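/- Let Ω ⊆ ℝ^N be open, M > 0, and let u : ℝ^N → ℝ be continuously differentiable with ∇u Lipschitz on B(0,1), satisfying: Δu + u = χ_Ω in B(0,1) in the sense of distributions (∫ u·(Δφ + φ) dx = ∫_Ω φ dx for every smooth φ compactly supported in B(0,1)), u = 0 and ∇u = 0 on B(0,1) \ Ω, sup_{B(0,1)} |u| ≤ M, and 0 ∈ ∂Ω. Then for every unit vector e there exist constants C > 0 and r₀ ∈ (0,1), depending only on N and M, such that the function r ↦ e^{C·r}·φ(r, D_e u) is monotone nondecreasing on (0, r₀), where D_e u is the directional derivative of u in direction e. -/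

import Mathlib

open MeasureTheory Metric Set Filter
open scoped RealInnerProductSpace

noncomputable section

/-- The Laplacian of `φ` at `x`, as the sum of the pure second derivatives. -/
def lap (N : ℕ) (φ : EuclideanSpace ℝ (Fin N) → ℝ) (x : EuclideanSpace ℝ (Fin N)) : ℝ :=
  ∑ i : Fin N,
    fderiv ℝ (fun y => fderiv ℝ φ y (EuclideanSpace.single i 1)) x (EuclideanSpace.single i 1)

/-- Membership in the class `P_r(z, M)`. -/
def MemP (N : ℕ) (r : ℝ) (z : EuclideanSpace ℝ (Fin N)) (M : ℝ)
    (Ω : Set (EuclideanSpace ℝ (Fin N))) (u : EuclideanSpace ℝ (Fin N) → ℝ) : Prop :=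
  IsOpen Ω ∧ ContDiff ℝ 1 u ∧
    (∀ φ : EuclideanSpace ℝ (Fin N) → ℝ, ContDiff ℝ (⊤ : ℕ∞) φ → tsupport φ ⊆ ball z r →
      ∫ x, u x * lap N φ x = ∫ x in Ω, φ x) ∧
    (∀ x ∈ ball z r \ Ω, u x = 0 ∧ gradient u x = 0) ∧
    (∀ x ∈ ball z r, |u x| ≤ M) ∧
    z ∈ frontier Ω

/-- Membership in the class `P_∞(0, M)` of global solutions with quadratic growth. -/
def MemPinf (N : ℕ) (M : ℝ) (Ω : Set (EuclideanSpace ℝ (Fin N)))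
    (u : EuclideanSpace ℝ (Fin N) → ℝ) : Prop :=
  IsOpen Ω ∧ ContDiff ℝ 1 u ∧
    (∀ φ : EuclideanSpace ℝ (Fin N) → ℝ, ContDiff ℝ (⊤ : ℕ∞) φ → HasCompactSupport φ →
      ∫ x, u x * lap N φ x = ∫ x in Ω, φ x) ∧
    (∀ x ∈ Ωᶜ, u x = 0 ∧ gradient u x = 0) ∧
    (0 : EuclideanSpace ℝ (Fin N)) ∈ frontier Ω ∧
    (∀ x, |u x| ≤ M * (‖x‖ ^ 2 + 1))

/-- The minimum diameter of a set: the smallest width of a slab containing it. -/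
def MD (N : ℕ) (D : Set (EuclideanSpace ℝ (Fin N))) : ℝ :=
  ⨅ e : {e : EuclideanSpace ℝ (Fin N) // ‖e‖ = 1},
    ((⨆ x : D, ⟪(x : EuclideanSpace ℝ (Fin N)), (e : EuclideanSpace ℝ (Fin N))⟫) -
      ⨅ x : D, ⟪(x : EuclideanSpace ℝ (Fin N)), (e : EuclideanSpace ℝ (Fin N))⟫)

/-- The density function `δ_r(u)`. -/
def deltaFn (N : ℕ) (u : EuclideanSpace ℝ (Fin N) → ℝ) (r : ℝ) : ℝ :=
  MD N ({x | u x = 0 ∧ gradient u x = 0} ∩ ball 0 r) / r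

/-- Half-space solutions `x ↦ (max(⟪x,e⟫,0))²/2`. -/
def IsHalfSpaceSol (N : ℕ) (u : EuclideanSpace ℝ (Fin N) → ℝ) : Prop :=
  ∃ e : EuclideanSpace ℝ (Fin N), ‖e‖ = 1 ∧ ∀ x, u x = (max ⟪x, e⟫ 0) ^ 2 / 2

/-- `∂Ω ∩ B` is the graph of a `C¹` function. -/
def IsC1Graph (N : ℕ) (Ω B : Set (EuclideanSpace ℝ (Fin N))) : Prop :=
  ∃ (e : EuclideanSpace ℝ (Fin N)) (f : EuclideanSpace ℝ (Fin N) → ℝ),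
    ‖e‖ = 1 ∧ ContDiff ℝ 1 f ∧
    Ω ∩ B = {x ∈ B | f (x - ⟪x, e⟫ • e) < ⟪x, e⟫} ∧
    frontier Ω ∩ B = {x ∈ B | ⟪x, e⟫ = f (x - ⟪x, e⟫ • e)}

/-- `∂Ω ∩ B` is the graph of a real-analytic function. -/
def IsAnalyticGraph (N : ℕ) (Ω B : Set (EuclideanSpace ℝ (Fin N))) : Prop :=
  ∃ (e : EuclideanSpace ℝ (Fin N)) (f : EuclideanSpace ℝ (Fin N) → ℝ),
    ‖e‖ = 1 ∧ (∀ x, AnalyticAt ℝ f x) ∧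
    Ω ∩ B = {x ∈ B | f (x - ⟪x, e⟫ • e) < ⟪x, e⟫} ∧
    frontier Ω ∩ B = {x ∈ B | ⟪x, e⟫ = f (x - ⟪x, e⟫ • e)}

/-- The Alt–Caffarelli–Friedman functional `φ(r, v)` centered at the origin. -/
def acf (N : ℕ) (v : EuclideanSpace ℝ (Fin N) → ℝ) (r : ℝ) : ℝ :=
  r ^ (-4 : ℤ) *
    (∫ x in ball (0 : EuclideanSpace ℝ (Fin N)) r,
      ‖gradient (fun y => max (v y) 0) x‖ ^ 2 * ‖x‖ ^ ((2 : ℤ) - (N : ℤ))) *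
    ∫ x in ball (0 : EuclideanSpace ℝ (Fin N)) r,
      ‖gradient (fun y => max (-v y) 0) x‖ ^ 2 * ‖x‖ ^ ((2 : ℤ) - (N : ℤ))

/-- `S_j(z, u) = sup_{B(z, 2^{-j})} |u|`. -/
def Sj (N : ℕ) (z : EuclideanSpace ℝ (Fin N)) (u : EuclideanSpace ℝ (Fin N) → ℝ) (j : ℕ) : ℝ :=
  sSup ((fun x => |u x|) '' ball z ((2 : ℝ) ^ (-(j : ℤ))))

/-! ### Symmetric positive operators on bounded measurable functions -/

/-- Bounded measurable real functions. -/
def BddMeas {α : Type*} [MeasurableSpace α] (f : α → ℝ) : Prop :=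
  Measurable f ∧ ∃ C, ∀ x, |f x| ≤ C

namespace BddMeas

variable {α : Type*} [MeasurableSpace α] {f g : α → ℝ}

lemma add (hf : BddMeas f) (hg : BddMeas g) : BddMeas (fun x => f x + g x) := by
  obtain ⟨hfm, C, hC⟩ := hf
  obtain ⟨hgm, D, hD⟩ := hg
  exact ⟨hfm.add hgm, C + D, fun x => (abs_add_le _ _).trans (add_le_add (hC x) (hD x))⟩

lemma mul (hf : BddMeas f) (hg : BddMeas g) : BddMeas (fun x => f x * g x) := by
  obtain ⟨hfm, C, hC⟩ := hf
  obtain ⟨hgm, D, hD⟩ := hg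
  refine ⟨hfm.mul hgm, C * D, fun x => ?_⟩
  rw [abs_mul]
  exact mul_le_mul (hC x) (hD x) (abs_nonneg _) ((abs_nonneg _).trans (hC x))

lemma const (a : ℝ) : BddMeas (fun _ : α => a) :=
  ⟨measurable_const, |a|, fun _ => le_rfl⟩

lemma const_mul (hf : BddMeas f) (a : ℝ) : BddMeas (fun x => a * f x) :=
  (const a).mul hf

lemma integrable {μ : Measure α} [IsFiniteMeasure μ] (hf : BddMeas f) : Integrable f μ := by
  obtain ⟨hfm, C, hC⟩ := hf
  exact Integrable.of_bound hfm.aestronglyMeasurable C (Eventually.of_forall hC)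

lemma indicator (hf : BddMeas f) {A : Set α} (hA : MeasurableSet A) :
    BddMeas (A.indicator f) := by
  obtain ⟨hfm, C, hC⟩ := hf
  refine ⟨hfm.indicator hA, C, fun x => ?_⟩
  by_cases hx : x ∈ A
  · simpa [hx] using hC x
  · simpa [hx] using (abs_nonneg _).trans (hC x)

lemma sum {ι : Type*} (s : Finset ι) {F : ι → α → ℝ} (hF : ∀ i, BddMeas (F i)) :
    BddMeas (fun x => ∑ i ∈ s, F i x) := by
  classical
  induction s using Finset.induction_on with
  | empty => simpa using const 0
  | insert i s hi ih => simpa [Finset.sum_insert hi] using (hF i).add ih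

end BddMeas

lemma sq_integral_mul_le {α : Type*} [MeasurableSpace α] {μ : Measure α} {f g : α → ℝ}
    (hf : Integrable (fun x => f x * f x) μ) (hg : Integrable (fun x => g x * g x) μ)
    (hfg : Integrable (fun x => f x * g x) μ) :
    (∫ x, f x * g x ∂μ) ^ 2 ≤ (∫ x, f x * f x ∂μ) * ∫ x, g x * g x ∂μ := by
  have h := discrim_le_zero (a := ∫ x, f x * f x ∂μ) (b := 2 * ∫ x, f x * g x ∂μ)
    (c := ∫ x, g x * g x ∂μ) (fun t => by
      have : 0 ≤ ∫ x, (t * f x + g x) ^ 2 ∂μ := integral_nonneg fun x => sq_nonneg _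
      have e : ∫ x, (t * f x + g x) ^ 2 ∂μ =
          ∫ x, (t * t) * (f x * f x) + (2 * t) * (f x * g x) + g x * g x ∂μ := by
        congr 1; ext x; ring
      rw [e, integral_add (by fun_prop) hg, integral_add (by fun_prop) (by fun_prop),
        integral_const_mul, integral_const_mul] at this
      linarith)
  unfold discrim at h
  nlinarith

/-- A positive linear operator on bounded measurable functions which is symmetric with respect
to `μ` and whose values vanish off `A`. -/
structure IsSymmPosOp {α : Type*} [MeasurableSpace α] (μ : Measure α) (A : Set α)
    (Q : (α → ℝ) → α → ℝ) : Prop where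
  bddMeas : ∀ f, BddMeas f → BddMeas (Q f)
  map_add : ∀ f g, BddMeas f → BddMeas g → Q (fun x => f x + g x) = fun x => Q f x + Q g x
  map_mul : ∀ (a : ℝ) f, Q (fun x => a * f x) = fun x => a * Q f x
  nonneg : ∀ f, BddMeas f → (∀ x, 0 ≤ f x) → ∀ x, 0 ≤ Q f x
  symm : ∀ f g, BddMeas f → BddMeas g → ∫ x, Q f x * g x ∂μ = ∫ x, f x * Q g x ∂μ
  eq_zero : ∀ f, BddMeas f → ∀ x ∉ A, Q f x = 0

namespace IsSymmPosOp

variable {α : Type*} [MeasurableSpace α] {μ : Measure α} {A : Set α}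
  {Q : (α → ℝ) → α → ℝ}

lemma bddMeas_iterate (hQ : IsSymmPosOp μ A Q) {f : α → ℝ} (hf : BddMeas f) (n : ℕ) :
    BddMeas (Q^[n] f) := by
  induction n with
  | zero => simpa
  | succ n ih => rw [Function.iterate_succ_apply']; exact hQ.bddMeas _ ih

lemma iterate_nonneg (hQ : IsSymmPosOp μ A Q) {f : α → ℝ} (hf : BddMeas f)
    (h0 : ∀ x, 0 ≤ f x) (n : ℕ) : ∀ x, 0 ≤ Q^[n] f x := by
  induction n with
  | zero => simpa
  | succ n ih =>
    rw [Function.iterate_succ_apply']; exact hQ.nonneg _ (hQ.bddMeas_iterate hf n) ih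

lemma integral_iterate_mul (hQ : IsSymmPosOp μ A Q) {f : α → ℝ} (hf : BddMeas f) (m n : ℕ) :
    ∫ x, Q^[m + n] f x * f x ∂μ = ∫ x, Q^[m] f x * Q^[n] f x ∂μ := by
  induction n generalizing m with
  | zero => simp
  | succ n ih =>
    rw [show m + (n + 1) = (m + 1) + n by ring, ih, Function.iterate_succ_apply',
      Function.iterate_succ_apply']
    exact hQ.symm _ _ (hQ.bddMeas_iterate hf m) (hQ.bddMeas_iterate hf n)

lemma map_sum (hQ : IsSymmPosOp μ A Q) {F : ℕ → α → ℝ} (hF : ∀ i, BddMeas (F i)) (n : ℕ) :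
    Q (fun x => ∑ j ∈ Finset.range n, F j x) = fun x => ∑ j ∈ Finset.range n, Q (F j) x := by
  induction n with
  | zero => simpa using hQ.map_mul 0 (fun _ => 0)
  | succ n ih =>
    simp_rw [Finset.sum_range_succ]
    rw [hQ.map_add _ _ (BddMeas.sum _ hF) (hF n), ih]

variable [IsProbabilityMeasure μ]

/-- Geometric growth of the norms of the iterates, from one step. -/
lemma pow_mul_le_integral_iterate (hQ : IsSymmPosOp μ A Q) {f : α → ℝ} (hf : BddMeas f)
    (hpos : 0 < ∫ x, f x * f x ∂μ) {κ : ℝ} (hκ : 0 < κ)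
    (hle : κ * ∫ x, f x * f x ∂μ ≤ ∫ x, Q f x * f x ∂μ) (n : ℕ) :
    κ ^ (2 * n) * ∫ x, f x * f x ∂μ ≤ ∫ x, Q^[n] f x * Q^[n] f x ∂μ := by
  set b : ℕ → ℝ := fun n => ∫ x, Q^[n] f x * Q^[n] f x ∂μ with hb
  have hB := hQ.bddMeas_iterate hf
  have hI : ∀ i j, Integrable (fun x => Q^[i] f x * Q^[j] f x) μ :=
    fun i j => ((hB i).mul (hB j)).integrable
  have b0 : b 0 = ∫ x, f x * f x ∂μ := by simp [hb]
  have hstep : ∀ n, b (n + 1) ^ 2 ≤ b n * b (n + 2) := by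
    intro n
    have := sq_integral_mul_le (hI n n) (hI (n + 2) (n + 2)) (hI n (n + 2))
    rwa [← hQ.integral_iterate_mul hf n (n + 2),
      show n + (n + 2) = (n + 1) + (n + 1) by ring, hQ.integral_iterate_mul hf] at this
  have hb1 : κ ^ 2 * b 0 ≤ b 1 := by
    have h := sq_integral_mul_le (hI 1 1) (hI 0 0) (hI 1 0)
    have h' : (κ * b 0) ^ 2 ≤ b 1 * b 0 := by
      refine le_trans ?_ h
      rw [b0]
      exact pow_le_pow_left₀ (by positivity) (by simpa using hle) 2
    rw [← b0] at hpos
    have : κ ^ 2 * b 0 * b 0 ≤ b 1 * b 0 := by nlinarith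
    exact le_of_mul_le_mul_right this hpos
  have key : ∀ n, 0 < b n ∧ κ ^ 2 * b n ≤ b (n + 1) := by
    intro n
    induction n with
    | zero => exact ⟨by rwa [b0], hb1⟩
    | succ n ih =>
      obtain ⟨h1, h2⟩ := ih
      have h3 : 0 < b (n + 1) := lt_of_lt_of_le (by positivity) h2
      refine ⟨h3, ?_⟩
      have h4 := hstep n
      have : κ ^ 2 * b (n + 1) * b n ≤ b (n + 2) * b n := by nlinarith
      exact le_of_mul_le_mul_right this h1
  rw [← b0]
  induction n with
  | zero => simp [hb]
  | succ n ih =>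
    calc κ ^ (2 * (n + 1)) * b 0 = κ ^ 2 * (κ ^ (2 * n) * b 0) := by ring
      _ ≤ κ ^ 2 * b n := by gcongr
      _ ≤ b (n + 1) := (key n).2

/-- A Rayleigh quotient bound yields a bounded function that is almost a subsolution. -/
theorem exists_almost_subsolution (hQ : IsSymmPosOp μ A Q) {f : α → ℝ} (hf : BddMeas f)
    (h0 : ∀ x, 0 ≤ f x) (hA : ∀ x ∉ A, f x = 0)
    (hpos : 0 < ∫ x, f x * f x ∂μ) {κ : ℝ} (hκ : 0 < κ)
    (hle : κ * ∫ x, f x * f x ∂μ ≤ ∫ x, Q f x * f x ∂μ) {ε : ℝ} (hε : 0 < ε) :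
    ∃ F : α → ℝ, BddMeas F ∧ (∀ x, 0 ≤ F x) ∧ (∀ x, F x ≤ 1) ∧ (∀ x ∉ A, F x = 0) ∧
      (∃ x, 1 / 2 ≤ F x) ∧ ∀ x, κ * (F x - ε) ≤ Q F x := by
  obtain ⟨C, hC⟩ := hf.2
  have hB := hQ.bddMeas_iterate hf
  set S : ℕ → α → ℝ := fun n x => ∑ j ∈ Finset.range n, κ⁻¹ ^ j * Q^[j] f x with hS
  have hSB : ∀ n, BddMeas (S n) := fun n => BddMeas.sum _ fun j => (hB j).const_mul _
  have hS0 : ∀ n x, 0 ≤ S n x := fun n x => Finset.sum_nonneg fun j _ =>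
    mul_nonneg (by positivity) (hQ.iterate_nonneg hf h0 j x)
  have hQS : ∀ n x, κ * (S n x - f x) ≤ Q (S n) x := by
    intro n x
    have h1 : Q (S n) x = κ * (S (n + 1) x - f x) := by
      rw [hS, hQ.map_sum (F := fun j x => κ⁻¹ ^ j * Q^[j] f x) (fun j => (hB j).const_mul _)]
      simp only [hQ.map_mul, ← Function.iterate_succ_apply']
      rw [Finset.sum_range_succ', add_sub_assoc]
      simp only [pow_zero, Function.iterate_zero, id_eq, one_mul, sub_self, add_zero,
        Finset.mul_sum]
      refine Finset.sum_congr rfl fun j _ => ?_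
      rw [pow_succ]; field_simp
    rw [h1]
    have : S n x ≤ S (n + 1) x := by
      simp only [hS]
      rw [Finset.sum_range_succ]
      have := mul_nonneg (by positivity : 0 ≤ κ⁻¹ ^ n) (hQ.iterate_nonneg hf h0 n x)
      linarith
    gcongr
  have hSint : ∀ n : ℕ, n * ∫ x, f x * f x ∂μ ≤ ∫ x, S (2 * n) x * f x ∂μ := by
    intro n
    induction n with
    | zero => simp [hS]
    | succ n ih =>
      have e : ∀ x, S (2 * (n + 1)) x * f x = S (2 * n) x * f x +
          κ⁻¹ ^ (2 * n) * (Q^[2 * n] f x * f x) +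
          κ⁻¹ ^ (2 * n + 1) * (Q^[2 * n + 1] f x * f x) := by
        intro x
        simp only [hS]
        rw [show 2 * (n + 1) = 2 * n + 1 + 1 by ring, Finset.sum_range_succ,
          Finset.sum_range_succ]
        ring
      simp_rw [e]
      have i1 := ((hSB (2 * n)).mul hf).integrable (μ := μ)
      have i2 := (((hB (2 * n)).mul hf).const_mul (κ⁻¹ ^ (2 * n))).integrable (μ := μ)
      have i3 := (((hB (2 * n + 1)).mul hf).const_mul (κ⁻¹ ^ (2 * n + 1))).integrable (μ := μ)
      rw [integral_add (by fun_prop) i3, integral_add i1 i2, integral_const_mul]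
      have h1 := hQ.pow_mul_le_integral_iterate hf hpos hκ hle n
      rw [← hQ.integral_iterate_mul hf, ← two_mul] at h1
      have h2 : 0 ≤ ∫ x, κ⁻¹ ^ (2 * n + 1) * (Q^[2 * n + 1] f x * f x) ∂μ :=
        integral_nonneg fun x => mul_nonneg (by positivity)
          (mul_nonneg (hQ.iterate_nonneg hf h0 _ x) (h0 x))
      have h3 : ∫ x, f x * f x ∂μ ≤ κ⁻¹ ^ (2 * n) * ∫ x, Q^[2 * n] f x * f x ∂μ := by
        calc ∫ x, f x * f x ∂μ = κ⁻¹ ^ (2 * n) * (κ ^ (2 * n) * ∫ x, f x * f x ∂μ) := by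
              rw [← mul_assoc, ← mul_pow, inv_mul_cancel₀ hκ.ne', one_pow, one_mul]
          _ ≤ _ := by gcongr
      push_cast
      linarith
  have hCpos : 0 < C := by
    by_contra! hc
    have : ∀ x, f x = 0 := fun x => abs_eq_zero.1 (le_antisymm ((hC x).trans hc) (abs_nonneg _))
    simp [this] at hpos
  -- a large multiple of the squared norm
  obtain ⟨n, hn⟩ := exists_nat_gt ((C / ε) * C / ∫ x, f x * f x ∂μ)
  rw [div_lt_iff₀ hpos] at hn
  set M := ⨆ x, S (2 * n) x with hM
  have hbdd : BddAbove (range (S (2 * n))) := by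
    obtain ⟨K, hK⟩ := (hSB (2 * n)).2
    exact ⟨K, by rintro _ ⟨x, rfl⟩; exact (le_abs_self _).trans (hK x)⟩
  have hle_M : ∀ x, S (2 * n) x ≤ M := fun x => le_ciSup hbdd x
  have hne : Nonempty α := by
    by_contra hne
    rw [not_nonempty_iff] at hne
    have : μ univ = 0 := by rw [univ_eq_empty_iff.2 hne]; simp
    simp at this
  have hM0 : 0 ≤ M := (hS0 _ hne.some).trans (hle_M hne.some)
  have hMC : C / ε ≤ M := by
    have h1 : ∫ x, S (2 * n) x * f x ∂μ ≤ ∫ x, M * C ∂μ := by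
      refine integral_mono ((hSB _).mul hf).integrable (integrable_const _) fun x => ?_
      exact mul_le_mul (hle_M x) ((le_abs_self _).trans (hC x)) (h0 x) hM0
    simp only [integral_const, probReal_univ, one_smul] at h1
    have h2 := hSint n
    have : C / ε * C ≤ M * C := by linarith
    exact le_of_mul_le_mul_right this hCpos
  have hMpos : 0 < M := lt_of_lt_of_le (by positivity) hMC
  refine ⟨fun x => M⁻¹ * S (2 * n) x, (hSB _).const_mul _,
    fun x => mul_nonneg (by positivity) (hS0 _ x), fun x => ?_, fun x hx => ?_, ?_, fun x => ?_⟩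
  · rw [inv_mul_le_iff₀ hMpos, mul_one]; exact hle_M x
  · have : S (2 * n) x = 0 := by
      simp only [hS]
      refine Finset.sum_eq_zero fun j _ => ?_
      cases j with
      | zero => simp [hA x hx]
      | succ j => rw [Function.iterate_succ_apply', hQ.eq_zero _ (hB j) x hx, mul_zero]
    simp [this]
  · obtain ⟨x, hx⟩ := exists_lt_of_lt_ciSup (show M / 2 < ⨆ x, S (2 * n) x by rw [← hM]; linarith)
    refine ⟨x, ?_⟩
    beta_reduce
    rw [inv_mul_eq_div, le_div_iff₀ hMpos]
    linarith
  · rw [hQ.map_mul]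
    have h1 := hQS (2 * n) x
    have h2 : M⁻¹ * f x ≤ ε := by
      rw [inv_mul_le_iff₀ hMpos]
      rw [div_le_iff₀ hε] at hMC
      exact ((le_abs_self _).trans (hC x)).trans hMC
    calc κ * (M⁻¹ * S (2 * n) x - ε) ≤ κ * (M⁻¹ * S (2 * n) x - M⁻¹ * f x) := by gcongr
      _ = M⁻¹ * (κ * (S (2 * n) x - f x)) := by ring
      _ ≤ M⁻¹ * Q (S (2 * n)) x := by gcongr

end IsSymmPosOp

/-! ### The Mehler (Ornstein–Uhlenbeck) averaging operator -/

section Mehler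

open ProbabilityTheory Real

variable {E : Type*} [NormedAddCommGroup E] [InnerProductSpace ℝ E] [FiniteDimensional ℝ E]
  [MeasurableSpace E] [BorelSpace E]

/-- Averaging of `F` over `cos θ • x + sin θ • Z` with `Z` a standard Gaussian vector. -/
def mehler (θ : ℝ) (F : E → ℝ) (x : E) : ℝ :=
  ∫ z, F (cos θ • x + sin θ • z) ∂stdGaussian E

lemma measurePreserving_rotation_stdGaussian (θ : ℝ) :
    MeasurePreserving (fun p : E × E => (cos θ • p.1 + sin θ • p.2, -sin θ • p.1 + cos θ • p.2))
      ((stdGaussian E).prod (stdGaussian E)) ((stdGaussian E).prod (stdGaussian E)) :=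
  ⟨by fun_prop, IsGaussian.map_rotation_eq_self (by simp [integral_id_stdGaussian]) θ⟩

lemma measurePreserving_cos_add_sin (θ : ℝ) :
    MeasurePreserving (fun p : E × E => cos θ • p.1 + sin θ • p.2)
      ((stdGaussian E).prod (stdGaussian E)) (stdGaussian E) :=
  measurePreserving_fst.comp (measurePreserving_rotation_stdGaussian θ)

lemma measurePreserving_neg_stdGaussian :
    MeasurePreserving (fun x : E => -x) (stdGaussian E) (stdGaussian E) :=
  ⟨by fun_prop, by simpa using stdGaussian_map (LinearIsometryEquiv.neg ℝ (E := E))⟩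

lemma BddMeas.comp {α β : Type*} [MeasurableSpace α] [MeasurableSpace β] {f : β → ℝ}
    (hf : BddMeas f) {g : α → β} (hg : Measurable g) : BddMeas (fun x => f (g x)) := by
  obtain ⟨hfm, C, hC⟩ := hf
  exact ⟨hfm.comp hg, C, fun x => hC _⟩

lemma bddMeas_mehler (θ : ℝ) {F : E → ℝ} (hF : BddMeas F) : BddMeas (mehler θ F) := by
  obtain ⟨C, hC⟩ := hF.2
  refine ⟨?_, C, fun x => ?_⟩
  · refine (StronglyMeasurable.integral_prod_right'
      (f := fun p : E × E => F (cos θ • p.1 + sin θ • p.2)) ?_).measurable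
    exact (hF.1.comp (by fun_prop)).stronglyMeasurable
  · have := norm_integral_le_of_norm_le_const (μ := stdGaussian E)
      (f := fun z => F (cos θ • x + sin θ • z)) (Eventually.of_forall fun z => hC _)
    simpa [mehler] using this

lemma integral_mehler_mul (θ : ℝ) {F G : E → ℝ} (hF : BddMeas F) (hG : BddMeas G) :
    ∫ x, mehler θ F x * G x ∂stdGaussian E =
      ∫ p, F (cos θ • p.1 + sin θ • p.2) * G p.1 ∂(stdGaussian E).prod (stdGaussian E) := by
  rw [integral_prod]
  · simp_rw [mehler, integral_mul_const]
  · exact ((hF.comp (by fun_prop)).mul (hG.comp (by fun_prop))).integrable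

lemma integral_mehler_mul_comm (θ : ℝ) {F G : E → ℝ} (hF : BddMeas F) (hG : BddMeas G) :
    ∫ x, mehler θ F x * G x ∂stdGaussian E = ∫ x, F x * mehler θ G x ∂stdGaussian E := by
  simp_rw [mul_comm (F _)]
  rw [integral_mehler_mul θ hF hG, integral_mehler_mul θ hG hF]
  have hneg : MeasurePreserving (Prod.map (fun x : E => x) (fun x : E => -x))
      ((stdGaussian E).prod (stdGaussian E)) ((stdGaussian E).prod (stdGaussian E)) :=
    (MeasurePreserving.id _).prod measurePreserving_neg_stdGaussian
  have h := hneg.comp (measurePreserving_rotation_stdGaussian (E := E) θ)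
  conv_rhs => rw [← h.map_eq]
  rw [integral_map h.measurable.aemeasurable]
  · congr 1
    ext p
    simp only [Function.comp_apply, Prod.map_fst, Prod.map_snd]
    rw [mul_comm]
    congr 2
    rw [smul_neg, smul_add, smul_add, smul_smul, smul_smul, smul_smul, smul_smul, neg_add]
    have : p.1 = (cos θ * cos θ + sin θ * sin θ) • p.1 := by
      rw [← sq, ← sq, cos_sq_add_sin_sq, one_smul]
    conv_lhs => rw [this]
    rw [add_smul, mul_comm (cos θ) (sin θ)]
    simp only [mul_neg, neg_smul, neg_neg]
    abel
  · exact ((hG.comp (by fun_prop)).mul (hF.comp (by fun_prop))).1.aestronglyMeasurable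

lemma isSymmPosOp_indicator_mehler (θ : ℝ) {A : Set E} (hA : MeasurableSet A) :
    IsSymmPosOp (stdGaussian E) A (fun f => A.indicator (mehler θ (A.indicator f))) where
  bddMeas f hf := (bddMeas_mehler θ (hf.indicator hA)).indicator hA
  map_add f g hf hg := by
    ext x
    by_cases hx : x ∈ A
    · simp only [hx, indicator_of_mem, mehler]
      rw [← integral_add]
      · congr 1; ext z
        by_cases hz : cos θ • x + sin θ • z ∈ A <;> simp [hz]
      · exact ((hf.indicator hA).comp (by fun_prop)).integrable
      · exact ((hg.indicator hA).comp (by fun_prop)).integrable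
    · simp [hx]
  map_mul a f := by
    ext x
    by_cases hx : x ∈ A
    · simp only [hx, indicator_of_mem, mehler]
      rw [← integral_const_mul]
      congr 1; ext z
      by_cases hz : cos θ • x + sin θ • z ∈ A <;> simp [hz]
    · simp [hx]
  nonneg f hf h0 x := by
    refine indicator_nonneg (fun x _ => integral_nonneg fun z => ?_) x
    exact indicator_nonneg (fun x _ => h0 x) _
  symm f g hf hg := by
    have e1 : ∀ x, A.indicator (mehler θ (A.indicator f)) x * g x =
        mehler θ (A.indicator f) x * A.indicator g x := by
      intro x; by_cases hx : x ∈ A <;> simp [hx]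
    have e2 : ∀ x, f x * A.indicator (mehler θ (A.indicator g)) x =
        A.indicator f x * mehler θ (A.indicator g) x := by
      intro x; by_cases hx : x ∈ A <;> simp [hx]
    simp_rw [e1, e2]
    exact integral_mehler_mul_comm θ (hf.indicator hA) (hg.indicator hA)
  eq_zero f _ x hx := by simp [hx]

lemma integral_sq_sub_eq (θ : ℝ) {F : E → ℝ} (hF : BddMeas F) :
    ∫ p, (F (cos θ • p.1 + sin θ • p.2) - F p.1) ^ 2 ∂(stdGaussian E).prod (stdGaussian E) =
      2 * (∫ x, F x * F x ∂stdGaussian E - ∫ x, mehler θ F x * F x ∂stdGaussian E) := by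
  rw [integral_mehler_mul θ hF hF]
  have h1 : ∫ p, F (cos θ • p.1 + sin θ • p.2) * F (cos θ • p.1 + sin θ • p.2)
      ∂(stdGaussian E).prod (stdGaussian E) = ∫ x, F x * F x ∂stdGaussian E := by
    conv_rhs => rw [← (measurePreserving_cos_add_sin (E := E) θ).map_eq]
    rw [integral_map (by fun_prop) (hF.mul hF).1.aestronglyMeasurable]
  have h2 : ∫ p, F p.1 * F p.1 ∂(stdGaussian E).prod (stdGaussian E) =
      ∫ x, F x * F x ∂stdGaussian E := by
    conv_rhs => rw [← (measurePreserving_fst (μ := stdGaussian E) (ν := stdGaussian E)).map_eq]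
    rw [integral_map (by fun_prop) (hF.mul hF).1.aestronglyMeasurable]
  have b1 : BddMeas fun p : E × E => F (cos θ • p.1 + sin θ • p.2) := hF.comp (by fun_prop)
  have b2 : BddMeas fun p : E × E => F p.1 := hF.comp (by fun_prop)
  have i1 := (b1.mul b1).integrable (μ := (stdGaussian E).prod (stdGaussian E))
  have i2 := (b2.mul b2).integrable (μ := (stdGaussian E).prod (stdGaussian E))
  have i3 := ((b1.mul b2).const_mul 2).integrable (μ := (stdGaussian E).prod (stdGaussian E))
  have e : ∀ p : E × E, (F (cos θ • p.1 + sin θ • p.2) - F p.1) ^ 2 =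
      F (cos θ • p.1 + sin θ • p.2) * F (cos θ • p.1 + sin θ • p.2) -
      2 * (F (cos θ • p.1 + sin θ • p.2) * F p.1) + F p.1 * F p.1 := fun p => by ring
  simp_rw [e]
  rw [integral_add (by fun_prop) i2, integral_sub i1 i3, integral_const_mul, h1, h2]
  ring

/-- A Dirichlet energy bound yields an almost subsolution for the Mehler operator. -/
theorem exists_almost_subsolution_mehler {θ : ℝ} {A : Set E} (hA : MeasurableSet A) {f : E → ℝ}
    (hf : BddMeas f) (h0 : ∀ x, 0 ≤ f x) (hfA : ∀ x ∉ A, f x = 0)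
    (hpos : 0 < ∫ x, f x * f x ∂stdGaussian E) {δ : ℝ} (hδ : δ < 1)
    (hle : ∫ p, (f (cos θ • p.1 + sin θ • p.2) - f p.1) ^ 2
      ∂(stdGaussian E).prod (stdGaussian E) ≤ 2 * δ * ∫ x, f x * f x ∂stdGaussian E)
    {ε : ℝ} (hε : 0 < ε) :
    ∃ F : E → ℝ, BddMeas F ∧ (∀ x, 0 ≤ F x) ∧ (∀ x, F x ≤ 1) ∧ (∀ x ∉ A, F x = 0) ∧
      (∃ x, 1 / 2 ≤ F x) ∧ ∀ x ∈ A, (1 - δ) * (F x - ε) ≤ mehler θ F x := by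
  rw [integral_sq_sub_eq θ hf] at hle
  have hfi : A.indicator f = f := indicator_eq_self.2 fun x hx => by
    by_contra h; exact hx (hfA x h)
  obtain ⟨F, h1, h2, h3, h4, h5, h6⟩ :=
    (isSymmPosOp_indicator_mehler (E := E) θ hA).exists_almost_subsolution hf h0 hfA hpos
    (κ := 1 - δ) (by linarith) (by
      have : ∫ x, A.indicator (mehler θ (A.indicator f)) x * f x ∂stdGaussian E =
          ∫ x, mehler θ f x * f x ∂stdGaussian E := by
        rw [hfi]
        congr 1; ext x
        by_cases hx : x ∈ A
        · simp [hx]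
        · simp [hx, hfA x hx]
      rw [this]; linarith) hε
  refine ⟨F, h1, h2, h3, h4, h5, fun x hx => ?_⟩
  have hFi : A.indicator F = F := indicator_eq_self.2 fun x hx => by
    by_contra h; exact hx (h4 x h)
  simpa [hx, hFi] using h6 x

end Mehler

/-! ### The two-point maximum argument -/

lemma add_le_two_mul_add_of_mul_le_sq {p r m w α β : ℝ} (hm : 1 / 2 ≤ m)
    (hpr : p * r ≤ m ^ 2) (hp : p ≤ α) (hr : r ≤ β) (hα : |α - m| ≤ w) (hβ : |β - m| ≤ w) :
    p + r ≤ 2 * m + 2 * w ^ 2 := by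
  have key : ∀ p r : ℝ, p * r ≤ m ^ 2 → p - m ≤ w → m < p → p + r ≤ 2 * m + 2 * w ^ 2 := by
    intro p r h h1 h2
    by_contra! h3
    have h4 : (p - m) ^ 2 ≤ w ^ 2 := pow_le_pow_left₀ (by linarith) h1 2
    have h5 : p * (2 * w ^ 2) < p * (p + r - 2 * m) := by
      apply mul_lt_mul_of_pos_left <;> linarith
    nlinarith [sq_nonneg w]
  have hα' := (abs_le.1 hα).2
  have hβ' := (abs_le.1 hβ).2
  rcases lt_or_ge m p with h | h
  · exact key p r hpr (by linarith) h
  rcases lt_or_ge m r with h' | h'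
  · have := key r p (by linarith) (by linarith) h'
    linarith
  · nlinarith [sq_nonneg w]

section TwoPoint

open ProbabilityTheory Real

variable {E : Type*} [NormedAddCommGroup E] [InnerProductSpace ℝ E]

lemma abs_norm_sq_div_sub_le {c s d D : ℝ} (hcs : c ^ 2 + s ^ 2 = 1) (hc : 0 ≤ c)
    (hd : 0 < d) {x y z : E} (hxy : d ≤ ‖x - y‖) (hx : ‖x‖ ≤ D) :
    |‖c • x + s • z - y‖ ^ 2 / ‖x - y‖ ^ 2 - (c + 2 * s * ⟪z, x - y⟫ / ‖x - y‖ ^ 2)| ≤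
      s ^ 2 * ((1 + 2 * D / d + 2 * (1 + D ^ 2) / d ^ 2) * (1 + ‖z‖ ^ 2)) := by
  have hρ : 0 < ‖x - y‖ := hd.trans_le hxy
  have hD : 0 ≤ D := (norm_nonneg _).trans hx
  set ρ := ‖x - y‖ with hρdef
  have hc1 : c ≤ 1 := by nlinarith [sq_nonneg s]
  have h1c : 1 - c ≤ s ^ 2 := by nlinarith
  have hs1 : s ^ 2 ≤ 1 := by nlinarith [sq_nonneg c]
  set q : E := s • z - (1 - c) • x with hq
  have e1 : ‖c • x + s • z - y‖ ^ 2 =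
      ρ ^ 2 + 2 * s * ⟪z, x - y⟫ - 2 * (1 - c) * ⟪x, x - y⟫ + ‖q‖ ^ 2 := by
    have : c • x + s • z - y = (x - y) + q := by rw [hq, sub_smul, one_smul]; abel
    rw [this, norm_add_sq_real, hq, inner_sub_right, real_inner_smul_right,
      real_inner_smul_right, real_inner_comm z, real_inner_comm x]
    ring
  have e2 : ‖c • x + s • z - y‖ ^ 2 / ρ ^ 2 - (c + 2 * s * ⟪z, x - y⟫ / ρ ^ 2) =
      (1 - c) - 2 * (1 - c) * (⟪x, x - y⟫ / ρ ^ 2) + ‖q‖ ^ 2 / ρ ^ 2 := by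
    rw [e1]; field_simp; ring
  have b1 : |⟪x, x - y⟫ / ρ ^ 2| ≤ D / d := by
    rw [abs_div, abs_of_pos (by positivity : 0 < ρ ^ 2)]
    have : |⟪x, x - y⟫| ≤ D * ρ := (abs_real_inner_le_norm _ _).trans (by gcongr)
    calc |⟪x, x - y⟫| / ρ ^ 2 ≤ D * ρ / ρ ^ 2 := by gcongr
      _ = D / ρ := by field_simp
      _ ≤ D / d := by gcongr
  have b2 : ‖q‖ ^ 2 / ρ ^ 2 ≤ s ^ 2 * (2 * (‖z‖ ^ 2 + D ^ 2) / d ^ 2) := by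
    have h1 : ‖q‖ ≤ |s| * ‖z‖ + |1 - c| * ‖x‖ := by
      rw [hq]; refine (norm_sub_le _ _).trans ?_; rw [norm_smul, norm_smul]; rfl
    have h2 : ‖q‖ ^ 2 ≤ 2 * (s ^ 2 * ‖z‖ ^ 2 + (1 - c) ^ 2 * ‖x‖ ^ 2) := by
      calc ‖q‖ ^ 2 ≤ (|s| * ‖z‖ + |1 - c| * ‖x‖) ^ 2 := by gcongr
        _ ≤ 2 * ((|s| * ‖z‖) ^ 2 + (|1 - c| * ‖x‖) ^ 2) := by
            nlinarith [sq_nonneg (|s| * ‖z‖ - |1 - c| * ‖x‖)]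
        _ = _ := by rw [mul_pow, mul_pow, sq_abs, sq_abs]
    have h3 : (1 - c) ^ 2 ≤ s ^ 2 := by nlinarith
    have h4 : ‖q‖ ^ 2 ≤ s ^ 2 * (2 * (‖z‖ ^ 2 + D ^ 2)) := by
      have : (1 - c) ^ 2 * ‖x‖ ^ 2 ≤ s ^ 2 * D ^ 2 := by gcongr
      linarith
    calc ‖q‖ ^ 2 / ρ ^ 2 ≤ (s ^ 2 * (2 * (‖z‖ ^ 2 + D ^ 2))) / d ^ 2 := by gcongr
      _ = _ := by ring
  rw [e2]
  have b3 : |(1 - c) - 2 * (1 - c) * (⟪x, x - y⟫ / ρ ^ 2) + ‖q‖ ^ 2 / ρ ^ 2| ≤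
      s ^ 2 + 2 * s ^ 2 * (D / d) + s ^ 2 * (2 * (‖z‖ ^ 2 + D ^ 2) / d ^ 2) := by
    refine (abs_add_le _ _).trans (add_le_add ?_ ?_)
    · refine (abs_sub _ _).trans (add_le_add ?_ ?_)
      · rwa [abs_of_nonneg (by linarith)]
      · rw [abs_mul, abs_of_nonneg (by linarith : 0 ≤ 2 * (1 - c))]
        gcongr
    · rwa [abs_of_nonneg (by positivity)]
  refine b3.trans ?_
  have : s ^ 2 * ((1 + 2 * D / d + 2 * (1 + D ^ 2) / d ^ 2) * (1 + ‖z‖ ^ 2)) -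
      (s ^ 2 + 2 * s ^ 2 * (D / d) + s ^ 2 * (2 * (‖z‖ ^ 2 + D ^ 2) / d ^ 2)) =
      s ^ 2 * ((1 + 2 * D / d) * ‖z‖ ^ 2 + 2 * (1 + D ^ 2 * ‖z‖ ^ 2) / d ^ 2) := by
    field_simp; ring
  have h0 : 0 ≤ s ^ 2 * ((1 + 2 * D / d) * ‖z‖ ^ 2 + 2 * (1 + D ^ 2 * ‖z‖ ^ 2) / d ^ 2) := by
    positivity
  linarith

/-- Almost maximisers of `F x * G y / ‖x - y‖ ^ 2`. -/
lemma exists_almost_max {E : Type*} [NormedAddCommGroup E] {A B : Set E} {F G : E → ℝ} {d D ε : ℝ} (hd : 0 < d) (hε : 0 < ε)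
    (hε1 : ε ≤ 1) (hAB : ∀ x ∈ A, ∀ y ∈ B, d ≤ ‖x - y‖) (hABD : ∀ x ∈ A, ∀ y ∈ B, ‖x - y‖ ≤ D)
    (F0 : ∀ x, 0 ≤ F x) (F1 : ∀ x, F x ≤ 1) (FA : ∀ x ∉ A, F x = 0) (Fx : ∃ x, 1 / 2 ≤ F x)
    (G0 : ∀ x, 0 ≤ G x) (G1 : ∀ x, G x ≤ 1) (GB : ∀ x ∉ B, G x = 0) (Gx : ∃ x, 1 / 2 ≤ G x) :
    ∃ x₀ ∈ A, ∃ y₀ ∈ B, d ^ 2 / (8 * D ^ 2) ≤ F x₀ ∧ d ^ 2 / (8 * D ^ 2) ≤ G y₀ ∧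
      ∀ x y, F x * G y * ‖x₀ - y₀‖ ^ 2 ≤ (1 + ε) * (F x₀ * G y₀) * ‖x - y‖ ^ 2 := by
  obtain ⟨x₁, hx₁⟩ := Fx
  obtain ⟨y₁, hy₁⟩ := Gx
  have hx₁A : x₁ ∈ A := by by_contra h; rw [FA _ h] at hx₁; norm_num at hx₁
  have hy₁B : y₁ ∈ B := by by_contra h; rw [GB _ h] at hy₁; norm_num at hy₁
  have hD : 0 < D := hd.trans_le ((hAB _ hx₁A _ hy₁B).trans (hABD _ hx₁A _ hy₁B))
  set Φ : A × B → ℝ := fun p => F p.1 * G p.2 / ‖(p.1 : E) - p.2‖ ^ 2 with hΦ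
  have hpos : ∀ p : A × B, 0 < ‖(p.1 : E) - p.2‖ := fun p =>
    hd.trans_le (hAB _ p.1.2 _ p.2.2)
  have hbdd : BddAbove (range Φ) := by
    refine ⟨1 / d ^ 2, ?_⟩
    rintro _ ⟨p, rfl⟩
    have h1 : F p.1 * G p.2 ≤ 1 := mul_le_one₀ (F1 _) (G0 _) (G1 _)
    have h2 := hAB _ p.1.2 _ p.2.2
    simp only [hΦ]; gcongr
  set S := ⨆ p, Φ p with hS
  have hle : ∀ p, Φ p ≤ S := fun p => le_ciSup hbdd p
  have hS1 : 1 / (4 * D ^ 2) ≤ S := by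
    refine le_trans ?_ (hle (⟨x₁, hx₁A⟩, ⟨y₁, hy₁B⟩))
    have h1 : 1 / 4 ≤ F x₁ * G y₁ := by nlinarith
    have h2 := hABD _ hx₁A _ hy₁B
    have h3 : 0 < ‖x₁ - y₁‖ := hpos (⟨x₁, hx₁A⟩, ⟨y₁, hy₁B⟩)
    calc 1 / (4 * D ^ 2) = 1 / 4 / D ^ 2 := by field_simp
      _ ≤ F x₁ * G y₁ / ‖x₁ - y₁‖ ^ 2 := by gcongr
  have hSpos : 0 < S := lt_of_lt_of_le (by positivity) hS1
  have hne : Nonempty (A × B) := ⟨(⟨x₁, hx₁A⟩, ⟨y₁, hy₁B⟩)⟩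
  obtain ⟨p, hp⟩ := exists_lt_of_lt_ciSup (show S / (1 + ε) < ⨆ p, Φ p by
    rw [← hS, div_lt_iff₀ (by positivity)]; nlinarith)
  rw [div_lt_iff₀ (by positivity)] at hp
  have hprod : d ^ 2 / (8 * D ^ 2) ≤ F p.1 * G p.2 := by
    have h1 : 1 / (8 * D ^ 2) ≤ Φ p := by
      have h0 : 0 ≤ Φ p := div_nonneg (mul_nonneg (F0 _) (G0 _)) (by positivity)
      have : 1 / (8 * D ^ 2) = 1 / (4 * D ^ 2) / 2 := by field_simp; norm_num
      nlinarith
    have h2 : F p.1 * G p.2 = Φ p * ‖(p.1 : E) - p.2‖ ^ 2 := by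
      simp only [hΦ]; field_simp [(hpos p).ne']
    have h3 := hAB _ p.1.2 _ p.2.2
    rw [h2]
    have h0 : 0 ≤ Φ p := le_trans (by positivity) h1
    calc d ^ 2 / (8 * D ^ 2) = 1 / (8 * D ^ 2) * d ^ 2 := by ring
      _ ≤ _ := by gcongr
  refine ⟨p.1, p.1.2, p.2, p.2.2, ?_, ?_, ?_⟩
  · exact hprod.trans (mul_le_of_le_one_right (F0 _) (G1 _))
  · exact hprod.trans (mul_le_of_le_one_left (G0 _) (F1 _))
  · intro x y
    have hnn : 0 ≤ (1 + ε) * (F p.1 * G p.2) * ‖x - y‖ ^ 2 :=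
      mul_nonneg (mul_nonneg (by linarith) (mul_nonneg (F0 _) (G0 _))) (by positivity)
    by_cases hx : x ∈ A
    · by_cases hy : y ∈ B
      · have h1 : Φ (⟨x, hx⟩, ⟨y, hy⟩) ≤ Φ p * (1 + ε) := (hle _).trans hp.le
        simp only [hΦ] at h1
        have h2 := hpos (⟨x, hx⟩, ⟨y, hy⟩)
        have h3 := hpos p
        simp only at h2
        rw [div_mul_eq_mul_div, div_le_div_iff₀ (by positivity) (by positivity)] at h1
        linarith
      · simpa [GB y hy] using hnn
    · simpa [FA x hx] using hnn

lemma inner_reflection_orthogonal_singleton (v z : E) :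
    ⟪(Submodule.span ℝ {v})ᗮ.reflection z, -v⟫ = ⟪z, v⟫ := by
  have h := Submodule.reflection_orthogonalComplement_singleton_eq_neg (𝕜 := ℝ) v
  conv_lhs => rw [← h]
  exact LinearIsometryEquiv.inner_map_map _ _ _

lemma reflection_orthogonal_singleton_apply (v z : E) :
    (Submodule.span ℝ {v})ᗮ.reflection z = z - (2 * ⟪z, v⟫ / ‖v‖ ^ 2) • v := by
  rw [Submodule.reflection_orthogonal_apply, Submodule.reflection_singleton_apply,
    real_inner_comm, two_smul, ← add_smul, neg_sub]
  congr 2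
  simp only [RCLike.ofReal_real_eq_id, id_eq]
  ring

variable [FiniteDimensional ℝ E] [MeasurableSpace E] [BorelSpace E]

lemma integral_inner_stdGaussian (v : E) : ∫ z, ⟪z, v⟫ ∂stdGaussian E = 0 := by
  simpa [real_inner_comm] using integral_strongDual_stdGaussian (innerSL ℝ v)

lemma integrable_norm_pow_stdGaussian (n : ℕ) :
    Integrable (fun z : E => ‖z‖ ^ n) (stdGaussian E) :=
  (IsGaussian.memLp_id (stdGaussian E) n (by simp)).integrable_norm_pow'

lemma integrable_one_add_norm_sq_sq_stdGaussian :
    Integrable (fun z : E => (1 + ‖z‖ ^ 2) ^ 2) (stdGaussian E) := by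
  have e : (fun z : E => (1 + ‖z‖ ^ 2) ^ 2) = fun z => 1 + 2 * ‖z‖ ^ 2 + ‖z‖ ^ 4 := by
    ext z; ring
  rw [e]
  exact ((integrable_const _).add ((integrable_norm_pow_stdGaussian 2).const_mul _)).add
    (integrable_norm_pow_stdGaussian 4)

/-- The pointwise comparison at an almost maximal pair. -/
lemma add_le_of_almost_max {c s d c₀ ρ m p r α β n : ℝ} (hc : 3 / 4 ≤ c) (hs : 0 ≤ s)
    (hd : 0 < d) (hc₀ : 0 < c₀) (hρ : d ≤ ρ) (hn : 0 ≤ n) {K : ℝ}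
    (hm : |m - c| ≤ 2 * s * n / ρ) (hpr : p * r ≤ m ^ 2) (hpα : p ≤ α) (hrβ : r ≤ β)
    (hp1 : p ≤ 1 / c₀) (hr1 : r ≤ 1 / c₀) (hα : |α - m| ≤ s ^ 2 * (K * (1 + n ^ 2)))
    (hβ : |β - m| ≤ s ^ 2 * (K * (1 + n ^ 2))) :
    p + r ≤ 2 * m + (2 * K ^ 2 + (2 / c₀ + 1) * (8 / d) ^ 4) * s ^ 4 * (1 + n ^ 2) ^ 2 := by
  have hm' : |m - c| ≤ 2 * s * n / d := hm.trans (by gcongr)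
  have hlow := (abs_le.1 hm').1
  set t := 8 * s * n / d with ht
  have ht0 : 0 ≤ t := by positivity
  have hmt : 2 * s * n / d = t / 4 := by rw [ht]; ring
  rw [hmt] at hlow
  have ht4 : t ^ 4 ≤ (8 / d) ^ 4 * s ^ 4 * (1 + n ^ 2) ^ 2 := by
    have : t ^ 4 = (8 / d) ^ 4 * s ^ 4 * n ^ 4 := by rw [ht]; ring
    rw [this]
    gcongr
    nlinarith [sq_nonneg n]
  rcases le_or_gt t 1 with h | h
  · have := add_le_two_mul_add_of_mul_le_sq (by linarith) hpr hpα hrβ hα hβ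
    refine this.trans ?_
    have e : 2 * (s ^ 2 * (K * (1 + n ^ 2))) ^ 2 = 2 * K ^ 2 * s ^ 4 * (1 + n ^ 2) ^ 2 := by ring
    have : 0 ≤ (2 / c₀ + 1) * (8 / d) ^ 4 * s ^ 4 * (1 + n ^ 2) ^ 2 := by positivity
    linarith
  · have h4 : t ≤ t ^ 4 := le_self_pow₀ h.le (by norm_num)
    have h1 : 1 ≤ t ^ 4 := h.le.trans h4
    have h2 : (2 / c₀ + 1) * t ^ 4 ≤ (2 / c₀ + 1) * ((8 / d) ^ 4 * s ^ 4 * (1 + n ^ 2) ^ 2) := by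
      gcongr
    have h3 : 2 / c₀ ≤ 2 / c₀ * t ^ 4 := le_mul_of_one_le_right (by positivity) h1
    have h5 : 0 ≤ 2 * K ^ 2 * s ^ 4 * (1 + n ^ 2) ^ 2 := by positivity
    have e : 1 / c₀ + 1 / c₀ = 2 / c₀ := by ring
    linarith

/-- Two functions with separated supports which are almost subsolutions of the Mehler operator
cannot both have eigenvalues close to one. -/
theorem exists_add_le_of_almost_subsolution (E : Type*) [NormedAddCommGroup E]
    [InnerProductSpace ℝ E] [FiniteDimensional ℝ E] [MeasurableSpace E] [BorelSpace E] {d D : ℝ}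
    (hd : 0 < d) (hD : 0 < D) :
    ∃ K : ℝ, ∀ (A B : Set E), (∀ x ∈ A, ∀ y ∈ B, d ≤ ‖x - y‖) → (∀ x ∈ A, ‖x‖ ≤ D) →
      (∀ y ∈ B, ‖y‖ ≤ D) → ∀ θ : ℝ, 3 / 4 ≤ cos θ → 0 ≤ sin θ → ∀ κ κ' : ℝ, 0 ≤ κ → 0 ≤ κ' →
      (∀ ε > 0, ∃ F : E → ℝ, BddMeas F ∧ (∀ x, 0 ≤ F x) ∧ (∀ x, F x ≤ 1) ∧ (∀ x ∉ A, F x = 0) ∧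
        (∃ x, 1 / 2 ≤ F x) ∧ ∀ x ∈ A, κ * (F x - ε) ≤ mehler θ F x) →
      (∀ ε > 0, ∃ F : E → ℝ, BddMeas F ∧ (∀ x, 0 ≤ F x) ∧ (∀ x, F x ≤ 1) ∧ (∀ x ∉ B, F x = 0) ∧
        (∃ x, 1 / 2 ≤ F x) ∧ ∀ x ∈ B, κ' * (F x - ε) ≤ mehler θ F x) →
      κ + κ' ≤ 2 * cos θ + K * sin θ ^ 4 := by
  set J := ∫ z : E, (1 + ‖z‖ ^ 2) ^ 2 ∂stdGaussian E with hJ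
  set c₀ := d ^ 2 / (8 * (2 * D) ^ 2) with hc₀
  set K₁ := 1 + 2 * D / d + 2 * (1 + D ^ 2) / d ^ 2 with hK₁
  set K₂ := 2 * K₁ ^ 2 + (2 / c₀ + 1) * (8 / d) ^ 4 with hK₂
  have hc₀pos : 0 < c₀ := by positivity
  refine ⟨K₂ * J, fun A B hAB hA hB θ hcos hsin κ κ' hκ hκ' hF hG => ?_⟩
  set c := cos θ with hc
  set s := sin θ with hs
  have hcs : c ^ 2 + s ^ 2 = 1 := cos_sq_add_sin_sq θ
  have main : ∀ ε : ℝ, 0 < ε → ε ≤ 1 →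
      (κ + κ') * (1 - ε / c₀) ≤ (1 + ε) * (2 * c + K₂ * J * s ^ 4) := by
    intro ε hε hε1
    obtain ⟨F, hFb, F0, F1, FA, Fx, hFsub⟩ := hF ε hε
    obtain ⟨G, hGb, G0, G1, GB, Gx, hGsub⟩ := hG ε hε
    obtain ⟨x₀, hx₀, y₀, hy₀, hFx, hGy, hmax⟩ := exists_almost_max (D := 2 * D) hd hε hε1 hAB
      (fun x hx y hy => by
        have := norm_sub_le x y; have := hA x hx; have := hB y hy; linarith)
      F0 F1 FA Fx G0 G1 GB Gx
    rw [← hc₀] at hFx hGy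
    set a := F x₀
    set b := G y₀
    have ha : 0 < a := hc₀pos.trans_le hFx
    have hb : 0 < b := hc₀pos.trans_le hGy
    set v := x₀ - y₀ with hv
    have hρ : d ≤ ‖v‖ := hAB _ hx₀ _ hy₀
    have hρ0 : 0 < ‖v‖ := hd.trans_le hρ
    set R := (Submodule.span ℝ {v})ᗮ.reflection with hR
    have hRmp : MeasurePreserving R (stdGaussian E) (stdGaussian E) :=
      ⟨R.continuous.measurable, stdGaussian_map R⟩
    set P : E → ℝ := fun z => F (c • x₀ + s • z) / ((1 + ε) * a) with hP
    set T : E → ℝ := fun z => G (c • y₀ + s • R z) / ((1 + ε) * b) with hT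
    set m : E → ℝ := fun z => c + 2 * s * ⟪z, v⟫ / ‖v‖ ^ 2 with hm
    have hPb : BddMeas P := by
      have := (hFb.comp (g := fun z : E => c • x₀ + s • z) (by fun_prop)).const_mul
        (((1 + ε) * a)⁻¹)
      simpa only [hP, div_eq_inv_mul] using this
    have hTb : BddMeas T := by
      have := (hGb.comp (g := fun z : E => c • y₀ + s • R z) (by fun_prop)).const_mul
        (((1 + ε) * b)⁻¹)
      simpa only [hT, div_eq_inv_mul] using this
    have hpt : ∀ z, P z + T z ≤ 2 * m z + K₂ * s ^ 4 * (1 + ‖z‖ ^ 2) ^ 2 := by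
      intro z
      have hdiff : c • x₀ + s • z - (c • y₀ + s • R z) = m z • v := by
        rw [hR, reflection_orthogonal_singleton_apply, smul_sub, hm]
        simp only [add_smul, hv, smul_smul]
        rw [smul_sub c]
        have : s * (2 * ⟪z, x₀ - y₀⟫ / ‖x₀ - y₀‖ ^ 2) = 2 * s * ⟪z, x₀ - y₀⟫ / ‖x₀ - y₀‖ ^ 2 := by
          ring
        rw [this]; abel
      have hm' : |m z - c| ≤ 2 * s * ‖z‖ / ‖v‖ := by
        have : m z - c = 2 * s * (⟪z, v⟫ / ‖v‖ ^ 2) := by simp only [hm]; ring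
        rw [this, abs_mul, abs_of_nonneg (by positivity : 0 ≤ 2 * s), abs_div,
          abs_of_pos (by positivity : 0 < ‖v‖ ^ 2), mul_div_assoc]
        refine mul_le_mul_of_nonneg_left ?_ (by positivity)
        rw [div_le_div_iff₀ (by positivity) (by positivity)]
        calc |⟪z, v⟫| * ‖v‖ ≤ ‖z‖ * ‖v‖ * ‖v‖ := by
              gcongr; exact abs_real_inner_le_norm _ _
          _ = _ := by ring
      refine add_le_of_almost_max (K := K₁) hcos hsin hd hc₀pos hρ (norm_nonneg z) hm'
        (α := ‖c • x₀ + s • z - y₀‖ ^ 2 / ‖v‖ ^ 2)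
        (β := ‖c • y₀ + s • R z - x₀‖ ^ 2 / ‖v‖ ^ 2) ?_ ?_ ?_ ?_ ?_ ?_ ?_
      · have h1 := hmax (c • x₀ + s • z) (c • y₀ + s • R z)
        rw [hdiff, norm_smul, mul_pow, Real.norm_eq_abs, sq_abs] at h1
        have h2 : F (c • x₀ + s • z) * G (c • y₀ + s • R z) ≤ (1 + ε) * (a * b) * m z ^ 2 := by
          have : F (c • x₀ + s • z) * G (c • y₀ + s • R z) * ‖v‖ ^ 2 ≤
            (1 + ε) * (a * b) * m z ^ 2 * ‖v‖ ^ 2 := by linarith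
          exact le_of_mul_le_mul_right this (by positivity)
        simp only [hP, hT]
        rw [div_mul_div_comm, div_le_iff₀ (by positivity)]
        refine h2.trans ?_
        have h3 : 0 ≤ ε * (1 + ε) * (a * b * m z ^ 2) := by positivity
        linarith
      · have h1 := hmax (c • x₀ + s • z) y₀
        simp only [hP]
        rw [div_le_div_iff₀ (by positivity) (by positivity)]
        have : F (c • x₀ + s • z) * ‖v‖ ^ 2 * b ≤
            ‖c • x₀ + s • z - y₀‖ ^ 2 * ((1 + ε) * a) * b := by linarith
        exact le_of_mul_le_mul_right this hb
      · have h1 := hmax x₀ (c • y₀ + s • R z)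
        simp only [hT]
        rw [div_le_div_iff₀ (by positivity) (by positivity), norm_sub_rev _ x₀]
        have : G (c • y₀ + s • R z) * ‖v‖ ^ 2 * a ≤
            ‖x₀ - (c • y₀ + s • R z)‖ ^ 2 * ((1 + ε) * b) * a := by linarith
        exact le_of_mul_le_mul_right this ha
      · simp only [hP]
        refine (div_le_div_of_nonneg_right (F1 _) (by positivity)).trans ?_
        apply one_div_le_one_div_of_le hc₀pos
        nlinarith
      · simp only [hT]
        refine (div_le_div_of_nonneg_right (G1 _) (by positivity)).trans ?_
        apply one_div_le_one_div_of_le hc₀pos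
        nlinarith
      · exact abs_norm_sq_div_sub_le hcs (by linarith) hd hρ (hA _ hx₀)
      · have h1 := abs_norm_sq_div_sub_le (z := R z) hcs (by linarith) hd
          (by rwa [norm_sub_rev] : d ≤ ‖y₀ - x₀‖) (hB _ hy₀)
        rw [norm_sub_rev y₀, ← hv, show y₀ - x₀ = -v by rw [hv]; abel,
          inner_reflection_orthogonal_singleton, LinearIsometryEquiv.norm_map] at h1
        exact h1
    have h_int : ∫ z, P z ∂stdGaussian E + ∫ z, T z ∂stdGaussian E ≤ 2 * c + K₂ * J * s ^ 4 := by
      rw [← integral_add hPb.integrable hTb.integrable]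
      have hi1 : Integrable (fun z : E => ⟪z, v⟫) (stdGaussian E) := by
        simpa [real_inner_comm] using
          (innerSL ℝ v).integrable_comp (IsGaussian.integrable_id (μ := stdGaussian E))
      have hi2 : Integrable m (stdGaussian E) :=
        (integrable_const c).add ((hi1.const_mul (2 * s)).div_const _)
      have hi3 := (integrable_one_add_norm_sq_sq_stdGaussian (E := E)).const_mul (K₂ * s ^ 4)
      refine (integral_mono (hPb.integrable.add hTb.integrable)
        ((hi2.const_mul 2).add hi3) hpt).trans (le_of_eq ?_)
      simp only [Pi.add_apply]
      rw [integral_add (hi2.const_mul 2) hi3, integral_const_mul, integral_const_mul, ← hJ]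
      have : ∫ z, m z ∂stdGaussian E = c := by
        simp only [hm]
        rw [integral_add (integrable_const _) ((hi1.const_mul (2 * s)).div_const _),
          integral_div, integral_const_mul, integral_inner_stdGaussian]
        simp
      rw [this]; ring
    have hPint : ∫ z, P z ∂stdGaussian E = mehler θ F x₀ / ((1 + ε) * a) := by
      simp only [hP, integral_div]; rfl
    have hTint : ∫ z, T z ∂stdGaussian E = mehler θ G y₀ / ((1 + ε) * b) := by
      simp only [hT, integral_div, mehler]
      congr 1
      conv_rhs => rw [← hRmp.map_eq]
      rw [integral_map (by fun_prop)
        (hGb.comp (g := fun z : E => c • y₀ + s • z) (by fun_prop)).1.aestronglyMeasurable]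
    have aux : ∀ {k a M : ℝ}, 0 ≤ k → c₀ ≤ a → k * (a - ε) ≤ M →
        k * (1 - ε / c₀) ≤ (1 + ε) * (M / ((1 + ε) * a)) := by
      intro k a M hk ha hM
      have ha0 : 0 < a := hc₀pos.trans_le ha
      have e1 : (1 + ε) * (M / ((1 + ε) * a)) = M / a := by field_simp
      have e2 : k * (1 - ε / c₀) ≤ k * (1 - ε / a) := by gcongr
      rw [e1, le_div_iff₀ ha0]
      calc k * (1 - ε / c₀) * a ≤ k * (1 - ε / a) * a := by gcongr
        _ = k * (a - ε) := by field_simp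
        _ ≤ M := hM
    have h1 := aux hκ hFx (hFsub _ hx₀)
    have h2 := aux hκ' hGy (hGsub _ hy₀)
    rw [← hPint] at h1
    rw [← hTint] at h2
    calc (κ + κ') * (1 - ε / c₀) ≤
        (1 + ε) * (∫ z, P z ∂stdGaussian E + ∫ z, T z ∂stdGaussian E) := by linarith
      _ ≤ _ := by gcongr
  have hl : Tendsto (fun ε : ℝ => (κ + κ') * (1 - ε / c₀)) (nhdsWithin 0 (Ioi 0))
      (nhds ((κ + κ') * (1 - 0 / c₀))) :=
    Tendsto.mono_left (Continuous.tendsto (by fun_prop) 0) nhdsWithin_le_nhds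
  have hr : Tendsto (fun ε : ℝ => (1 + ε) * (2 * c + K₂ * J * s ^ 4)) (nhdsWithin 0 (Ioi 0))
      (nhds ((1 + 0) * (2 * c + K₂ * J * s ^ 4))) :=
    Tendsto.mono_left (Continuous.tendsto (by fun_prop) 0) nhdsWithin_le_nhds
  have := le_of_tendsto_of_tendsto hl hr (by
    filter_upwards [Ioc_mem_nhdsGT (zero_lt_one' ℝ)] with ε hε using main ε hε.1 hε.2)
  simpa using this

end TwoPoint

/-! ### The density of the standard Gaussian measure -/

section Density

open ProbabilityTheory Real

variable {E : Type*} [NormedAddCommGroup E] [InnerProductSpace ℝ E] [FiniteDimensional ℝ E]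
  [MeasurableSpace E] [BorelSpace E]

lemma integrable_exp_neg_mul_sq_norm {b : ℝ} (hb : 0 < b) :
    Integrable (fun x : E => rexp (-b * ‖x‖ ^ 2)) := by
  by_contra h
  have h1 := GaussianFourier.integral_rexp_neg_mul_sq_norm (V := E) hb
  rw [integral_undef h] at h1
  have : 0 < (π / b) ^ (Module.finrank ℝ E / 2 : ℝ) := by positivity
  linarith

lemma stdGaussian_eq_withDensity :
    ∃ Z : ℝ, 0 < Z ∧ stdGaussian E =
      (volume : Measure E).withDensity (fun x => ENNReal.ofReal (Z * rexp (-(1 / 2) * ‖x‖ ^ 2))) := by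
  set W : ℝ := (π / (1 / 2)) ^ (Module.finrank ℝ E / 2 : ℝ) with hW
  have hWpos : 0 < W := by positivity
  have hWint := GaussianFourier.integral_rexp_neg_mul_sq_norm (V := E) (b := 1 / 2) (by norm_num)
  have h_int := integrable_exp_neg_mul_sq_norm (E := E) (b := 1 / 2) (by norm_num)
  refine ⟨W⁻¹, inv_pos.2 hWpos, ?_⟩
  set f : E → ℝ := fun x => W⁻¹ * rexp (-(1 / 2) * ‖x‖ ^ 2) with hf
  have hf0 : ∀ x, 0 ≤ f x := fun x => by positivity
  have : IsFiniteMeasure ((volume : Measure E).withDensity fun x => ENNReal.ofReal (f x)) :=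
    isFiniteMeasure_withDensity_ofReal (h_int.const_mul _).2
  refine Measure.ext_of_charFun (funext fun t => ?_)
  rw [charFun_stdGaussian, charFun_apply,
    integral_withDensity_eq_integral_toReal_smul (by fun_prop) (by simp)]
  have h2 := GaussianFourier.integral_cexp_neg_mul_sq_norm_add (V := E) (b := 1 / 2) (by norm_num)
    Complex.I t
  have e : ∀ x : E, (ENNReal.ofReal (f x)).toReal • Complex.exp (⟪x, t⟫ * Complex.I) =
      (W⁻¹ : ℂ) * Complex.exp (-(1 / 2) * (‖x‖ : ℂ) ^ 2 + Complex.I * (⟪t, x⟫ : ℝ)) := by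
    intro x
    rw [ENNReal.toReal_ofReal (hf0 x), Complex.real_smul, Complex.exp_add, hf,
      real_inner_comm]
    push_cast
    ring_nf
  rw [integral_congr_ae (Eventually.of_forall e), integral_const_mul, h2]
  have hW' : ((π : ℂ) / (1 / 2)) ^ (Module.finrank ℝ E / 2 : ℂ) = (W : ℂ) := by
    rw [hW, Complex.ofReal_cpow (by positivity)]
    push_cast; rfl
  rw [hW', ← mul_assoc, inv_mul_cancel₀ (by exact_mod_cast hWpos.ne'), one_mul, Complex.I_sq]
  congr 1
  ring

lemma stdGaussian_absolutelyContinuous : stdGaussian E ≪ (volume : Measure E) := by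
  obtain ⟨Z, -, h⟩ := stdGaussian_eq_withDensity (E := E)
  rw [h]
  exact withDensity_absolutelyContinuous _ _

end Density

/-! ### The Dirichlet form of the Mehler operator -/

section Dirichlet

open ProbabilityTheory Real

variable {E : Type*} [NormedAddCommGroup E] [InnerProductSpace ℝ E] [FiniteDimensional ℝ E]
  [MeasurableSpace E] [BorelSpace E]

lemma integral_sq_dual_stdGaussian (L : StrongDual ℝ E) :
    ∫ z, L z ^ 2 ∂stdGaussian E = ‖L‖ ^ 2 := by
  rw [← variance_dual_stdGaussian, variance_eq_integral (by fun_prop)]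
  have := integral_strongDual_stdGaussian L
  simp [this]

lemma hasDerivAt_comp_cos_sin {F : E → ℝ} {x : E} (hF : DifferentiableAt ℝ F x) (z : E) :
    HasDerivAt (fun θ : ℝ => F (cos θ • x + sin θ • z)) (fderiv ℝ F x z) 0 := by
  have h1 : HasDerivAt (fun θ : ℝ => cos θ • x + sin θ • z) ((-sin 0) • x + cos 0 • z) 0 :=
    ((hasDerivAt_cos 0).smul_const x).add ((hasDerivAt_sin 0).smul_const z)
  have hF' : HasFDerivAt F (fderiv ℝ F x) (cos 0 • x + sin 0 • z) := by simpa using hF.hasFDerivAt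
  have h2 := hF'.comp_hasDerivAt 0 h1
  rwa [sin_zero, cos_zero, neg_zero, zero_smul, zero_add, one_smul] at h2

lemma tendsto_sub_div_sin {F : E → ℝ} {x : E} (hF : DifferentiableAt ℝ F x) (z : E) :
    Tendsto (fun θ : ℝ => (F (cos θ • x + sin θ • z) - F x) / sin θ) (nhdsWithin 0 (Ioi 0))
      (nhds (fderiv ℝ F x z)) := by
  have h1 := (hasDerivAt_comp_cos_sin hF z).tendsto_slope_zero_right
  have h2 := (hasDerivAt_sin 0).tendsto_slope_zero_right
  have h3 := h1.div h2 (by simp)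
  simp only [cos_zero, div_one] at h3
  refine h3.congr' ?_
  filter_upwards [self_mem_nhdsWithin] with θ hθ
  have : θ ≠ 0 := (ne_of_gt hθ)
  simp only [Pi.div_apply, zero_add, one_smul, sin_zero, zero_smul, add_zero, sub_zero,
    smul_eq_mul]
  rw [mul_div_mul_left _ _ (inv_ne_zero this)]

lemma tendsto_energy {F : E → ℝ} {K : NNReal} (hF : LipschitzWith K F) :
    Tendsto (fun θ : ℝ => ∫ p, ((F (cos θ • p.1 + sin θ • p.2) - F p.1) / sin θ) ^ 2
      ∂(stdGaussian E).prod (stdGaussian E)) (nhdsWithin 0 (Ioi 0))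
      (nhds (∫ x, ‖fderiv ℝ F x‖ ^ 2 ∂stdGaussian E)) := by
  have hn : ∀ n, Integrable (fun p : E × E => ‖p.1‖ ^ n) ((stdGaussian E).prod (stdGaussian E)) :=
    fun n => (integrable_norm_pow_stdGaussian n).comp_fst _
  have hn' : ∀ n, Integrable (fun p : E × E => ‖p.2‖ ^ n) ((stdGaussian E).prod (stdGaussian E)) :=
    fun n => (integrable_norm_pow_stdGaussian n).comp_snd _
  have hmeas : Measurable fun p : E × E => fderiv ℝ F p.1 p.2 := by
    have : Measurable fun x => fderiv ℝ F x := measurable_fderiv ℝ F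
    have h2 : Continuous fun q : (E →L[ℝ] ℝ) × E => q.1 q.2 := by fun_prop
    exact h2.measurable.comp ((this.comp measurable_fst).prodMk measurable_snd)
  have hlim : ∫ x, ‖fderiv ℝ F x‖ ^ 2 ∂stdGaussian E =
      ∫ p : E × E, (fderiv ℝ F p.1 p.2) ^ 2 ∂(stdGaussian E).prod (stdGaussian E) := by
    rw [integral_prod]
    · simp_rw [integral_sq_dual_stdGaussian]
    · refine ((hn' 2).const_mul ((K : ℝ) ^ 2)).mono' (hmeas.pow_const 2).aestronglyMeasurable
        (Eventually.of_forall fun p => ?_)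
      rw [norm_pow, ← mul_pow]
      gcongr
      exact (ContinuousLinearMap.le_opNorm _ _).trans
        (by gcongr; exact norm_fderiv_le_of_lipschitz ℝ hF)
  rw [hlim]
  refine tendsto_integral_filter_of_dominated_convergence
    (fun p => 2 * (K : ℝ) ^ 2 * (‖p.1‖ ^ 2 + ‖p.2‖ ^ 2)) ?_ ?_ ?_ ?_
  · refine Eventually.of_forall fun θ => ?_
    have := hF.continuous
    exact Continuous.aestronglyMeasurable (by fun_prop)
  · filter_upwards [Ioo_mem_nhdsGT pi_div_two_pos] with θ hθ
    refine Eventually.of_forall fun p => ?_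
    have hs : 0 < sin θ := sin_pos_of_pos_of_lt_pi hθ.1 (by linarith [hθ.2, pi_pos])
    have hc : 0 ≤ cos θ := cos_nonneg_of_mem_Icc ⟨by linarith [hθ.1, pi_pos], hθ.2.le⟩
    have hcs := sin_sq_add_cos_sq θ
    have hs1 := sin_le_one θ
    have hc1 := cos_le_one θ
    have h1 : |F (cos θ • p.1 + sin θ • p.2) - F p.1| ≤ K * (sin θ * (‖p.1‖ + ‖p.2‖)) := by
      have h2 := hF.dist_le_mul (cos θ • p.1 + sin θ • p.2) p.1
      rw [Real.dist_eq, dist_eq_norm] at h2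
      refine h2.trans ?_
      gcongr
      have : cos θ • p.1 + sin θ • p.2 - p.1 = sin θ • p.2 - (1 - cos θ) • p.1 := by
        rw [sub_smul, one_smul]; abel
      rw [this]
      refine (norm_sub_le _ _).trans ?_
      rw [norm_smul, norm_smul, Real.norm_eq_abs, Real.norm_eq_abs, abs_of_pos hs,
        abs_of_nonneg (by linarith)]
      have : 1 - cos θ ≤ sin θ := by nlinarith
      nlinarith [norm_nonneg p.1]
    rw [norm_pow, norm_div, Real.norm_eq_abs, Real.norm_eq_abs, abs_of_pos hs]
    have h3 : |F (cos θ • p.1 + sin θ • p.2) - F p.1| / sin θ ≤ K * (‖p.1‖ + ‖p.2‖) := by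
      rw [div_le_iff₀ hs]; linarith
    calc (|F (cos θ • p.1 + sin θ • p.2) - F p.1| / sin θ) ^ 2 ≤ (K * (‖p.1‖ + ‖p.2‖)) ^ 2 := by
          gcongr
      _ ≤ _ := by
        have : 0 ≤ (K : ℝ) ^ 2 * (‖p.1‖ - ‖p.2‖) ^ 2 := by positivity
        linarith
  · exact ((hn 2).add (hn' 2)).const_mul _
  · have hd : ∀ᵐ x ∂stdGaussian E, DifferentiableAt ℝ F x :=
      stdGaussian_absolutelyContinuous hF.ae_differentiableAt
    have hd' : ∀ᵐ p ∂(stdGaussian E).prod (stdGaussian E), DifferentiableAt ℝ F p.1 :=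
      Measure.quasiMeasurePreserving_fst.ae hd
    filter_upwards [hd'] with p hp
    exact (tendsto_sub_div_sin hp p.2).pow 2

/-- Two bounded Lipschitz functions with bounded separated supports: the sum of the Gaussian
Rayleigh quotients is at least two. -/
theorem two_le_add_of_separated {A B : Set E} (hA : MeasurableSet A) (hB : MeasurableSet B)
    {d D : ℝ} (hd : 0 < d) (hD : 0 < D) (hAB : ∀ x ∈ A, ∀ y ∈ B, d ≤ ‖x - y‖)
    (hAD : ∀ x ∈ A, ‖x‖ ≤ D) (hBD : ∀ y ∈ B, ‖y‖ ≤ D) {F G : E → ℝ} {K K' : NNReal}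
    (hF : LipschitzWith K F) (hG : LipschitzWith K' G) (hFb : BddMeas F) (hGb : BddMeas G)
    (F0 : ∀ x, 0 ≤ F x) (G0 : ∀ x, 0 ≤ G x) (FA : ∀ x ∉ A, F x = 0) (GB : ∀ x ∉ B, G x = 0)
    (Fpos : 0 < ∫ x, F x * F x ∂stdGaussian E) (Gpos : 0 < ∫ x, G x * G x ∂stdGaussian E)
    {l m : ℝ} (hl : ∫ x, ‖fderiv ℝ F x‖ ^ 2 ∂stdGaussian E < l * ∫ x, F x * F x ∂stdGaussian E)
    (hm : ∫ x, ‖fderiv ℝ G x‖ ^ 2 ∂stdGaussian E < m * ∫ x, G x * G x ∂stdGaussian E) :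
    2 ≤ l + m := by
  obtain ⟨C, hC⟩ := exists_add_le_of_almost_subsolution E hd hD
  have energy_lt : ∀ {H : E → ℝ} {k : NNReal} {l : ℝ}, LipschitzWith k H →
      ∫ x, ‖fderiv ℝ H x‖ ^ 2 ∂stdGaussian E < l * ∫ x, H x * H x ∂stdGaussian E →
      ∀ᶠ θ in nhdsWithin 0 (Ioi 0), 0 < sin θ →
        ∫ p, (H (cos θ • p.1 + sin θ • p.2) - H p.1) ^ 2 ∂(stdGaussian E).prod (stdGaussian E) ≤
          2 * (l * sin θ ^ 2 / 2) * ∫ x, H x * H x ∂stdGaussian E := by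
    intro H k l hH hl
    filter_upwards [(tendsto_energy hH).eventually_lt_const hl] with θ h1 hs
    simp_rw [div_pow] at h1
    rw [integral_div, div_lt_iff₀ (by positivity)] at h1
    linarith
  have hsin : Tendsto (fun θ => sin θ) (nhdsWithin 0 (Ioi 0)) (nhds 0) := by
    simpa using (continuous_sin.tendsto 0).mono_left nhdsWithin_le_nhds
  have hcos : Tendsto (fun θ => cos θ) (nhdsWithin 0 (Ioi 0)) (nhds 1) := by
    simpa using (continuous_cos.tendsto 0).mono_left nhdsWithin_le_nhds
  have hsmall : ∀ a : ℝ, ∀ᶠ θ in nhdsWithin 0 (Ioi 0), a * sin θ ^ 2 / 2 < 1 := by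
    intro a
    have : Tendsto (fun θ => a * sin θ ^ 2 / 2) (nhdsWithin 0 (Ioi 0)) (nhds (a * 0 ^ 2 / 2)) :=
      ((hsin.pow 2).const_mul a).div_const 2
    exact this.eventually_lt_const (by norm_num)
  have key : ∀ᶠ θ in nhdsWithin (0 : ℝ) (Ioi 0), 2 ≤ l + m + 2 * C * sin θ ^ 2 := by
    filter_upwards [energy_lt hF hl, energy_lt hG hm, hsmall l, hsmall m,
      hcos.eventually_const_lt (show (3 / 4 : ℝ) < 1 by norm_num),
      Ioo_mem_nhdsGT pi_pos] with θ h1 h2 h3 h4 h5 h6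
    have hs : 0 < sin θ := sin_pos_of_pos_of_lt_pi h6.1 h6.2
    have h7 := hC A B hAB hAD hBD θ h5.le hs.le (1 - l * sin θ ^ 2 / 2) (1 - m * sin θ ^ 2 / 2)
      (by linarith) (by linarith)
      (fun ε hε => exists_almost_subsolution_mehler hA hFb F0 FA Fpos h3 (h1 hs) hε)
      (fun ε hε => exists_almost_subsolution_mehler hB hGb G0 GB Gpos h4 (h2 hs) hε)
    have h8 : cos θ ≤ 1 - sin θ ^ 2 / 2 := by
      nlinarith [sin_sq_add_cos_sq θ, sq_nonneg (cos θ - 1)]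
    have h9 : sin θ ^ 2 * 2 ≤ sin θ ^ 2 * (l + m + 2 * C * sin θ ^ 2) := by nlinarith
    exact le_of_mul_le_mul_left h9 (by positivity)
  have hlim : Tendsto (fun θ => l + m + 2 * C * sin θ ^ 2) (nhdsWithin 0 (Ioi 0))
      (nhds (l + m + 2 * C * 0 ^ 2)) := ((hsin.pow 2).const_mul _).const_add _
  have := ge_of_tendsto hlim key
  simpa using this

end Dirichlet

/-! ### Two functions with disjoint supports -/

section Truncation

open ProbabilityTheory Real

variable {E : Type*} [NormedAddCommGroup E] [InnerProductSpace ℝ E] [FiniteDimensional ℝ E]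
  [MeasurableSpace E] [BorelSpace E]

lemma norm_fderiv_max_sub_le {F : E → ℝ} (hF : Continuous F) {ε : ℝ} (x : E) :
    ‖fderiv ℝ (fun y => max (F y - ε) 0) x‖ ≤ ‖fderiv ℝ F x‖ := by
  rcases lt_or_ge ε (F x) with h | h
  · have h1 : (fun y => max (F y - ε) 0) =ᶠ[nhds x] fun y => F y - ε := by
      filter_upwards [hF.continuousAt.eventually (lt_mem_nhds h)] with y hy
      exact max_eq_left (by linarith)
    rw [h1.fderiv_eq, fderiv_sub_const]
  · have h1 : IsLocalMin (fun y => max (F y - ε) 0) x := by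
      refine Eventually.of_forall fun y => ?_
      simp only [max_eq_right (show F x - ε ≤ 0 by linarith)]
      exact le_max_right _ _
    rw [h1.fderiv_eq_zero, norm_zero]
    exact norm_nonneg _

/-- Two disjointly supported functions cannot both have Gaussian Rayleigh quotient less than one
on average. -/
theorem two_le_add_of_mul_eq_zero {F G : E → ℝ} (hF : Continuous F) (hG : Continuous G)
    (F0 : ∀ x, 0 ≤ F x) (G0 : ∀ x, 0 ≤ G x) (hFG : ∀ x, F x * G x = 0)
    (hFL : ∀ ε > 0, ∃ K, LipschitzWith K (fun x => max (F x - ε) 0))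
    (hGL : ∀ ε > 0, ∃ K, LipschitzWith K (fun x => max (G x - ε) 0))
    (hFD : ∀ ε > 0, ∃ D, ∀ x, ε ≤ F x → ‖x‖ ≤ D)
    (hGD : ∀ ε > 0, ∃ D, ∀ x, ε ≤ G x → ‖x‖ ≤ D)
    (hFi : Integrable (fun x => ‖fderiv ℝ F x‖ ^ 2) (stdGaussian E))
    (hGi : Integrable (fun x => ‖fderiv ℝ G x‖ ^ 2) (stdGaussian E))
    (Fpos : 0 < ∫ x, F x * F x ∂stdGaussian E) (Gpos : 0 < ∫ x, G x * G x ∂stdGaussian E)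
    {l m : ℝ} (hl : ∫ x, ‖fderiv ℝ F x‖ ^ 2 ∂stdGaussian E < l * ∫ x, F x * F x ∂stdGaussian E)
    (hm : ∫ x, ‖fderiv ℝ G x‖ ^ 2 ∂stdGaussian E < m * ∫ x, G x * G x ∂stdGaussian E) :
    2 ≤ l + m := by
  have hcpt : ∀ {H : E → ℝ}, Continuous H → (∀ ε > 0, ∃ D, ∀ x, ε ≤ H x → ‖x‖ ≤ D) →
      ∀ ε > 0, IsCompact {x | ε ≤ H x} := by
    intro H hH hD ε hε
    obtain ⟨D, hD⟩ := hD ε hε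
    exact Metric.isCompact_of_isClosed_isBounded (isClosed_le continuous_const hH)
      ((isBounded_closedBall (x := (0 : E)) (r := D)).subset fun x hx => by
        simpa using hD x hx)
  have hbdd : ∀ {H : E → ℝ}, Continuous H → (∀ x, 0 ≤ H x) →
      (∀ ε > 0, ∃ D, ∀ x, ε ≤ H x → ‖x‖ ≤ D) → ∃ C, ∀ x, H x ≤ C := by
    intro H hH H0 hD
    obtain ⟨C, hC⟩ := (hcpt hH hD 1 one_pos).bddAbove_image hH.continuousOn
    refine ⟨max C 1, fun x => ?_⟩
    rcases le_total 1 (H x) with h | h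
    · exact (hC ⟨x, h, rfl⟩).trans (le_max_left _ _)
    · exact h.trans (le_max_right _ _)
  have hBM : ∀ {H : E → ℝ}, Continuous H → (∀ x, 0 ≤ H x) →
      (∀ ε > 0, ∃ D, ∀ x, ε ≤ H x → ‖x‖ ≤ D) → ∀ ε > 0, BddMeas (fun x => max (H x - ε) 0) := by
    intro H hH H0 hD ε hε
    obtain ⟨C, hC⟩ := hbdd hH H0 hD
    refine ⟨by fun_prop, C, fun x => ?_⟩
    rw [abs_of_nonneg (le_max_right _ _)]
    exact max_le (by linarith [hC x]) ((H0 x).trans (hC x))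
  have hlim : ∀ {H : E → ℝ}, Continuous H → (∀ x, 0 ≤ H x) →
      (∀ ε > 0, ∃ D, ∀ x, ε ≤ H x → ‖x‖ ≤ D) →
      Tendsto (fun n : ℕ => ∫ x, max (H x - 1 / ((n : ℝ) + 1)) 0 * max (H x - 1 / ((n : ℝ) + 1)) 0
        ∂stdGaussian E) atTop (nhds (∫ x, H x * H x ∂stdGaussian E)) := by
    intro H hH H0 hD
    obtain ⟨C, hC⟩ := hbdd hH H0 hD
    refine tendsto_integral_of_dominated_convergence (fun _ => C * C) ?_ (integrable_const _) ?_ ?_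
    · intro n
      exact Continuous.aestronglyMeasurable (by fun_prop)
    · intro n
      refine Eventually.of_forall fun x => ?_
      have h2 : max (H x - 1 / ((n : ℝ) + 1)) 0 ≤ C :=
        max_le (by have := hC x; have : 0 < 1 / ((n : ℝ) + 1) := by positivity
                   linarith) ((H0 x).trans (hC x))
      have h3 : 0 ≤ max (H x - 1 / ((n : ℝ) + 1)) 0 := le_max_right _ _
      rw [Real.norm_of_nonneg (mul_nonneg h3 h3)]
      exact mul_le_mul h2 h2 h3 (h3.trans h2)
    · refine Eventually.of_forall fun x => ?_
      have h1 : Tendsto (fun n : ℕ => max (H x - 1 / ((n : ℝ) + 1)) 0) atTop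
          (nhds (max (H x - 0) 0)) :=
        (tendsto_const_nhds.sub tendsto_one_div_add_atTop_nhds_zero_nat).max tendsto_const_nhds
      have h2 : max (H x - 0) 0 = H x := by rw [sub_zero, max_eq_left (H0 x)]
      rw [h2] at h1
      exact h1.mul h1
  have e1 := (hlim hF F0 hFD).eventually (lt_mem_nhds Fpos)
  have e2 := (hlim hG G0 hGD).eventually (lt_mem_nhds Gpos)
  have e3 := ((hlim hF F0 hFD).const_mul l).eventually (lt_mem_nhds hl)
  have e4 := ((hlim hG G0 hGD).const_mul m).eventually (lt_mem_nhds hm)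
  obtain ⟨n, h1, h2, h3, h4⟩ := (e1.and (e2.and (e3.and e4))).exists
  set ε : ℝ := 1 / ((n : ℝ) + 1)
  have hε : 0 < ε := by positivity
  have cA := hcpt hF hFD ε hε
  have cB := hcpt hG hGD ε hε
  have hne : ∀ x ∈ {x | ε ≤ F x}, ∀ y ∈ {x | ε ≤ G x}, 0 < ‖x - y‖ := by
    intro x hx y hy
    rw [norm_pos_iff, sub_ne_zero]
    rintro rfl
    have : 0 < F x * G x := mul_pos (hε.trans_le hx) (hε.trans_le hy)
    linarith [hFG x]
  obtain ⟨d, hd, hdA⟩ : ∃ d > 0, ∀ x ∈ {x | ε ≤ F x}, ∀ y ∈ {x | ε ≤ G x}, d ≤ ‖x - y‖ := by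
    rcases ({x | ε ≤ F x} ×ˢ {x | ε ≤ G x}).eq_empty_or_nonempty with he | he
    · refine ⟨1, one_pos, fun x hx y hy => ?_⟩
      have : (x, y) ∈ {x | ε ≤ F x} ×ˢ {x | ε ≤ G x} := ⟨hx, hy⟩
      rw [he] at this
      exact this.elim
    · obtain ⟨p, hp, hmin⟩ := (cA.prod cB).exists_isMinOn he
        (f := fun p : E × E => ‖p.1 - p.2‖) (by fun_prop)
      exact ⟨‖p.1 - p.2‖, hne _ hp.1 _ hp.2, fun x hx y hy => hmin (show (x, y) ∈ _ from ⟨hx, hy⟩)⟩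
  obtain ⟨D₁, hD₁⟩ := hFD ε hε
  obtain ⟨D₂, hD₂⟩ := hGD ε hε
  obtain ⟨K, hK⟩ := hFL ε hε
  obtain ⟨K', hK'⟩ := hGL ε hε
  have hen : ∀ {H : E → ℝ}, Continuous H → Integrable (fun x => ‖fderiv ℝ H x‖ ^ 2) (stdGaussian E) →
      ∫ x, ‖fderiv ℝ (fun y => max (H y - ε) 0) x‖ ^ 2 ∂stdGaussian E ≤
        ∫ x, ‖fderiv ℝ H x‖ ^ 2 ∂stdGaussian E := by
    intro H hH hHi
    refine integral_mono_of_nonneg (Eventually.of_forall fun x => sq_nonneg _) hHi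
      (Eventually.of_forall fun x => ?_)
    exact pow_le_pow_left₀ (norm_nonneg _) (norm_fderiv_max_sub_le hH x) 2
  refine two_le_add_of_separated (A := {x | ε ≤ F x}) (B := {x | ε ≤ G x})
    cA.isClosed.measurableSet cB.isClosed.measurableSet hd
    (D := max (max D₁ D₂) 1) (lt_max_of_lt_right one_pos) hdA
    (fun x hx => (hD₁ x hx).trans ((le_max_left _ _).trans (le_max_left _ _)))
    (fun x hx => (hD₂ x hx).trans ((le_max_right _ _).trans (le_max_left _ _))) hK hK'
    (hBM hF F0 hFD ε hε) (hBM hG G0 hGD ε hε) (fun _ => le_max_right _ _)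
    (fun _ => le_max_right _ _) (fun x hx => ?_) (fun x hx => ?_) h1 h2
    ((hen hF hFi).trans_lt h3) ((hen hG hGi).trans_lt h4)
  · simp only [mem_ofPred_eq, not_le] at hx
    exact max_eq_right (by linarith)
  · simp only [mem_ofPred_eq, not_le] at hx
    exact max_eq_right (by linarith)

end Truncation

/-! ### Polar coordinates -/

section Polar

variable {E : Type*} [NormedAddCommGroup E] [InnerProductSpace ℝ E] [FiniteDimensional ℝ E]
  [MeasurableSpace E] [BorelSpace E]

lemma integral_volumeIoiPow (n : ℕ) (k : ℝ → ℝ) :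
    ∫ s : Ioi (0 : ℝ), k s ∂(Measure.volumeIoiPow n) = ∫ s in Ioi (0 : ℝ), s ^ n * k s := by
  simp only [Measure.volumeIoiPow, ENNReal.ofReal]
  rw [integral_withDensity_eq_integral_smul,
    integral_subtype_comap measurableSet_Ioi fun a ↦ Real.toNNReal (a ^ n) • k a,
    setIntegral_congr_fun measurableSet_Ioi fun x hx ↦ ?_]
  · rw [NNReal.smul_def, Real.coe_toNNReal _ (pow_nonneg hx.out.le _), smul_eq_mul]
  · exact (measurable_subtype_coe.pow_const _).real_toNNReal

lemma integrable_volumeIoiPow_iff (n : ℕ) (k : ℝ → ℝ) :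
    Integrable (fun s : Ioi (0 : ℝ) => k s) (Measure.volumeIoiPow n) ↔
      IntegrableOn (fun s => s ^ n * k s) (Ioi (0 : ℝ)) := by
  rw [integrableOn_iff_comap_subtypeVal measurableSet_Ioi, Function.comp_def,
    Measure.volumeIoiPow, integrable_withDensity_iff_integrable_smul', integrable_congr]
  · refine .of_forall ?_
    rintro ⟨x, hx : 0 < x⟩
    simp (disch := positivity) [ENNReal.toReal_ofReal]
  · fun_prop
  · simp

lemma integrable_polar {f : E → ℝ} (hf : Integrable f) :
    Integrable (fun p : sphere (0 : E) 1 × Ioi (0 : ℝ) => f ((p.2 : ℝ) • (p.1 : E)))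
      ((volume : Measure E).toSphere.prod (Measure.volumeIoiPow (Module.finrank ℝ E - 1))) := by
  have h := (volume : Measure E).measurePreserving_homeomorphUnitSphereProd.integrable_comp_emb
    (g := fun p : sphere (0 : E) 1 × Ioi (0 : ℝ) => f ((p.2 : ℝ) • (p.1 : E)))
    (Homeomorph.measurableEmbedding _)
  refine h.1 ?_
  have h2 : IntegrableOn f ({0}ᶜ : Set E) := hf.integrableOn
  rw [integrableOn_iff_comap_subtypeVal (measurableSet_singleton _).compl] at h2
  refine h2.congr (.of_forall fun x => ?_)
  have : ‖(x : E)‖ ≠ 0 := norm_ne_zero_iff.2 x.2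
  simp [smul_smul, this]

variable [Nontrivial E]

theorem integral_polar {f : E → ℝ} (hf : Integrable f) :
    IntegrableOn (fun s : ℝ => s ^ (Module.finrank ℝ E - 1) *
      ∫ θ : sphere (0 : E) 1, f (s • (θ : E)) ∂(volume : Measure E).toSphere) (Ioi 0) ∧
    ∫ x, f x = ∫ s in Ioi (0 : ℝ), s ^ (Module.finrank ℝ E - 1) *
      ∫ θ : sphere (0 : E) 1, f (s • (θ : E)) ∂(volume : Measure E).toSphere := by
  have hi := integrable_polar hf
  constructor
  · rw [← integrable_volumeIoiPow_iff]
    exact hi.integral_prod_right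
  · rw [← integral_volumeIoiPow _ (fun s => ∫ θ : sphere (0 : E) 1, f (s • (θ : E))
      ∂(volume : Measure E).toSphere), ← integral_prod_symm _ hi,
      ← (volume : Measure E).measurePreserving_homeomorphUnitSphereProd.integral_comp
        (Homeomorph.measurableEmbedding _)]
    have h1 : ∫ x, f x = ∫ x : ({0}ᶜ : Set E), f x ∂((volume : Measure E).comap (↑)) := by
      rw [integral_subtype_comap (measurableSet_singleton _).compl, restrict_compl_singleton]
    rw [h1]
    refine integral_congr_ae (.of_forall fun x => ?_)
    have : ‖(x : E)‖ ≠ 0 := norm_ne_zero_iff.2 x.2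
    simp [smul_smul, this]

lemma ae_polar {P : E → Prop} (h : ∀ᵐ x, P x) :
    ∀ᵐ s ∂(volume.restrict (Ioi (0 : ℝ))),
      ∀ᵐ θ : sphere (0 : E) 1 ∂(volume : Measure E).toSphere, P (s • (θ : E)) := by
  obtain ⟨t, ht, hP, ht0⟩ : ∃ t, MeasurableSet t ∧ (∀ x ∉ t, P x) ∧ volume t = 0 := by
    refine ⟨toMeasurable volume {x | ¬ P x}, measurableSet_toMeasurable _ _, fun x hx => ?_, ?_⟩
    · by_contra h'
      exact hx (subset_toMeasurable _ _ h')
    · rw [measure_toMeasurable]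
      exact h
  have hi : Integrable (t.indicator fun _ => (1 : ℝ)) (volume : Measure E) := by
    rw [integrable_indicator_iff ht, integrableOn_const_iff]
    simp [ht0]
  obtain ⟨h1, h2⟩ := integral_polar hi
  rw [integral_indicator_const _ ht, measureReal_def, ht0] at h2
  have h3 : ∀ s ∈ Ioi (0 : ℝ), 0 ≤ s ^ (Module.finrank ℝ E - 1) * ∫ θ : sphere (0 : E) 1,
      t.indicator (fun _ => (1 : ℝ)) (s • (θ : E)) ∂(volume : Measure E).toSphere := by
    intro s hs
    have : (0 : ℝ) < s := hs
    exact mul_nonneg (by positivity) (integral_nonneg fun θ => indicator_nonneg (by simp) _)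
  have h4 := (setIntegral_eq_zero_iff_of_nonneg_ae
    ((ae_restrict_mem measurableSet_Ioi).mono h3) h1).1 (by simpa using h2.symm)
  filter_upwards [h4, ae_restrict_mem measurableSet_Ioi] with s hs hs0
  have hs0' : (0 : ℝ) < s := hs0
  have h5 : ∫ θ : sphere (0 : E) 1, t.indicator (fun _ => (1 : ℝ)) (s • (θ : E))
      ∂(volume : Measure E).toSphere = 0 := by
    have : s ^ (Module.finrank ℝ E - 1) ≠ 0 := by positivity
    simpa [this] using hs
  have hm : MeasurableSet {θ : sphere (0 : E) 1 | s • (θ : E) ∈ t} :=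
    ht.preimage (f := fun θ : sphere (0 : E) 1 => s • (θ : E)) (by fun_prop)
  have h6 : ∫ θ : sphere (0 : E) 1, {θ : sphere (0 : E) 1 | s • (θ : E) ∈ t}.indicator
      (fun _ => (1 : ℝ)) θ ∂(volume : Measure E).toSphere = 0 := h5
  rw [integral_indicator_const _ hm] at h6
  have h7 : (volume : Measure E).toSphere {θ : sphere (0 : E) 1 | s • (θ : E) ∈ t} = 0 := by
    simpa [measureReal_def, ENNReal.toReal_eq_zero_iff] using h6
  rw [ae_iff]
  refine measure_mono_null (fun θ hθ => ?_) h7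
  by_contra h'
  exact hθ (hP _ h')

end Polar

/-! ### Test functions which are homogeneous up to a radial factor -/

section ConeFn

open ProbabilityTheory Real

variable {E : Type*} [NormedAddCommGroup E] [InnerProductSpace ℝ E]

/-- The function `ρ^α exp(-ηρ²) w(rθ)` in polar coordinates. -/
def coneFn (α η r : ℝ) (w : E → ℝ) (x : E) : ℝ :=
  ‖x‖ ^ α * rexp (-η * ‖x‖ ^ 2) * w ((r / ‖x‖) • x)

lemma coneFn_smul {α η r : ℝ} {w : E → ℝ} {s : ℝ} (hs : 0 < s) {θ : E} (hθ : ‖θ‖ = 1) :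
    coneFn α η r w (s • θ) = s ^ α * rexp (-η * s ^ 2) * w (r • θ) := by
  simp [coneFn, norm_smul, hθ, abs_of_pos hs, smul_smul, hs.ne']

lemma coneFn_nonneg {α η r : ℝ} {w : E → ℝ} (hw : ∀ x, 0 ≤ w x) (x : E) :
    0 ≤ coneFn α η r w x := by
  unfold coneFn
  have := hw ((r / ‖x‖) • x)
  positivity

lemma coneFn_zero {α η r : ℝ} (hα : 0 < α) {w : E → ℝ} : coneFn α η r w 0 = 0 := by
  simp [coneFn, Real.zero_rpow hα.ne']

lemma norm_div_smul_le {r : ℝ} (hr : 0 < r) (x : E) : ‖(r / ‖x‖) • x‖ ≤ r := by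
  rcases eq_or_ne x 0 with rfl | hx
  · simpa using hr.le
  · have : ‖x‖ ≠ 0 := norm_ne_zero_iff.2 hx
    rw [norm_smul, norm_div, norm_norm, Real.norm_of_nonneg hr.le]
    field_simp
    exact le_rfl

lemma exists_coneFn_le {w : E → ℝ} {L : NNReal} (hw : LipschitzWith L w) {r : ℝ} (hr : 0 < r) :
    ∃ C, 0 ≤ C ∧ ∀ α η : ℝ, ∀ x, |coneFn α η r w x| ≤ C * (‖x‖ ^ α * rexp (-η * ‖x‖ ^ 2)) := by
  refine ⟨|w 0| + L * r, by positivity, fun α η x => ?_⟩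
  have h1 : |w ((r / ‖x‖) • x)| ≤ |w 0| + L * r := by
    have h2 := hw.dist_le_mul ((r / ‖x‖) • x) 0
    rw [dist_zero_right, Real.dist_eq] at h2
    have h3 : (L : ℝ) * ‖(r / ‖x‖) • x‖ ≤ L * r :=
      mul_le_mul_of_nonneg_left (norm_div_smul_le hr x) L.2
    have h4 := abs_sub_abs_le_abs_sub (w ((r / ‖x‖) • x)) (w 0)
    linarith
  unfold coneFn
  rw [abs_mul, abs_of_nonneg (by positivity), mul_comm]
  exact mul_le_mul_of_nonneg_right h1 (by positivity)

lemma contDiffAt_radial {α η : ℝ} {x : E} (hx : x ≠ 0) :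
    ContDiffAt ℝ 1 (fun y : E => ‖y‖ ^ α * rexp (-η * ‖y‖ ^ 2)) x := by
  have h1 : ContDiffAt ℝ 1 (fun y : E => ‖y‖) x := contDiffAt_norm ℝ hx
  have h2 : ContDiffAt ℝ 1 (fun y : E => ‖y‖ ^ α) x :=
    h1.rpow_const_of_ne (norm_ne_zero_iff.2 hx)
  have h3 : ContDiffAt ℝ 1 (fun y : E => rexp (-η * ‖y‖ ^ 2)) x := by fun_prop
  exact h2.mul h3

lemma contDiffAt_div_norm_smul {r : ℝ} {x : E} (hx : x ≠ 0) :
    ContDiffAt ℝ 1 (fun y : E => (r / ‖y‖) • y) x := by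
  have h1 : ContDiffAt ℝ 1 (fun y : E => ‖y‖) x := contDiffAt_norm ℝ hx
  exact (contDiffAt_const.div h1 (norm_ne_zero_iff.2 hx)).smul contDiffAt_id

lemma continuous_coneFn {α η r : ℝ} (hα : 0 < α) (hη : 0 ≤ η) (hr : 0 < r) {w : E → ℝ} {L : NNReal}
    (hw : LipschitzWith L w) : Continuous (coneFn α η r w) := by
  rw [continuous_iff_continuousAt]
  intro x
  rcases eq_or_ne x 0 with rfl | hx
  · obtain ⟨C, hC0, hC⟩ := exists_coneFn_le hw hr
    unfold ContinuousAt
    rw [coneFn_zero hα]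
    have h1 : Tendsto (fun x : E => C * ‖x‖ ^ α) (nhds 0) (nhds 0) := by
      have : Continuous fun x : E => C * ‖x‖ ^ α :=
        continuous_const.mul (continuous_norm.rpow_const fun x => Or.inr hα.le)
      simpa [Real.zero_rpow hα.ne'] using this.tendsto 0
    refine squeeze_zero_norm (fun x => ?_) h1
    refine (hC α η x).trans (mul_le_mul_of_nonneg_left ?_ hC0)
    refine mul_le_of_le_one_right (by positivity) (exp_le_one_iff.2 ?_)
    nlinarith [sq_nonneg ‖x‖]
  · exact (contDiffAt_radial hx).continuousAt.mul
      (hw.continuous.continuousAt.comp (contDiffAt_div_norm_smul hx).continuousAt)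

lemma exists_norm_le_of_le_coneFn {α η r : ℝ} (hη : 0 < η) (hr : 0 < r) {w : E → ℝ}
    {L : NNReal} (hw : LipschitzWith L w) {ε : ℝ} (hε : 0 < ε) :
    ∃ D, ∀ x, ε ≤ coneFn α η r w x → ‖x‖ ≤ D := by
  obtain ⟨C, hC0, hC⟩ := exists_coneFn_le hw hr
  have h1 : Tendsto (fun x : ℝ => x ^ α * rexp (-η * x ^ 2)) atTop (nhds 0) := by
    refine (rpow_mul_exp_neg_mul_sq_isLittleO_exp_neg hη α).trans_tendsto ?_
    exact tendsto_exp_atBot.comp (tendsto_id.const_mul_atTop_of_neg (by norm_num))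
  have h2 : Tendsto (fun x : ℝ => C * (x ^ α * rexp (-η * x ^ 2))) atTop (nhds 0) := by
    simpa using h1.const_mul C
  obtain ⟨D, hD⟩ := (eventually_atTop.1 (h2.eventually (gt_mem_nhds hε)))
  refine ⟨D, fun x hx => ?_⟩
  by_contra! h
  have := hD ‖x‖ h.le
  have h3 := (le_abs_self _).trans (hC α η x)
  linarith

lemma exists_lipschitzOnWith_coneFn {α η r : ℝ} {w : E → ℝ} {L : NNReal}
    (hw : LipschitzWith L w) {x : E} (hx : x ≠ 0) :
    ∃ K, ∃ t ∈ nhds x, LipschitzOnWith K (coneFn α η r w) t := by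
  obtain ⟨K₁, t₁, ht₁, h₁⟩ := (contDiffAt_radial (α := α) (η := η) hx).exists_lipschitzOnWith
  obtain ⟨K₂, t₂, ht₂, h₂⟩ := (contDiffAt_div_norm_smul (r := r) hx).exists_lipschitzOnWith
  have hm : ContDiff ℝ 1 (fun p : ℝ × ℝ => p.1 * p.2) := by fun_prop
  obtain ⟨K₃, t₃, ht₃, h₃⟩ := hm.contDiffAt.exists_lipschitzOnWith
    (x := (‖x‖ ^ α * rexp (-η * ‖x‖ ^ 2), w ((r / ‖x‖) • x)))
  have hc : ContinuousAt (fun y : E => (‖y‖ ^ α * rexp (-η * ‖y‖ ^ 2), w ((r / ‖y‖) • y))) x :=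
    (contDiffAt_radial hx).continuousAt.prodMk
      (hw.continuous.continuousAt.comp (contDiffAt_div_norm_smul hx).continuousAt)
  have h4 : LipschitzOnWith (max K₁ (L * K₂))
      (fun y : E => (‖y‖ ^ α * rexp (-η * ‖y‖ ^ 2), w ((r / ‖y‖) • y))) (t₁ ∩ t₂) :=
    (h₁.mono inter_subset_left).prodMk
      ((hw.lipschitzOnWith (s := univ)).comp (h₂.mono inter_subset_right) (mapsTo_univ _ _))
  exact ⟨K₃ * max K₁ (L * K₂), _, inter_mem (inter_mem ht₁ ht₂) (hc.preimage_mem_nhds ht₃),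
    h₃.comp (h4.mono inter_subset_left) fun y hy => hy.2⟩

variable [FiniteDimensional ℝ E]

lemma exists_lipschitzWith_max_coneFn_sub {α η r : ℝ} (hα : 0 < α) (hη : 0 < η) (hr : 0 < r)
    {w : E → ℝ} {L : NNReal} (hw : LipschitzWith L w) {ε : ℝ} (hε : 0 < ε) :
    ∃ K, LipschitzWith K (fun x => max (coneFn α η r w x - ε) 0) := by
  set f : E → ℝ := fun x => max (coneFn α η r w x - ε) 0 with hf
  have hcont := continuous_coneFn hα hη.le hr hw
  have hfc : Continuous f := by fun_prop
  have hloc : LocallyLipschitz f := by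
    intro x
    rcases eq_or_ne x 0 with rfl | hx
    · have h1 : ∀ᶠ y in nhds (0 : E), coneFn α η r w y < ε :=
        hcont.continuousAt.eventually (gt_mem_nhds (by rw [coneFn_zero hα]; exact hε))
      refine ⟨0, _, h1, ?_⟩
      have : EqOn f (fun _ => 0) {y | coneFn α η r w y < ε} := fun y hy =>
        max_eq_right (by simp only [mem_ofPred_eq] at hy; linarith)
      exact fun a ha b hb => by rw [this ha, this hb]; simp
    · obtain ⟨K, t, ht, h⟩ := exists_lipschitzOnWith_coneFn (α := α) (η := η) (r := r) hw hx
      refine ⟨K, t, ht, ?_⟩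
      have h2 : LipschitzWith 1 (fun a : ℝ => max (a - ε) 0) := by
        have : LipschitzWith 1 (fun a : ℝ => a - ε) := LipschitzWith.of_dist_le_mul fun a b => by
          simp
        exact this.max_const 0
      simpa [Function.comp_def] using (h2.lipschitzOnWith (s := univ)).comp h (mapsTo_univ _ _)
  obtain ⟨D, hD⟩ := exists_norm_le_of_le_coneFn (α := α) hη hr hw hε
  have hf0 : ∀ x, D < ‖x‖ → f x = 0 := fun x hx => max_eq_right (by
    by_contra! h
    linarith [hD x (by linarith)])
  have hcb := isCompact_closedBall (0 : E) (D + 1)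
  obtain ⟨K, hK⟩ := hloc.locallyLipschitzOn.exists_lipschitzOnWith_of_compact hcb
  obtain ⟨C, hC⟩ := hcb.exists_bound_of_continuousOn hfc.continuousOn
  have hfC : ∀ x, |f x| ≤ max C 0 := by
    intro x
    by_cases hx : x ∈ closedBall (0 : E) (D + 1)
    · exact (hC x hx).trans (le_max_left _ _)
    · rw [hf0 x (by simp at hx; linarith), abs_zero]
      exact le_max_right _ _
  have key : ∀ x y, y ∉ closedBall (0 : E) (D + 1) →
      |f x - f y| ≤ (max K (max C 0).toNNReal : NNReal) * dist x y := by
    intro x y hy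
    have hy' : D + 1 < ‖y‖ := by simpa using hy
    rw [hf0 y (by linarith), sub_zero]
    rcases lt_or_ge D ‖x‖ with hx | hx
    · rw [hf0 x hx, abs_zero]
      positivity
    · have h1 : 1 ≤ dist x y := by
        rw [dist_comm, dist_eq_norm]
        have := norm_sub_norm_le y x
        linarith
      have h2 : max C 0 ≤ ((max K (max C 0).toNNReal : NNReal) : ℝ) := by
        have : (max C 0).toNNReal ≤ max K (max C 0).toNNReal := le_max_right _ _
        have h3 := NNReal.coe_le_coe.2 this
        rwa [Real.coe_toNNReal _ (le_max_right _ _)] at h3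
      calc |f x| ≤ max C 0 := hfC x
        _ ≤ ((max K (max C 0).toNNReal : NNReal) : ℝ) := h2
        _ ≤ _ := le_mul_of_one_le_right (NNReal.coe_nonneg _) h1
  refine ⟨max K (max C 0).toNNReal, LipschitzWith.of_dist_le_mul fun x y => ?_⟩
  by_cases hy : y ∈ closedBall (0 : E) (D + 1)
  · by_cases hx : x ∈ closedBall (0 : E) (D + 1)
    · refine (hK.dist_le_mul x hx y hy).trans (mul_le_mul_of_nonneg_right ?_ dist_nonneg)
      exact_mod_cast le_max_left _ _
    · rw [dist_comm, dist_comm x]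
      exact key y x hx
  · exact key x y hy

end ConeFn

/-! ### The Gaussian energy of the test functions -/

section ConeEnergy

open ProbabilityTheory Real

variable {E : Type*} [NormedAddCommGroup E] [InnerProductSpace ℝ E]

lemma hasFDerivAt_norm_of_ne_zero {x : E} (hx : x ≠ 0) :
    HasFDerivAt (fun y : E => ‖y‖) ((1 / ‖x‖) • innerSL ℝ x) x := by
  have h1 := ((hasFDerivAt_id (𝕜 := ℝ) x).norm_sq).sqrt (by simpa using hx)
  have h2 : (fun y : E => √(‖id y‖ ^ 2)) = fun y => ‖y‖ := by
    ext y
    simp [Real.sqrt_sq]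
  rw [h2] at h1
  convert h1 using 1
  ext v
  have : ‖x‖ ≠ 0 := norm_ne_zero_iff.2 hx
  simp [Real.sqrt_sq]
  field_simp

/-- `r²` times the squared tangential gradient of `w` at the point `rθ`. -/
def tangSq (w : E → ℝ) (r : ℝ) (θ : E) : ℝ :=
  r ^ 2 * (‖fderiv ℝ w (r • θ)‖ ^ 2 - (fderiv ℝ w (r • θ) θ) ^ 2)

lemma tangSq_nonneg (w : E → ℝ) (r : ℝ) {θ : E} (hθ : ‖θ‖ = 1) : 0 ≤ tangSq w r θ := by
  unfold tangSq
  have h := (fderiv ℝ w (r • θ)).le_opNorm θ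
  rw [hθ, mul_one, Real.norm_eq_abs] at h
  have := pow_le_pow_left₀ (abs_nonneg _) h 2
  rw [sq_abs] at this
  exact mul_nonneg (sq_nonneg _) (by linarith)

lemma tangSq_le {w : E → ℝ} {L : NNReal} (hw : LipschitzWith L w) (r : ℝ) (θ : E) :
    tangSq w r θ ≤ r ^ 2 * L ^ 2 := by
  unfold tangSq
  refine mul_le_mul_of_nonneg_left ?_ (sq_nonneg _)
  have h := norm_fderiv_le_of_lipschitz ℝ hw (x₀ := r • θ)
  have := pow_le_pow_left₀ (norm_nonneg _) h 2
  nlinarith [sq_nonneg (fderiv ℝ w (r • θ) θ)]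

variable [FiniteDimensional ℝ E]

lemma norm_sq_fderiv_coneFn {α η r : ℝ} {w : E → ℝ} {s : ℝ} (hs : 0 < s) {θ : E}
    (hθ : ‖θ‖ = 1) (hw : DifferentiableAt ℝ w (r • θ)) :
    ‖fderiv ℝ (coneFn α η r w) (s • θ)‖ ^ 2 =
      ((α / s - 2 * η * s) * (s ^ α * rexp (-η * s ^ 2))) ^ 2 * (w (r • θ)) ^ 2 +
        (s ^ α * rexp (-η * s ^ 2) / s) ^ 2 * tangSq w r θ := by
  set x := s • θ with hx
  have hxn : ‖x‖ = s := by simp [hx, norm_smul, hθ, abs_of_pos hs]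
  have hx0 : x ≠ 0 := norm_ne_zero_iff.1 (by rw [hxn]; exact hs.ne')
  have hrx : (r / ‖x‖) • x = r • θ := by
    rw [hxn, hx, smul_smul]
    field_simp
  have hN := hasFDerivAt_norm_of_ne_zero hx0
  rw [hxn] at hN
  have hψ : HasDerivAt (fun ρ : ℝ => ρ ^ α * rexp (-η * ρ ^ 2))
      ((α / s - 2 * η * s) * (s ^ α * rexp (-η * s ^ 2))) s := by
    have h1 := (Real.hasDerivAt_rpow_const (p := α) (Or.inl hs.ne')).mul
      (((hasDerivAt_pow 2 s).const_mul (-η)).exp)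
    refine h1.congr_deriv ?_
    rw [Real.rpow_sub_one hs.ne']
    simp only [Nat.cast_ofNat]
    field_simp
    ring
  have hA : HasFDerivAt (fun y : E => ‖y‖ ^ α * rexp (-η * ‖y‖ ^ 2))
      (((α / s - 2 * η * s) * (s ^ α * rexp (-η * s ^ 2))) • (1 / s) • innerSL ℝ x) x := by
    have h1 : HasDerivAt (fun ρ : ℝ => ρ ^ α * rexp (-η * ρ ^ 2))
      ((α / s - 2 * η * s) * (s ^ α * rexp (-η * s ^ 2))) ‖x‖ := by rwa [hxn]
    exact h1.comp_hasFDerivAt x hN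
  have hI : HasDerivAt (fun ρ : ℝ => r / ρ) (-r / s ^ 2) s := by
    have := (hasDerivAt_inv hs.ne').const_mul r
    simp only [div_eq_mul_inv] at this ⊢
    refine this.congr_deriv ?_
    ring
  have hB : HasFDerivAt (fun y : E => (r / ‖y‖) • y)
      ((r / s) • ContinuousLinearMap.id ℝ E +
        ((-r / s ^ 2) • (1 / s) • innerSL ℝ x).smulRight x) x := by
    have h1 : HasDerivAt (fun ρ : ℝ => r / ρ) (-r / s ^ 2) ‖x‖ := by rwa [hxn]
    have h2 := (h1.comp_hasFDerivAt x hN).smul (hasFDerivAt_id x)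
    simp only [Function.comp_def, hxn] at h2
    exact h2
  have hW : HasFDerivAt (fun y : E => w ((r / ‖y‖) • y))
      ((fderiv ℝ w (r • θ)).comp ((r / s) • ContinuousLinearMap.id ℝ E +
        ((-r / s ^ 2) • (1 / s) • innerSL ℝ x).smulRight x)) x := by
    have h1 : HasFDerivAt w (fderiv ℝ w (r • θ)) ((r / ‖x‖) • x) := by
      rw [hrx]; exact hw.hasFDerivAt
    exact HasFDerivAt.comp (f := fun y : E => (r / ‖y‖) • y) x h1 hB
  have hF := hA.mul hW
  rw [hxn] at hrx
  simp only [hxn, hrx] at hF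
  have hgrad := hw.hasGradientAt
  set g := gradient w (r • θ) with hg
  have hgf : ∀ v, fderiv ℝ w (r • θ) v = ⟪g, v⟫ := fun v => by
    rw [hg, ← InnerProductSpace.toDual_apply_apply (𝕜 := ℝ), toDual_gradient]
  have hgn : ‖fderiv ℝ w (r • θ)‖ = ‖g‖ := by
    rw [hg, ← toDual_gradient, LinearIsometryEquiv.norm_map]
  have hfd : fderiv ℝ (coneFn α η r w) x = InnerProductSpace.toDual ℝ E
      (((α / s - 2 * η * s) * (s ^ α * rexp (-η * s ^ 2)) * w (r • θ)) • θ +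
        (s ^ α * rexp (-η * s ^ 2) * (r / s)) • (g - ⟪g, θ⟫ • θ)) := by
    have : coneFn α η r w = (fun y : E => ‖y‖ ^ α * rexp (-η * ‖y‖ ^ 2)) *
      fun y : E => w ((r / ‖y‖) • y) := rfl
    rw [this, hF.fderiv]
    ext v
    simp only [InnerProductSpace.toDual_apply_apply, inner_smul_left,
      inner_sub_left, add_apply, smul_apply,
      ContinuousLinearMap.comp_apply, ContinuousLinearMap.smulRight_apply, hgf, map_add,
      innerSL_apply_apply, smul_eq_mul, inner_add_right, inner_smul_right, hx,
      ContinuousLinearMap.id_apply, conj_trivial]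
    field_simp
    ring
  rw [hfd, LinearIsometryEquiv.norm_map, ← real_inner_self_eq_norm_sq]
  have hθθ : ⟪θ, θ⟫ = (1 : ℝ) := by rw [real_inner_self_eq_norm_sq, hθ]; norm_num
  unfold tangSq
  rw [hgn, hgf, ← real_inner_self_eq_norm_sq]
  simp only [inner_add_left, inner_add_right, inner_smul_left, inner_smul_right, inner_sub_left,
    inner_sub_right, hθθ, conj_trivial, real_inner_comm g θ]
  field_simp
  ring

end ConeEnergy

section ConeEnergyIntegral

open ProbabilityTheory Real

lemma integral_rpow_add_two_mul_exp_neg_mul_sq {q b : ℝ} (hq : -1 < q) (hb : 0 < b) :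
    ∫ x in Ioi (0 : ℝ), x ^ (q + 2) * rexp (-b * x ^ 2) =
      (q + 1) / (2 * b) * ∫ x in Ioi (0 : ℝ), x ^ q * rexp (-b * x ^ 2) := by
  simp_rw [← Real.rpow_two]
  rw [integral_rpow_mul_exp_neg_mul_rpow two_pos (by linarith) hb,
    integral_rpow_mul_exp_neg_mul_rpow two_pos hq hb]
  have h1 : (q + 2 + 1) / 2 = (q + 1) / 2 + 1 := by ring
  have h2 : -(q + 2 + 1) / 2 = -(q + 1) / 2 - 1 := by ring
  rw [h1, h2, Real.Gamma_add_one (by linarith), Real.rpow_sub_one hb.ne']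
  field_simp

lemma integral_rpow_mul_exp_neg_mul_sq_pos {q b : ℝ} (hq : -1 < q) (hb : 0 < b) :
    0 < ∫ x in Ioi (0 : ℝ), x ^ q * rexp (-b * x ^ 2) := by
  simp_rw [← Real.rpow_two]
  rw [integral_rpow_mul_exp_neg_mul_rpow two_pos hq hb]
  have := Real.Gamma_pos_of_pos (show 0 < (q + 1) / 2 by linarith)
  positivity

variable {E : Type*} [NormedAddCommGroup E] [InnerProductSpace ℝ E] [FiniteDimensional ℝ E]
  [MeasurableSpace E] [BorelSpace E]

lemma ae_of_ae_toSphere {P : E → Prop} [Nontrivial E]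
    (h : ∀ᵐ θ : sphere (0 : E) 1 ∂(volume : Measure E).toSphere, P θ) :
    ∀ᵐ x : E, P (‖x‖⁻¹ • x) := by
  have h1 : ∀ᵐ p ∂((volume : Measure E).toSphere.prod
      (Measure.volumeIoiPow (Module.finrank ℝ E - 1))), P p.1 :=
    Measure.quasiMeasurePreserving_fst.ae h
  have h2 := (volume : Measure E).measurePreserving_homeomorphUnitSphereProd.quasiMeasurePreserving.ae h1
  rw [← restrict_compl_singleton (μ := (volume : Measure E)) 0,
    ← map_comap_subtype_coe (measurableSet_singleton _).compl,
    (MeasurableEmbedding.subtype_coe (measurableSet_singleton _).compl).ae_map_iff]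
  filter_upwards [h2] with x hx
  simpa using hx

lemma exists_integral_stdGaussian_polar [Nontrivial E] : ∃ Z : ℝ, 0 < Z ∧ ∀ g : E → ℝ,
    Integrable (fun x => rexp (-(1 / 2) * ‖x‖ ^ 2) * g x) → Integrable g (stdGaussian E) ∧
      ∫ x, g x ∂stdGaussian E = Z * ∫ s in Ioi (0 : ℝ), s ^ (Module.finrank ℝ E - 1) *
        (rexp (-(1 / 2) * s ^ 2) *
          ∫ θ : sphere (0 : E) 1, g (s • (θ : E)) ∂(volume : Measure E).toSphere) := by
  obtain ⟨Z, hZ, h⟩ := stdGaussian_eq_withDensity (E := E)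
  refine ⟨Z, hZ, fun g hg => ?_⟩
  have hm : Measurable fun x : E => ENNReal.ofReal (Z * rexp (-(1 / 2) * ‖x‖ ^ 2)) := by fun_prop
  have ht : ∀ x : E, (ENNReal.ofReal (Z * rexp (-(1 / 2) * ‖x‖ ^ 2))).toReal =
      Z * rexp (-(1 / 2) * ‖x‖ ^ 2) := fun x => ENNReal.toReal_ofReal (by positivity)
  constructor
  · rw [h, integrable_withDensity_iff_integrable_smul' hm (by simp)]
    simp_rw [ht, smul_eq_mul, mul_assoc]
    exact hg.const_mul Z
  · rw [h, integral_withDensity_eq_integral_toReal_smul hm (by simp)]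
    simp_rw [ht, smul_eq_mul, mul_assoc]
    rw [integral_const_mul, (integral_polar hg).2]
    congr 1
    refine setIntegral_congr_fun measurableSet_Ioi fun s hs => ?_
    have hs0 : (0 : ℝ) < s := hs
    simp [norm_smul, integral_const_mul]

end ConeEnergyIntegral

section ConeRayleigh

open ProbabilityTheory Real

lemma pow_mul_exp_mul_radial_sq {n : ℕ} (hn : 1 ≤ n) {α η s : ℝ} (hs : 0 < s) :
    s ^ (n - 1) * (rexp (-(1 / 2) * s ^ 2) * (s ^ α * rexp (-η * s ^ 2) / s) ^ 2) =
      s ^ (2 * α + n - 3) * rexp (-(1 / 2 + 2 * η) * s ^ 2) := by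
  have h1 : (s : ℝ) ^ (n - 1) = s ^ ((n : ℝ) - 1) := by
    rw [← Real.rpow_natCast, Nat.cast_sub hn, Nat.cast_one]
  have h2 : rexp (-(1 / 2 + 2 * η) * s ^ 2) =
      rexp (-(1 / 2) * s ^ 2) * (rexp (-η * s ^ 2) * rexp (-η * s ^ 2)) := by
    rw [← Real.exp_add, ← Real.exp_add]
    congr 1
    ring
  have h3 : s ^ (2 * α + n - 3) = s ^ ((n : ℝ) - 1) * (s ^ α * s ^ α) / s ^ 2 := by
    rw [← Real.rpow_natCast s 2, ← Real.rpow_add hs, ← Real.rpow_add hs, ← Real.rpow_sub hs]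
    congr 1
    push_cast
    ring
  rw [h1, h2, h3]
  field_simp

lemma energy_arith {α η n m τ J Z l : ℝ} (hn : 2 ≤ n) (hZ : 0 < Z) (hm : 0 < m) (hJ : 0 < J)
    (hα : 0 < α) (hη : 0 < η) (hη2 : α + 4 * η ^ 2 * (2 * α + n) < l)
    (hτ : τ ≤ α * (α + n - 2) * m) :
    Z * ((α ^ 2 * m + τ) * J -
        4 * α * η * m * ((2 * α + n - 3 + 1) / (2 * (1 / 2 + 2 * η)) * J) +
        4 * η ^ 2 * m * ((2 * α + n - 3 + 2 + 1) / (2 * (1 / 2 + 2 * η)) *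
          ((2 * α + n - 3 + 1) / (2 * (1 / 2 + 2 * η)) * J))) <
      l * (Z * (m * ((2 * α + n - 3 + 1) / (2 * (1 / 2 + 2 * η)) * J))) := by
  obtain ⟨b, hb⟩ : ∃ b, b = 2 * (1 / 2 + 2 * η) := ⟨_, rfl⟩
  obtain ⟨p, hp⟩ : ∃ p, p = 2 * α + n - 3 + 1 := ⟨_, rfl⟩
  have hb0 : 0 < b := by rw [hb]; positivity
  have hp0 : 0 < p := by linarith
  rw [← hb, ← hp]
  obtain ⟨I, hI⟩ : ∃ I, I = p / b * J := ⟨_, rfl⟩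
  have hIpos : 0 < I := by rw [hI]; positivity
  have hJI : p * J = b * I := by
    rw [hI]; field_simp
  rw [← hI]
  have h1 : (α ^ 2 * m + τ) * J ≤ α * (1 + 4 * η) * m * I := by
    have : α ^ 2 * m + τ ≤ α * p * m := by
      rw [hp]; nlinarith
    calc (α ^ 2 * m + τ) * J ≤ α * p * m * J := mul_le_mul_of_nonneg_right this hJ.le
      _ = α * m * (p * J) := by ring
      _ = α * (1 + 4 * η) * m * I := by rw [hJI, hb]; ring
  have h2 : (2 * α + n - 3 + 2 + 1) / b ≤ 2 * α + n := by
    rw [div_le_iff₀ hb0, hb]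
    nlinarith
  have h3 : 4 * η ^ 2 * m * ((2 * α + n - 3 + 2 + 1) / b * I) ≤
      4 * η ^ 2 * m * ((2 * α + n) * I) :=
    mul_le_mul_of_nonneg_left (mul_le_mul_of_nonneg_right h2 hIpos.le) (by positivity)
  have h4 : (α + 4 * η ^ 2 * (2 * α + n)) * (m * I) < l * (m * I) :=
    mul_lt_mul_of_pos_right hη2 (by positivity)
  have h5 : (α ^ 2 * m + τ) * J - 4 * α * η * m * I +
      4 * η ^ 2 * m * ((2 * α + n - 3 + 2 + 1) / b * I) < l * (m * I) := by linarith
  calc _ < Z * (l * (m * I)) := mul_lt_mul_of_pos_left h5 hZ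
    _ = _ := by ring

variable {E : Type*} [NormedAddCommGroup E] [InnerProductSpace ℝ E] [FiniteDimensional ℝ E]
  [MeasurableSpace E] [BorelSpace E]

lemma integrable_radial [Nontrivial E] {α η : ℝ} (hα : 0 < α) (hη : 0 ≤ η)
    (hn : 2 ≤ Module.finrank ℝ E) (a b c : ℝ) :
    Integrable (fun x : E => rexp (-(1 / 2) * ‖x‖ ^ 2) *
      ((‖x‖ ^ α * rexp (-η * ‖x‖ ^ 2) / ‖x‖) ^ 2 * (a + b * ‖x‖ ^ 2 + c * ‖x‖ ^ 4))) := by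
  have h := integrable_fun_norm_addHaar (volume : Measure E) (f := fun s : ℝ =>
    rexp (-(1 / 2) * s ^ 2) * ((s ^ α * rexp (-η * s ^ 2) / s) ^ 2 * (a + b * s ^ 2 + c * s ^ 4)))
  refine h.2 ?_
  have hb : 0 < 1 / 2 + 2 * η := by positivity
  have hn' : (2 : ℝ) ≤ Module.finrank ℝ E := by exact_mod_cast hn
  set q : ℝ := 2 * α + Module.finrank ℝ E - 3 with hq
  have i0 := integrableOn_rpow_mul_exp_neg_mul_sq hb (s := q) (by linarith)
  have i2 := integrableOn_rpow_mul_exp_neg_mul_sq hb (s := q + 2) (by linarith)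
  have i4 := integrableOn_rpow_mul_exp_neg_mul_sq hb (s := q + 2 + 2) (by linarith)
  have h4 := ((i0.const_mul a).add (i2.const_mul b)).add (i4.const_mul c)
  refine IntegrableOn.congr_fun h4 (fun s hs => ?_) measurableSet_Ioi
  have hs0 : (0 : ℝ) < s := hs
  have e1 := pow_mul_exp_mul_radial_sq (n := Module.finrank ℝ E) (by omega) (α := α) (η := η) hs0
  have e2 : s ^ (2 : ℝ) = s ^ 2 := by exact_mod_cast Real.rpow_natCast s 2
  simp only [Pi.add_apply, smul_eq_mul]
  rw [Real.rpow_add hs0 (q + 2), Real.rpow_add hs0 q, e2]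
  linear_combination (-(a + b * s ^ 2 + c * s ^ 4)) * e1

theorem exists_energy_coneFn_lt [Nontrivial E] (hn : 2 ≤ Module.finrank ℝ E) {w : E → ℝ}
    {L : NNReal} (hw : LipschitzWith L w) {r : ℝ} (hr : 0 < r)
    (hdiff : ∀ᵐ θ : sphere (0 : E) 1 ∂(volume : Measure E).toSphere,
      DifferentiableAt ℝ w (r • (θ : E)))
    (hm : 0 < ∫ θ : sphere (0 : E) 1, w (r • (θ : E)) ^ 2 ∂(volume : Measure E).toSphere)
    {α l : ℝ} (hα : 0 < α) (hl : α < l)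
    (hτ : ∫ θ : sphere (0 : E) 1, tangSq w r θ ∂(volume : Measure E).toSphere ≤
      α * (α + Module.finrank ℝ E - 2) *
        ∫ θ : sphere (0 : E) 1, w (r • (θ : E)) ^ 2 ∂(volume : Measure E).toSphere) :
    ∃ η, 0 < η ∧ 0 < ∫ x, coneFn α η r w x * coneFn α η r w x ∂stdGaussian E ∧
      Integrable (fun x => ‖fderiv ℝ (coneFn α η r w) x‖ ^ 2) (stdGaussian E) ∧
      ∫ x, ‖fderiv ℝ (coneFn α η r w) x‖ ^ 2 ∂stdGaussian E <
        l * ∫ x, coneFn α η r w x * coneFn α η r w x ∂stdGaussian E := by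
  set m := ∫ θ : sphere (0 : E) 1, w (r • (θ : E)) ^ 2 ∂(volume : Measure E).toSphere with hm_def
  set τ := ∫ θ : sphere (0 : E) 1, tangSq w r θ ∂(volume : Measure E).toSphere with hτ_def
  obtain ⟨Z, hZ, hpolar⟩ := exists_integral_stdGaussian_polar (E := E)
  obtain ⟨C, hC0, hC⟩ := exists_coneFn_le hw hr
  set n := Module.finrank ℝ E with hn_def
  have hn' : (2 : ℝ) ≤ n := by exact_mod_cast hn
  set q : ℝ := 2 * α + n - 3 with hq
  have hq1 : -1 < q := by linarith
  obtain ⟨η, hη, hη2⟩ : ∃ η, 0 < η ∧ α + 4 * η ^ 2 * (2 * α + n) < l := by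
    have : Tendsto (fun η : ℝ => α + 4 * η ^ 2 * (2 * α + n)) (nhdsWithin 0 (Ioi 0)) (nhds α) := by
      have h1 : Continuous (fun η : ℝ => α + 4 * η ^ 2 * (2 * α + n)) := by fun_prop
      have h2 := h1.tendsto 0
      simp only [ne_eq, OfNat.ofNat_ne_zero, not_false_eq_true, zero_pow, mul_zero, zero_mul,
        add_zero] at h2
      exact h2.mono_left nhdsWithin_le_nhds
    obtain ⟨η, h1, h2⟩ := ((this.eventually (gt_mem_nhds hl)).and self_mem_nhdsWithin).exists
    exact ⟨η, h2, h1⟩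
  have hb : 0 < 1 / 2 + 2 * η := by positivity
  set b := 1 / 2 + 2 * η with hb_def
  set J := ∫ x in Ioi (0 : ℝ), x ^ q * rexp (-b * x ^ 2) with hJ
  have hJpos : 0 < J := integral_rpow_mul_exp_neg_mul_sq_pos hq1 hb
  have hJ2 := integral_rpow_add_two_mul_exp_neg_mul_sq hq1 hb
  have hJ4 := integral_rpow_add_two_mul_exp_neg_mul_sq (q := q + 2) (by linarith) hb
  have i0 := integrableOn_rpow_mul_exp_neg_mul_sq hb (s := q) (by linarith)
  have i2 := integrableOn_rpow_mul_exp_neg_mul_sq hb (s := q + 2) (by linarith)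
  have i4 := integrableOn_rpow_mul_exp_neg_mul_sq hb (s := q + 2 + 2) (by linarith)
  have e2 : ∀ s : ℝ, s ^ (2 : ℝ) = s ^ 2 := fun s => by exact_mod_cast Real.rpow_natCast s 2
  have hFc := continuous_coneFn hα hη.le hr hw
  set F := coneFn α η r w with hF
  -- the mass
  have hmass_int : Integrable (fun x => rexp (-(1 / 2) * ‖x‖ ^ 2) * (F x * F x)) := by
    refine (integrable_radial hα hη.le hn 0 (C ^ 2) 0).mono'
      (Continuous.aestronglyMeasurable (by fun_prop)) (Eventually.of_forall fun x => ?_)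
    rw [norm_mul, Real.norm_of_nonneg (exp_pos _).le]
    refine mul_le_mul_of_nonneg_left ?_ (exp_pos _).le
    rcases eq_or_ne x 0 with rfl | hx
    · simp [hF, coneFn_zero hα]
    · have hx' : 0 < ‖x‖ := norm_pos_iff.2 hx
      have h1 := hC α η x
      rw [norm_mul, Real.norm_eq_abs]
      calc |F x| * |F x| ≤ (C * (‖x‖ ^ α * rexp (-η * ‖x‖ ^ 2))) *
            (C * (‖x‖ ^ α * rexp (-η * ‖x‖ ^ 2))) :=
            mul_le_mul h1 h1 (abs_nonneg _) ((abs_nonneg _).trans h1)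
        _ = _ := by field_simp; ring
  have hmass : ∫ x, F x * F x ∂stdGaussian E = Z * (m * ((q + 1) / (2 * b) * J)) := by
    rw [(hpolar _ hmass_int).2, ← hJ2, ← integral_const_mul m]
    congr 1
    refine setIntegral_congr_fun measurableSet_Ioi fun s hs => ?_
    have hs0 : (0 : ℝ) < s := hs
    have h1 : ∫ θ : sphere (0 : E) 1, F (s • (θ : E)) * F (s • (θ : E))
        ∂(volume : Measure E).toSphere = (s ^ α * rexp (-η * s ^ 2)) ^ 2 * m := by
      rw [hm_def, ← integral_const_mul]
      refine integral_congr_ae (Eventually.of_forall fun θ => ?_)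
      simp only [hF, coneFn_smul hs0 (norm_eq_of_mem_sphere θ)]
      ring
    have h2 := pow_mul_exp_mul_radial_sq (n := n) (by omega) (α := α) (η := η) hs0
    rw [h1, Real.rpow_add hs0, e2]
    have h3 : (s ^ α * rexp (-η * s ^ 2)) ^ 2 = (s ^ α * rexp (-η * s ^ 2) / s) ^ 2 * s ^ 2 := by
      field_simp
    rw [h3]
    linear_combination (m * s ^ 2) * h2
  -- the energy
  have hae : ∀ᵐ x : E, ‖fderiv ℝ F x‖ ^ 2 =
      ((α / ‖x‖ - 2 * η * ‖x‖) * (‖x‖ ^ α * rexp (-η * ‖x‖ ^ 2))) ^ 2 *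
        (w (r • (‖x‖⁻¹ • x))) ^ 2 +
        (‖x‖ ^ α * rexp (-η * ‖x‖ ^ 2) / ‖x‖) ^ 2 * tangSq w r (‖x‖⁻¹ • x) := by
    have h0 : ∀ᵐ x : E, x ≠ 0 := by simp [ae_iff]
    filter_upwards [ae_of_ae_toSphere (P := fun θ => DifferentiableAt ℝ w (r • θ)) hdiff, h0] with x hx hx0
    have hx' : 0 < ‖x‖ := norm_pos_iff.2 hx0
    have h1 := norm_sq_fderiv_coneFn (α := α) (η := η) hx' (θ := ‖x‖⁻¹ • x)
      (by simp [norm_smul, hx'.ne']) hx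
    rwa [smul_smul, mul_inv_cancel₀ hx'.ne', one_smul] at h1
  have hen_int : Integrable (fun x => rexp (-(1 / 2) * ‖x‖ ^ 2) * ‖fderiv ℝ F x‖ ^ 2) := by
    have hw1 : ∃ C', 0 ≤ C' ∧ ∀ x : E, ‖x‖ = 1 → w (r • x) ^ 2 ≤ C' := by
      refine ⟨(|w 0| + L * r) ^ 2, by positivity, fun x hx => ?_⟩
      have h2 := hw.dist_le_mul (r • x) 0
      rw [dist_zero_right, Real.dist_eq, norm_smul, hx, mul_one, Real.norm_of_nonneg hr.le] at h2
      have h4 := abs_sub_abs_le_abs_sub (w (r • x)) (w 0)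
      rw [← sq_abs]
      exact pow_le_pow_left₀ (abs_nonneg _) (by linarith) 2
    obtain ⟨C', hC'0, hC'⟩ := hw1
    refine (integrable_radial hα hη.le hn (C' * (2 * α ^ 2) + r ^ 2 * L ^ 2) 0
      (C' * (8 * η ^ 2))).mono' ?_ ?_
    · exact ((by fun_prop : Measurable fun x : E => rexp (-(1 / 2) * ‖x‖ ^ 2)).mul
        ((measurable_fderiv ℝ F).norm.pow_const 2)).aestronglyMeasurable
    · have h0 : ∀ᵐ x : E, x ≠ 0 := by simp [ae_iff]
      filter_upwards [hae, h0] with x hx hx0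
      have hx' : 0 < ‖x‖ := norm_pos_iff.2 hx0
      rw [norm_mul, Real.norm_of_nonneg (exp_pos _).le]
      refine mul_le_mul_of_nonneg_left ?_ (exp_pos _).le
      rw [Real.norm_of_nonneg (sq_nonneg _), hx]
      have hθ : ‖‖x‖⁻¹ • x‖ = 1 := by simp [norm_smul, hx'.ne']
      have h1 := hC' _ hθ
      have h2 := tangSq_le hw r (‖x‖⁻¹ • x)
      set X := ‖x‖ ^ α * rexp (-η * ‖x‖ ^ 2) / ‖x‖ with hX
      have h3 : ((α / ‖x‖ - 2 * η * ‖x‖) * (‖x‖ ^ α * rexp (-η * ‖x‖ ^ 2))) ^ 2 =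
          X ^ 2 * (α - 2 * η * ‖x‖ ^ 2) ^ 2 := by
        rw [hX]; field_simp
      rw [h3]
      have h4 : (α - 2 * η * ‖x‖ ^ 2) ^ 2 ≤ 2 * α ^ 2 + 8 * η ^ 2 * ‖x‖ ^ 4 := by
        nlinarith [sq_nonneg (α + 2 * η * ‖x‖ ^ 2)]
      have h5 : (α - 2 * η * ‖x‖ ^ 2) ^ 2 * w (r • (‖x‖⁻¹ • x)) ^ 2 ≤
          (2 * α ^ 2 + 8 * η ^ 2 * ‖x‖ ^ 4) * C' :=
        mul_le_mul h4 h1 (sq_nonneg _) (by positivity)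
      calc _ = X ^ 2 * ((α - 2 * η * ‖x‖ ^ 2) ^ 2 * w (r • (‖x‖⁻¹ • x)) ^ 2 +
            tangSq w r (‖x‖⁻¹ • x)) := by ring
        _ ≤ X ^ 2 * ((2 * α ^ 2 + 8 * η ^ 2 * ‖x‖ ^ 4) * C' + r ^ 2 * L ^ 2) :=
            mul_le_mul_of_nonneg_left (add_le_add h5 h2) (sq_nonneg _)
        _ = _ := by ring
  have hti : Integrable (fun θ : sphere (0 : E) 1 => tangSq w r θ) (volume : Measure E).toSphere := by
    refine Integrable.of_bound (C := r ^ 2 * L ^ 2) ?_ (Eventually.of_forall fun θ => ?_)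
    · have hmeas : Measurable fun θ : sphere (0 : E) 1 => fderiv ℝ w (r • (θ : E)) :=
        (measurable_fderiv ℝ w).comp (by fun_prop)
      have hmeas2 : Measurable fun θ : sphere (0 : E) 1 => fderiv ℝ w (r • (θ : E)) (θ : E) :=
        Continuous.measurable2 (c := fun (f : E →L[ℝ] ℝ) (v : E) => f v) (by fun_prop) hmeas
          measurable_subtype_coe
      unfold tangSq
      exact (((hmeas.norm.pow_const 2).sub (hmeas2.pow_const 2)).const_mul _).aestronglyMeasurable
    · rw [Real.norm_of_nonneg (tangSq_nonneg w r (norm_eq_of_mem_sphere θ))]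
      exact tangSq_le hw r _
  have hwi : Integrable (fun θ : sphere (0 : E) 1 => w (r • (θ : E)) ^ 2)
      (volume : Measure E).toSphere := by
    by_contra h
    rw [hm_def, integral_undef h] at hm
    exact lt_irrefl _ hm
  have hen : ∫ x, ‖fderiv ℝ F x‖ ^ 2 ∂stdGaussian E =
      Z * ((α ^ 2 * m + τ) * J - 4 * α * η * m * ((q + 1) / (2 * b) * J) +
        4 * η ^ 2 * m * ((q + 2 + 1) / (2 * b) * ((q + 1) / (2 * b) * J))) := by
    have key : ∀ A B C : ℝ, ∫ x in Ioi (0 : ℝ), (A * (x ^ q * rexp (-b * x ^ 2)) -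
        B * (x ^ (q + 2) * rexp (-b * x ^ 2)) + C * (x ^ (q + 2 + 2) * rexp (-b * x ^ 2))) =
        A * J - B * ((q + 1) / (2 * b) * J) +
          C * ((q + 2 + 1) / (2 * b) * ((q + 1) / (2 * b) * J)) := fun A B C => by
      have h01 : IntegrableOn (fun x : ℝ => A * (x ^ q * rexp (-b * x ^ 2)) -
          B * (x ^ (q + 2) * rexp (-b * x ^ 2))) (Ioi 0) := (i0.const_mul A).sub (i2.const_mul B)
      rw [integral_add h01 (i4.const_mul C), integral_sub (i0.const_mul A) (i2.const_mul B), integral_const_mul, integral_const_mul,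
        integral_const_mul, hJ4, hJ2]
    rw [(hpolar _ hen_int).2, ← key]
    congr 1
    refine setIntegral_congr_fun measurableSet_Ioi fun s hs => ?_
    have hs0 : (0 : ℝ) < s := hs
    have h1 : ∫ θ : sphere (0 : E) 1, ‖fderiv ℝ F (s • (θ : E))‖ ^ 2
        ∂(volume : Measure E).toSphere =
        ((α / s - 2 * η * s) * (s ^ α * rexp (-η * s ^ 2))) ^ 2 * m +
          (s ^ α * rexp (-η * s ^ 2) / s) ^ 2 * τ := by
      rw [hm_def, hτ_def, ← integral_const_mul, ← integral_const_mul, ← integral_add]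
      · refine integral_congr_ae ?_
        filter_upwards [hdiff] with θ hθ
        exact norm_sq_fderiv_coneFn hs0 (norm_eq_of_mem_sphere θ) hθ
      · exact hwi.const_mul _
      · exact hti.const_mul _
    have h2 := pow_mul_exp_mul_radial_sq (n := n) (by omega) (α := α) (η := η) hs0
    rw [h1, Real.rpow_add hs0 (q + 2), Real.rpow_add hs0 q, e2]
    have h3 : ((α / s - 2 * η * s) * (s ^ α * rexp (-η * s ^ 2))) ^ 2 =
        (s ^ α * rexp (-η * s ^ 2) / s) ^ 2 * (α - 2 * η * s ^ 2) ^ 2 := by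
      field_simp
    rw [h3]
    linear_combination ((α - 2 * η * s ^ 2) ^ 2 * m + τ) * h2
  have hq1' : 0 < q + 1 := by linarith
  refine ⟨η, hη, ?_, (hpolar _ hen_int).1, ?_⟩
  · rw [hmass]
    positivity
  · rw [hmass, hen]
    exact energy_arith hn' hZ hm hJpos hα hη hη2 hτ

end ConeRayleigh

section FriedlandHayman

open ProbabilityTheory Real

variable {E : Type*} [NormedAddCommGroup E] [InnerProductSpace ℝ E] [FiniteDimensional ℝ E]
  [MeasurableSpace E] [BorelSpace E]

/-- The Friedland–Hayman inequality for two Lipschitz functions with disjoint supports. -/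
theorem two_le_add_of_tangSq_le [Nontrivial E] (hn : 2 ≤ Module.finrank ℝ E) {w₁ w₂ : E → ℝ}
    {L₁ L₂ : NNReal} (hw₁ : LipschitzWith L₁ w₁) (hw₂ : LipschitzWith L₂ w₂)
    (h₁ : ∀ x, 0 ≤ w₁ x) (h₂ : ∀ x, 0 ≤ w₂ x) (h12 : ∀ x, w₁ x * w₂ x = 0) {r : ℝ} (hr : 0 < r)
    (hd₁ : ∀ᵐ θ : sphere (0 : E) 1 ∂(volume : Measure E).toSphere,
      DifferentiableAt ℝ w₁ (r • (θ : E)))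
    (hd₂ : ∀ᵐ θ : sphere (0 : E) 1 ∂(volume : Measure E).toSphere,
      DifferentiableAt ℝ w₂ (r • (θ : E)))
    (hm₁ : 0 < ∫ θ : sphere (0 : E) 1, w₁ (r • (θ : E)) ^ 2 ∂(volume : Measure E).toSphere)
    (hm₂ : 0 < ∫ θ : sphere (0 : E) 1, w₂ (r • (θ : E)) ^ 2 ∂(volume : Measure E).toSphere)
    {γ₁ γ₂ : ℝ} (hγ₁ : 0 ≤ γ₁) (hγ₂ : 0 ≤ γ₂)
    (hτ₁ : ∫ θ : sphere (0 : E) 1, tangSq w₁ r θ ∂(volume : Measure E).toSphere ≤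
      γ₁ * (γ₁ + Module.finrank ℝ E - 2) *
        ∫ θ : sphere (0 : E) 1, w₁ (r • (θ : E)) ^ 2 ∂(volume : Measure E).toSphere)
    (hτ₂ : ∫ θ : sphere (0 : E) 1, tangSq w₂ r θ ∂(volume : Measure E).toSphere ≤
      γ₂ * (γ₂ + Module.finrank ℝ E - 2) *
        ∫ θ : sphere (0 : E) 1, w₂ (r • (θ : E)) ^ 2 ∂(volume : Measure E).toSphere) :
    2 ≤ γ₁ + γ₂ := by
  by_contra! hlt
  have hn' : (2 : ℝ) ≤ Module.finrank ℝ E := by exact_mod_cast hn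
  obtain ⟨ι, hι, hι2⟩ : ∃ ι, 0 < ι ∧ γ₁ + γ₂ + 4 * ι < 2 :=
    ⟨(2 - γ₁ - γ₂) / 8, by linarith, by linarith⟩
  have key : ∀ {γ m : ℝ}, 0 ≤ γ → 0 < m → γ * (γ + Module.finrank ℝ E - 2) * m ≤
      (γ + ι) * (γ + ι + Module.finrank ℝ E - 2) * m := fun {γ m} hγ hm => by
    refine mul_le_mul_of_nonneg_right (mul_le_mul ?_ ?_ ?_ ?_) hm.le <;> linarith
  obtain ⟨η₁, hη₁, F0, Fi, Fl⟩ := exists_energy_coneFn_lt hn hw₁ hr hd₁ hm₁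
    (α := γ₁ + ι) (l := γ₁ + 2 * ι) (by linarith) (by linarith) (hτ₁.trans (key hγ₁ hm₁))
  obtain ⟨η₂, hη₂, G0, Gi, Gl⟩ := exists_energy_coneFn_lt hn hw₂ hr hd₂ hm₂
    (α := γ₂ + ι) (l := γ₂ + 2 * ι) (by linarith) (by linarith) (hτ₂.trans (key hγ₂ hm₂))
  have hα₁ : 0 < γ₁ + ι := by linarith
  have hα₂ : 0 < γ₂ + ι := by linarith
  have := two_le_add_of_mul_eq_zero (continuous_coneFn hα₁ hη₁.le hr hw₁)
    (continuous_coneFn hα₂ hη₂.le hr hw₂) (fun x => coneFn_nonneg h₁ x)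
    (fun x => coneFn_nonneg h₂ x)
    (fun x => by
      have := h12 ((r / ‖x‖) • x)
      unfold coneFn
      linear_combination (‖x‖ ^ (γ₁ + ι) * rexp (-η₁ * ‖x‖ ^ 2)) *
        (‖x‖ ^ (γ₂ + ι) * rexp (-η₂ * ‖x‖ ^ 2)) * this)
    (fun ε hε => exists_lipschitzWith_max_coneFn_sub hα₁ hη₁ hr hw₁ hε)
    (fun ε hε => exists_lipschitzWith_max_coneFn_sub hα₂ hη₂ hr hw₂ hε)
    (fun ε hε => exists_norm_le_of_le_coneFn hη₁ hr hw₁ hε)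
    (fun ε hε => exists_norm_le_of_le_coneFn hη₂ hr hw₂ hε)
    Fi Gi F0 G0 Fl Gl
  linarith

end FriedlandHayman

section SmoothApprox

open scoped Convolution

variable {E : Type*} [NormedAddCommGroup E] [InnerProductSpace ℝ E] [FiniteDimensional ℝ E]
  [MeasurableSpace E] [BorelSpace E]

lemma hasFDerivAt_convolution_of_lipschitzWith {ρ ψ : E → ℝ} (hρ : Continuous ρ)
    (hρc : HasCompactSupport ρ) {L : NNReal} (hψ : LipschitzWith L ψ) (x : E) :
    HasFDerivAt (fun x => ∫ t, ρ t * ψ (x - t)) (∫ t, ρ t • fderiv ℝ ψ (x - t)) x := by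
  have hae : ∀ᵐ t : E, DifferentiableAt ℝ ψ (x - t) :=
    (Measure.measurePreserving_sub_left volume x).quasiMeasurePreserving.ae hψ.ae_differentiableAt
  have hψc := hψ.continuous
  refine (hasFDerivAt_integral_of_dominated_loc_of_lip (s := univ)
    (bound := fun t => |ρ t| * L) univ_mem (Eventually.of_forall fun y =>
      Continuous.aestronglyMeasurable (by fun_prop)) ?_ ?_ ?_ ?_ ?_).2
  · exact Continuous.integrable_of_hasCompactSupport (by fun_prop) hρc.mul_right
  · exact (hρ.measurable.smul ((measurable_fderiv ℝ ψ).comp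
      (measurable_const.sub measurable_id))).aestronglyMeasurable
  · refine Eventually.of_forall fun t => LipschitzOnWith.of_dist_le_mul fun a _ b _ => ?_
    have h1 := hψ.dist_le_mul (a - t) (b - t)
    rw [dist_sub_right] at h1
    rw [Real.dist_eq, ← mul_sub, abs_mul, Real.coe_nnabs, abs_mul, abs_abs, mul_assoc]
    refine mul_le_mul_of_nonneg_left ?_ (abs_nonneg _)
    rwa [Real.dist_eq, ← NNReal.abs_eq L] at h1
  · exact (hρ.abs.integrable_of_hasCompactSupport hρc.abs).mul_const _
  · filter_upwards [hae] with t ht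
    have h1 : HasFDerivAt (fun y => ψ (y - t)) (fderiv ℝ ψ (x - t)) x :=
      (hasFDerivAt_comp_sub t).2 ht.hasFDerivAt
    exact h1.const_mul _

theorem exists_smooth_approx_of_lipschitzWith {ψ : E → ℝ} {L : NNReal} (hψ : LipschitzWith L ψ)
    (hc : HasCompactSupport ψ) {U : Set E} (hU : IsOpen U) (hs : tsupport ψ ⊆ U) :
    ∃ (K : Set E) (g : ℕ → E → ℝ) (C : ℝ), IsCompact K ∧ K ⊆ U ∧
      (∀ n, ContDiff ℝ (⊤ : ℕ∞) (g n)) ∧ (∀ n, tsupport (g n) ⊆ K) ∧ (∀ n x, |g n x| ≤ C) ∧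
      (∀ n x, ‖fderiv ℝ (g n) x‖ ≤ L) ∧ (∀ x, Tendsto (fun n => g n x) atTop (nhds (ψ x))) ∧
      ∀ᵐ x, Tendsto (fun n => fderiv ℝ (g n) x) atTop (nhds (fderiv ℝ ψ x)) := by
  obtain ⟨δ, hδ, hδU⟩ := hc.isCompact.exists_cthickening_subset_open hU hs
  obtain ⟨C, hC⟩ := hψ.continuous.bounded_above_of_compact_support hc
  let φ : ℕ → ContDiffBump (0 : E) := fun n =>
    ⟨δ / (2 * (n + 1)), δ / (n + 1), by positivity, by
      rw [div_lt_div_iff₀ (by positivity) (by positivity)]; nlinarith⟩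
  have hφ0 : Tendsto (fun n => (φ n).rOut) atTop (nhds 0) := by
    have h := (tendsto_one_div_add_atTop_nhds_zero_nat (𝕜 := ℝ)).const_mul δ
    simpa [φ, div_eq_mul_inv] using h
  have hconv : ∀ n, ((φ n).normed volume ⋆[ContinuousLinearMap.lsmul ℝ ℝ, volume] ψ) =
      fun x => ∫ t, (φ n).normed volume t * ψ (x - t) := fun n => by
    ext x
    simp [convolution_def]
  have hρi : ∀ n, Integrable ((φ n).normed (volume : Measure E)) := fun n => (φ n).integrable_normed
  have hder := fun n x => hasFDerivAt_convolution_of_lipschitzWith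
    ((φ n).continuous_normed (μ := (volume : Measure E)))
    (φ n).hasCompactSupport_normed hψ x
  refine ⟨cthickening δ (tsupport ψ), fun n x => ∫ t, (φ n).normed volume t * ψ (x - t), C,
    hc.isCompact.cthickening, hδU, fun n => ?_, fun n => ?_, fun n x => ?_, fun n x => ?_,
    fun x => ?_, ?_⟩
  · change ContDiff ℝ _ (fun x => ∫ t, (φ n).normed volume t * ψ (x - t))
    rw [← hconv]
    exact ((φ n).hasCompactSupport_normed (μ := volume)).contDiff_convolution_left _ (φ n).contDiff_normed
      hψ.continuous.locallyIntegrable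
  · refine closure_minimal (fun x hx => ?_) isClosed_cthickening
    by_contra hx2
    refine hx (integral_eq_zero_of_ae (Eventually.of_forall fun t => ?_))
    by_contra ht
    have h1 := left_ne_zero_of_mul ht
    have h2 := right_ne_zero_of_mul ht
    have h3 : t ∈ ball (0 : E) (φ n).rOut := by
      rw [← (φ n).support_normed_eq (μ := volume)]; exact h1
    refine hx2 (mem_cthickening_of_dist_le x (x - t) δ _ (subset_tsupport _ h2) ?_)
    rw [mem_ball_zero_iff] at h3
    have h4 : (φ n).rOut ≤ δ := div_le_self hδ.le (by linarith [n.cast_nonneg (α := ℝ)])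
    rw [dist_eq_norm, sub_sub_cancel]
    exact h3.le.trans h4
  · have h1 := norm_integral_le_of_norm_le ((hρi n).mul_const C)
      (Eventually.of_forall fun t => (by
        rw [norm_mul, Real.norm_of_nonneg ((φ n).nonneg_normed t)]
        exact mul_le_mul_of_nonneg_left (hC _) ((φ n).nonneg_normed t) :
          ‖(φ n).normed volume t * ψ (x - t)‖ ≤ (φ n).normed volume t * C))
    rwa [integral_mul_const, (φ n).integral_normed, one_mul] at h1
  · rw [(hder n x).fderiv]
    have h1 := norm_integral_le_of_norm_le ((hρi n).mul_const (L : ℝ))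
      (Eventually.of_forall fun t => (by
        rw [norm_smul, Real.norm_of_nonneg ((φ n).nonneg_normed t)]
        exact mul_le_mul_of_nonneg_left (norm_fderiv_le_of_lipschitz ℝ hψ)
          ((φ n).nonneg_normed t) :
          ‖(φ n).normed volume t • fderiv ℝ ψ (x - t)‖ ≤ (φ n).normed volume t * L))
    rwa [integral_mul_const, (φ n).integral_normed, one_mul] at h1
  · have h1 := ContDiffBump.convolution_tendsto_right_of_continuous (μ := (volume : Measure E))
      hφ0 hψ.continuous x
    exact h1.congr fun n => by rw [hconv]
  · have hli : LocallyIntegrable (fderiv ℝ ψ) :=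
      (locallyIntegrable_const (L : ℝ)).mono (measurable_fderiv ℝ ψ).aestronglyMeasurable
        (Eventually.of_forall fun x => by
          rw [NNReal.norm_eq]
          exact norm_fderiv_le_of_lipschitz ℝ hψ)
    have h1 := ContDiffBump.ae_convolution_tendsto_right_of_locallyIntegrable
      (μ := (volume : Measure E)) (K := 2) hφ0 (Eventually.of_forall fun n => (by
        simp only [φ]
        apply le_of_eq
        field_simp : (φ n).rOut ≤ 2 * (φ n).rIn)) hli
    filter_upwards [h1] with x hx
    refine hx.congr fun n => ?_
    rw [(hder n x).fderiv]
    simp [convolution_def]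

end SmoothApprox

section WeakForm

lemma fderiv_fderiv_apply_comm {E : Type*} [NormedAddCommGroup E] [NormedSpace ℝ E] {g : E → ℝ}
    (hg : ContDiff ℝ 2 g) (x a b : E) :
    fderiv ℝ (fun y => fderiv ℝ g y a) x b = fderiv ℝ (fun y => fderiv ℝ g y b) x a := by
  have h1 : DifferentiableAt ℝ (fderiv ℝ g) x :=
    (hg.fderiv_right (m := 1) (by norm_num)).differentiable (by norm_num) x
  have h2 : ∀ c, HasFDerivAt (fun y => fderiv ℝ g y c)
      ((ContinuousLinearMap.apply ℝ ℝ c).comp (fderiv ℝ (fderiv ℝ g) x)) x := fun c =>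
    (ContinuousLinearMap.apply ℝ ℝ c).hasFDerivAt.comp x h1.hasFDerivAt
  rw [(h2 a).fderiv, (h2 b).fderiv]
  exact (hg.contDiffAt (x := x)).isSymmSndFDerivAt (by simp) b a

lemma contDiff_fderiv_apply_const {E : Type*} [NormedAddCommGroup E] [NormedSpace ℝ E] {g : E → ℝ}
    (hg : ContDiff ℝ (⊤ : ℕ∞) g) (a : E) : ContDiff ℝ (⊤ : ℕ∞) (fun y => fderiv ℝ g y a) :=
  (hg.fderiv_right (m := (⊤ : ℕ∞)) (by simp)).clm_apply contDiff_const

variable {N : ℕ}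

lemma contDiff_lap {ψ : EuclideanSpace ℝ (Fin N) → ℝ} (hψ : ContDiff ℝ (⊤ : ℕ∞) ψ) :
    ContDiff ℝ (⊤ : ℕ∞) (lap N ψ) := by
  unfold lap
  exact ContDiff.sum fun i _ => contDiff_fderiv_apply_const (contDiff_fderiv_apply_const hψ _) _

lemma tsupport_lap_subset (ψ : EuclideanSpace ℝ (Fin N) → ℝ) :
    tsupport (lap N ψ) ⊆ tsupport ψ := by
  refine closure_minimal (fun x hx => ?_) (isClosed_tsupport _)
  obtain ⟨i, -, hi⟩ := Finset.exists_ne_zero_of_sum_ne_zero hx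
  exact tsupport_fderiv_apply_subset ℝ _ (tsupport_fderiv_apply_subset ℝ _ (subset_tsupport _ hi))

lemma lap_fderiv_apply {ψ : EuclideanSpace ℝ (Fin N) → ℝ} (hψ : ContDiff ℝ (⊤ : ℕ∞) ψ)
    (e x : EuclideanSpace ℝ (Fin N)) :
    lap N (fun y => fderiv ℝ ψ y e) x = fderiv ℝ (lap N ψ) x e := by
  have h2 : ∀ {g : EuclideanSpace ℝ (Fin N) → ℝ}, ContDiff ℝ (⊤ : ℕ∞) g → ContDiff ℝ 2 g :=
    fun h => h.of_le (WithTop.coe_le_coe.2 le_top)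
  have h3 : fderiv ℝ (lap N ψ) x e = ∑ i : Fin N, fderiv ℝ (fun x =>
      fderiv ℝ (fun y => fderiv ℝ ψ y (EuclideanSpace.single i 1)) x
        (EuclideanSpace.single i 1)) x e := by
    unfold lap
    rw [fderiv_fun_sum fun i _ => ((contDiff_fderiv_apply_const (contDiff_fderiv_apply_const hψ _)
      _).differentiable (by simp)).differentiableAt]
    simp
  rw [h3]
  unfold lap
  refine Finset.sum_congr rfl fun i _ => ?_
  have h4 : (fun y => fderiv ℝ (fun z => fderiv ℝ ψ z e) y (EuclideanSpace.single i 1)) =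
      fun y => fderiv ℝ (fun z => fderiv ℝ ψ z (EuclideanSpace.single i 1)) y e := by
    ext y
    exact fderiv_fderiv_apply_comm (h2 hψ) _ _ _
  rw [h4]
  exact fderiv_fderiv_apply_comm (h2 (contDiff_fderiv_apply_const hψ _)) _ _ _

lemma integral_fderiv_mul_lap_add_eq_zero {Ω : Set (EuclideanSpace ℝ (Fin N))}
    {u : EuclideanSpace ℝ (Fin N) → ℝ} (hu : ContDiff ℝ 1 u)
    (heq : ∀ φ : EuclideanSpace ℝ (Fin N) → ℝ, ContDiff ℝ (⊤ : ℕ∞) φ →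
      tsupport φ ⊆ ball (0 : EuclideanSpace ℝ (Fin N)) 1 →
      ∫ x, u x * (lap N φ x + φ x) = ∫ x in Ω, φ x) (e : EuclideanSpace ℝ (Fin N))
    {ψ : EuclideanSpace ℝ (Fin N) → ℝ} (hψ : ContDiff ℝ (⊤ : ℕ∞) ψ) (hc : HasCompactSupport ψ)
    (hs : tsupport ψ ⊆ Ω ∩ ball 0 1) :
    ∫ x, fderiv ℝ u x e * (lap N ψ x + ψ x) = 0 := by
  have hχ : ContDiff ℝ (⊤ : ℕ∞) (fun x => lap N ψ x + ψ x) := (contDiff_lap hψ).add hψ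
  have hχs : tsupport (fun x => lap N ψ x + ψ x) ⊆ tsupport ψ :=
    (tsupport_add _ _).trans (union_subset (tsupport_lap_subset ψ) subset_rfl)
  have hχc : HasCompactSupport (fun x => lap N ψ x + ψ x) :=
    hc.of_isClosed_subset (isClosed_tsupport _) hχs
  have hu' : Continuous (fderiv ℝ u) := hu.continuous_fderiv (by norm_num)
  have hχ' : Continuous (fderiv ℝ (fun x => lap N ψ x + ψ x)) := hχ.continuous_fderiv (by simp)
  have hψ' : Continuous (fderiv ℝ ψ) := hψ.continuous_fderiv (by simp)
  have hχ0 := hχ.continuous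
  have hu0 := hu.continuous
  have hc' : HasCompactSupport (fun x => fderiv ℝ (fun x => lap N ψ x + ψ x) x e) :=
    hχc.of_isClosed_subset (isClosed_tsupport _) (tsupport_fderiv_apply_subset ℝ _)
  have h1 := integral_mul_fderiv_eq_neg_fderiv_mul_of_integrable (μ := volume) (v := e) (f := u)
    (g := fun x => lap N ψ x + ψ x)
    (Continuous.integrable_of_hasCompactSupport (by fun_prop) hχc.mul_left)
    (Continuous.integrable_of_hasCompactSupport (by fun_prop) hc'.mul_left)
    (Continuous.integrable_of_hasCompactSupport (by fun_prop) hχc.mul_left)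
    (fun x _ => (hu.differentiable (by norm_num)) x)
    (fun x _ => (hχ.differentiable (by simp)) x)
  have h2 := heq (fun y => fderiv ℝ ψ y e) (contDiff_fderiv_apply_const hψ e)
    ((tsupport_fderiv_apply_subset ℝ _).trans (hs.trans inter_subset_right))
  have h3 : ∀ x, fderiv ℝ (fun x => lap N ψ x + ψ x) x e =
      lap N (fun y => fderiv ℝ ψ y e) x + fderiv ℝ ψ x e := fun x => by
    rw [lap_fderiv_apply hψ, fderiv_fun_add ((contDiff_lap hψ).differentiable (by simp) x)
      (hψ.differentiable (by simp) x)]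
    rfl
  have h4 : ∫ x, fderiv ℝ ψ x e = 0 := by
    have hc2 : HasCompactSupport (fun x => fderiv ℝ ψ x e) :=
      hc.of_isClosed_subset (isClosed_tsupport _) (tsupport_fderiv_apply_subset ℝ _)
    have := integral_mul_fderiv_eq_neg_fderiv_mul_of_integrable (μ := volume) (v := e)
      (f := fun _ => (1 : ℝ)) (g := ψ) (by simp)
      (by simpa using Continuous.integrable_of_hasCompactSupport (by fun_prop) hc2)
      (by simpa using hψ.continuous.integrable_of_hasCompactSupport hc)
      (fun x _ => by fun_prop) (fun x _ => (hψ.differentiable (by simp)) x)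
    simpa using this
  have h5 : ∫ x in Ω, fderiv ℝ ψ x e = ∫ x, fderiv ℝ ψ x e :=
    setIntegral_eq_integral_of_forall_compl_eq_zero fun x hx => by
      by_contra h
      exact hx (hs (tsupport_fderiv_apply_subset ℝ _ (subset_tsupport _ h))).1
  simp_rw [h3] at h1
  rw [h2, h5, h4] at h1
  linarith

lemma fderiv_apply_gradient {v ψ : EuclideanSpace ℝ (Fin N) → ℝ} (x : EuclideanSpace ℝ (Fin N)) :
    fderiv ℝ ψ x (gradient v x) = ∑ i : Fin N, fderiv ℝ v x (EuclideanSpace.single i 1) *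
      fderiv ℝ ψ x (EuclideanSpace.single i 1) := by
  have h1 : gradient v x = ∑ i : Fin N, fderiv ℝ v x (EuclideanSpace.single i 1) •
      EuclideanSpace.single i (1 : ℝ) := by
    have h2 := (EuclideanSpace.basisFun (Fin N) ℝ).sum_repr' (gradient v x)
    rw [← h2]
    refine Finset.sum_congr rfl fun i _ => ?_
    rw [← toDual_gradient, InnerProductSpace.toDual_apply_apply, real_inner_comm]
    simp
  rw [h1, map_sum]
  simp

lemma norm_gradient {F : Type*} [NormedAddCommGroup F] [InnerProductSpace ℝ F] [CompleteSpace F]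
    (v : F → ℝ) (x : F) : ‖gradient v x‖ = ‖fderiv ℝ v x‖ := by
  rw [← toDual_gradient, LinearIsometryEquiv.norm_map]

lemma measurable_gradient {F : Type*} [NormedAddCommGroup F] [InnerProductSpace ℝ F]
    [CompleteSpace F] [MeasurableSpace F] [BorelSpace F] (v : F → ℝ) : Measurable (gradient v) :=
  (InnerProductSpace.toDual ℝ _).symm.continuous.measurable.comp (measurable_fderiv ℝ v)

lemma integral_mul_lap {v ψ : EuclideanSpace ℝ (Fin N) → ℝ} {K : NNReal} (hv : LipschitzWith K v)
    (hψ : ContDiff ℝ (⊤ : ℕ∞) ψ) (hc : HasCompactSupport ψ) :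
    ∫ x, v x * lap N ψ x = -∫ x, fderiv ℝ ψ x (gradient v x) := by
  have hvc := hv.continuous
  have hc' : ∀ a, HasCompactSupport (fun x => fderiv ℝ ψ x a) := fun a =>
    hc.of_isClosed_subset (isClosed_tsupport _) (tsupport_fderiv_apply_subset ℝ _)
  have hc'' : ∀ a b, HasCompactSupport (fun x => fderiv ℝ (fun y => fderiv ℝ ψ y a) x b) :=
    fun a b => (hc' a).of_isClosed_subset (isClosed_tsupport _) (tsupport_fderiv_apply_subset ℝ _)
  have hψ' := fun a => contDiff_fderiv_apply_const hψ a
  have hψ'' := fun a b => contDiff_fderiv_apply_const (hψ' a) b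
  have hψ'c := fun a => (hψ' a).continuous
  have hψ''c := fun a b => (hψ'' a b).continuous
  have i1 : ∀ a, Integrable (fun x => v x * fderiv ℝ (fun y => fderiv ℝ ψ y a) x a) := fun a => by
    have := hψ''c a a
    exact Continuous.integrable_of_hasCompactSupport (by fun_prop) (hc'' a a).mul_left
  have i2 : ∀ a, Integrable (fun x => fderiv ℝ v x a * fderiv ℝ ψ x a) := fun a => by
    refine Integrable.bdd_mul (c := K * ‖a‖)
      ((hψ'c a).integrable_of_hasCompactSupport (hc' a))
      (measurable_fderiv_apply_const ℝ v a).aestronglyMeasurable (Eventually.of_forall fun x => ?_)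
    exact (ContinuousLinearMap.le_opNorm _ _).trans
      (mul_le_mul_of_nonneg_right (norm_fderiv_le_of_lipschitz ℝ hv) (norm_nonneg _))
  simp_rw [fderiv_apply_gradient, lap, Finset.mul_sum]
  rw [integral_finsetSum _ fun i _ => i1 _, integral_finsetSum _ fun i _ => i2 _,
    ← Finset.sum_neg_distrib]
  refine Finset.sum_congr rfl fun i _ => ?_
  set a : EuclideanSpace ℝ (Fin N) := EuclideanSpace.single i 1
  obtain ⟨D, hD⟩ := (contDiff_fderiv_apply_const hψ a).lipschitzWith_of_hasCompactSupport (hc' a)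
    (by simp)
  have h1 := hv.integral_lineDeriv_mul_eq (μ := volume) hD (hc' a) a
  have h2 : ∫ x, lineDeriv ℝ v x a * fderiv ℝ ψ x a = ∫ x, fderiv ℝ v x a * fderiv ℝ ψ x a := by
    refine integral_congr_ae ?_
    filter_upwards [hv.ae_differentiableAt] with x hx
    rw [hx.lineDeriv_eq_fderiv]
  have h3 : ∀ x, lineDeriv ℝ (fun y => fderiv ℝ ψ y a) x (-a) * v x =
      -(v x * fderiv ℝ (fun y => fderiv ℝ ψ y a) x a) := fun x => by
    rw [((hψ' a).differentiable (by simp) x).lineDeriv_eq_fderiv, map_neg]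
    ring
  rw [h2] at h1
  simp_rw [h3] at h1
  rw [integral_neg] at h1
  linarith

end WeakForm

section PositivePart

lemma LipschitzWith.mul_of_abs_le {X : Type*} [PseudoMetricSpace X] {f g : X → ℝ}
    {Kf Kg A B : NNReal} (hf : LipschitzWith Kf f) (hg : LipschitzWith Kg g)
    (hA : ∀ x, |f x| ≤ A) (hB : ∀ x, |g x| ≤ B) :
    LipschitzWith (A * Kg + B * Kf) (fun x => f x * g x) := by
  refine LipschitzWith.of_dist_le_mul fun x y => ?_
  have h1 := hf.dist_le_mul x y
  have h2 := hg.dist_le_mul x y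
  rw [Real.dist_eq] at *
  have h3 : f x * g x - f y * g y = f x * (g x - g y) + g y * (f x - f y) := by ring
  rw [h3]
  refine (abs_add_le _ _).trans ?_
  rw [abs_mul, abs_mul]
  push_cast
  have h4 := mul_le_mul (hA x) h2 (abs_nonneg _) A.2
  have h5 := mul_le_mul (hB y) h1 (abs_nonneg _) B.2
  linarith

variable {N : ℕ}

lemma fderiv_apply_gradient_self (v : EuclideanSpace ℝ (Fin N) → ℝ)
    (x : EuclideanSpace ℝ (Fin N)) : fderiv ℝ v x (gradient v x) = ‖gradient v x‖ ^ 2 := by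
  rw [← toDual_gradient, InnerProductSpace.toDual_apply_apply, real_inner_self_eq_norm_sq]

lemma gradient_max_zero_of_pos {v : EuclideanSpace ℝ (Fin N) → ℝ} (hv : Continuous v)
    {x : EuclideanSpace ℝ (Fin N)} (hx : 0 < v x) :
    gradient (fun y => max (v y) 0) x = gradient v x := by
  unfold gradient
  congr 1
  refine Filter.EventuallyEq.fderiv_eq ?_
  filter_upwards [hv.continuousAt.eventually (lt_mem_nhds hx)] with y hy
  exact max_eq_left hy.le

lemma gradient_max_zero_of_nonpos {v : EuclideanSpace ℝ (Fin N) → ℝ}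
    {x : EuclideanSpace ℝ (Fin N)} (hx : v x ≤ 0) :
    gradient (fun y => max (v y) 0) x = 0 := by
  unfold gradient
  have h : IsLocalMin (fun y => max (v y) 0) x := Eventually.of_forall fun y => by
    simp [max_eq_right hx]
  rw [h.fderiv_eq_zero, map_zero]

lemma integrable_const_indicator {F : Type*} [NormedAddCommGroup F] [InnerProductSpace ℝ F]
    [FiniteDimensional ℝ F] [MeasurableSpace F] [BorelSpace F] {S : Set F} (hS : IsCompact S)
    (c : ℝ) : Integrable (S.indicator fun _ => c) :=
  (integrable_indicator_iff hS.measurableSet).2 (integrableOn_const hS.measure_lt_top.ne)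

lemma integral_fderiv_gradient_of_weak {v : EuclideanSpace ℝ (Fin N) → ℝ} {K W : NNReal}
    (hv : LipschitzWith K v) (hW : ∀ x, |v x| ≤ W) {U : Set (EuclideanSpace ℝ (Fin N))}
    (hU : IsOpen U)
    (hweak : ∀ ψ : EuclideanSpace ℝ (Fin N) → ℝ, ContDiff ℝ (⊤ : ℕ∞) ψ → HasCompactSupport ψ →
      tsupport ψ ⊆ U → ∫ x, v x * (lap N ψ x + ψ x) = 0)
    {ψ : EuclideanSpace ℝ (Fin N) → ℝ} {L : NNReal} (hψ : LipschitzWith L ψ)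
    (hc : HasCompactSupport ψ) (hs : tsupport ψ ⊆ U) :
    ∫ x, fderiv ℝ ψ x (gradient v x) = ∫ x, v x * ψ x := by
  obtain ⟨S, g, C, hS, hSU, hg, hgs, hgC, hgL, hlim, hlim'⟩ :=
    exists_smooth_approx_of_lipschitzWith hψ hc hU hs
  have hgc : ∀ n, HasCompactSupport (g n) := fun n =>
    hS.of_isClosed_subset (isClosed_tsupport _) (hgs n)
  have hvc := hv.continuous
  have heq : ∀ n, ∫ x, fderiv ℝ (g n) x (gradient v x) = ∫ x, v x * g n x := fun n => by
    have h1 := hweak _ (hg n) (hgc n) ((hgs n).trans hSU)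
    have h2 := (contDiff_lap (hg n)).continuous
    have h3 := (hg n).continuous
    have h4 : HasCompactSupport (lap N (g n)) :=
      (hgc n).of_isClosed_subset (isClosed_tsupport _) (tsupport_lap_subset _)
    simp_rw [mul_add] at h1
    have i1 : Integrable (fun x => v x * lap N (g n) x) :=
      Continuous.integrable_of_hasCompactSupport (by fun_prop) h4.mul_left
    have i2 : Integrable (fun x => v x * g n x) :=
      Continuous.integrable_of_hasCompactSupport (by fun_prop) (hgc n).mul_left
    rw [integral_add i1 i2, integral_mul_lap hv (hg n) (hgc n)] at h1
    linarith
  have t1 : Tendsto (fun n => ∫ x, fderiv ℝ (g n) x (gradient v x)) atTop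
      (nhds (∫ x, fderiv ℝ ψ x (gradient v x))) := by
    refine tendsto_integral_of_dominated_convergence (S.indicator fun _ => (L * K : ℝ))
      (fun n => ?_) (integrable_const_indicator hS _) (fun n => Eventually.of_forall fun x => ?_) ?_
    · exact (Continuous.measurable2 (c := fun (f : EuclideanSpace ℝ (Fin N) →L[ℝ] ℝ)
        (a : EuclideanSpace ℝ (Fin N)) => f a) (by fun_prop) (measurable_fderiv ℝ (g n))
        (measurable_gradient v)).aestronglyMeasurable
    · by_cases hx : x ∈ S
      · rw [indicator_of_mem hx]
        refine (ContinuousLinearMap.le_opNorm _ _).trans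
          (mul_le_mul (hgL n x) ?_ (norm_nonneg _) L.2)
        rw [norm_gradient]
        exact norm_fderiv_le_of_lipschitz ℝ hv
      · rw [indicator_of_notMem hx]
        have : fderiv ℝ (g n) x = 0 := by
          by_contra h
          exact hx (hgs n (tsupport_fderiv_subset ℝ (subset_tsupport _ h)))
        simp [this]
    · filter_upwards [hlim'] with x hx
      exact ((ContinuousLinearMap.apply ℝ ℝ (gradient v x)).continuous.tendsto _).comp hx
  have t2 : Tendsto (fun n => ∫ x, v x * g n x) atTop (nhds (∫ x, v x * ψ x)) := by
    refine tendsto_integral_of_dominated_convergence (S.indicator fun _ => (W * C : ℝ))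
      (fun n => ?_) (integrable_const_indicator hS _) (fun n => Eventually.of_forall fun x => ?_)
      (Eventually.of_forall fun x => (hlim x).const_mul _)
    · have h3 := (hg n).continuous
      exact Continuous.aestronglyMeasurable (by fun_prop)
    · by_cases hx : x ∈ S
      · rw [indicator_of_mem hx, norm_mul]
        exact mul_le_mul (hW x) (hgC n x) (norm_nonneg _) W.2
      · rw [indicator_of_notMem hx]
        have : g n x = 0 := by
          by_contra h
          exact hx (hgs n (subset_tsupport _ h))
        simp [this]
  simp_rw [heq] at t1
  exact tendsto_nhds_unique t1 t2

/-- Caccioppoli-type identity for the positive part of a weak solution of `Δv + v = 0`. -/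
theorem integral_mul_sq_gradient_max {v : EuclideanSpace ℝ (Fin N) → ℝ} {K W : NNReal}
    (hv : LipschitzWith K v) (hW : ∀ x, |v x| ≤ W) {U B : Set (EuclideanSpace ℝ (Fin N))}
    (hU : IsOpen U) (hB : ∀ x ∈ B, x ∉ U → v x ≤ 0)
    (hweak : ∀ ψ : EuclideanSpace ℝ (Fin N) → ℝ, ContDiff ℝ (⊤ : ℕ∞) ψ → HasCompactSupport ψ →
      tsupport ψ ⊆ U → ∫ x, v x * (lap N ψ x + ψ x) = 0)
    {η : EuclideanSpace ℝ (Fin N) → ℝ} {L : NNReal} (hη : LipschitzWith L η)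
    (hc : HasCompactSupport η) (hs : tsupport η ⊆ B) :
    ∫ x, (η x * ‖gradient (fun y => max (v y) 0) x‖ ^ 2 +
      max (v x) 0 * fderiv ℝ η x (gradient (fun y => max (v y) 0) x)) =
      ∫ x, η x * max (v x) 0 ^ 2 := by
  obtain ⟨A, hA⟩ : ∃ A : NNReal, ∀ x, |η x| ≤ A := by
    obtain ⟨C, hC⟩ := hη.continuous.bounded_above_of_compact_support hc
    exact ⟨C.toNNReal, fun x => (hC x).trans (Real.le_coe_toNNReal C)⟩
  have hvc := hv.continuous
  have hηc := hη.continuous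
  set ε : ℕ → ℝ := fun n => 1 / ((n : ℝ) + 1) with hε
  have hε0 : ∀ n, 0 < ε n := fun n => by positivity
  have hεlim : Tendsto ε atTop (nhds 0) := tendsto_one_div_add_atTop_nhds_zero_nat
  have hcutL : ∀ n, LipschitzWith K (fun x => max (v x - ε n) 0) := fun n =>
    (LipschitzWith.of_dist_le_mul fun x y => by
      have := hv.dist_le_mul x y
      rwa [dist_sub_right] : LipschitzWith K fun x => v x - ε n).max_const 0
  have hcutW : ∀ n x, |max (v x - ε n) 0| ≤ W := fun n x => by
    rw [abs_of_nonneg (le_max_right _ _)]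
    refine max_le ?_ W.2
    linarith [hε0 n, le_abs_self (v x), hW x]
  set ψ : ℕ → EuclideanSpace ℝ (Fin N) → ℝ := fun n x => η x * max (v x - ε n) 0 with hψ
  have hψL : ∀ n, LipschitzWith (A * K + W * L) (ψ n) := fun n =>
    hη.mul_of_abs_le (hcutL n) hA (hcutW n)
  have hψη : ∀ n, tsupport (ψ n) ⊆ tsupport η := fun n =>
    closure_mono fun x hx => left_ne_zero_of_mul hx
  have hψU : ∀ n, tsupport (ψ n) ⊆ U := fun n x hx => by
    have h1 : tsupport (ψ n) ⊆ {x | ε n ≤ v x} := by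
      refine closure_minimal (fun y hy => ?_) (isClosed_le continuous_const hvc)
      by_contra h
      rw [mem_ofPred_eq, not_le] at h
      exact right_ne_zero_of_mul hy (max_eq_right (by linarith))
    by_contra h
    have h2 := hB x (hs (hψη n hx)) h
    have h3 : ε n ≤ v x := h1 hx
    linarith [hε0 n]
  have hψc : ∀ n, HasCompactSupport (ψ n) := fun n =>
    hc.of_isClosed_subset (isClosed_tsupport _) (hψη n)
  have heq := fun n => integral_fderiv_gradient_of_weak hv hW hU hweak (hψL n) (hψc n) (hψU n)
  have t1 : Tendsto (fun n => ∫ x, fderiv ℝ (ψ n) x (gradient v x)) atTop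
      (nhds (∫ x, (η x * ‖gradient (fun y => max (v y) 0) x‖ ^ 2 +
        max (v x) 0 * fderiv ℝ η x (gradient (fun y => max (v y) 0) x)))) := by
    refine tendsto_integral_of_dominated_convergence
      ((tsupport η).indicator fun _ => (((A * K + W * L : NNReal) : ℝ) * K))
      (fun n => ?_) (integrable_const_indicator hc _) (fun n => Eventually.of_forall fun x => ?_) ?_
    · exact (Continuous.measurable2 (c := fun (f : EuclideanSpace ℝ (Fin N) →L[ℝ] ℝ)
        (a : EuclideanSpace ℝ (Fin N)) => f a) (by fun_prop) (measurable_fderiv ℝ (ψ n))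
        (measurable_gradient v)).aestronglyMeasurable
    · by_cases hx : x ∈ tsupport η
      · rw [indicator_of_mem hx]
        refine (ContinuousLinearMap.le_opNorm _ _).trans
          (mul_le_mul (norm_fderiv_le_of_lipschitz ℝ (hψL n)) ?_ (norm_nonneg _) (NNReal.coe_nonneg _))
        rw [norm_gradient]
        exact norm_fderiv_le_of_lipschitz ℝ hv
      · rw [indicator_of_notMem hx]
        have : fderiv ℝ (ψ n) x = 0 := by
          by_contra h
          exact hx (hψη n (tsupport_fderiv_subset ℝ (subset_tsupport _ h)))
        simp [this]
    · filter_upwards [hv.ae_differentiableAt, hη.ae_differentiableAt] with x hx hx'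
      rcases lt_or_ge 0 (v x) with h0 | h0
      · rw [gradient_max_zero_of_pos hvc h0, max_eq_left h0.le]
        have h1 : Tendsto (fun n => η x * ‖gradient v x‖ ^ 2 +
            (v x - ε n) * fderiv ℝ η x (gradient v x)) atTop (nhds (η x * ‖gradient v x‖ ^ 2 +
            (v x - 0) * fderiv ℝ η x (gradient v x))) :=
          ((hεlim.const_sub (v x)).mul_const _).const_add _
        rw [sub_zero] at h1
        refine h1.congr' ?_
        filter_upwards [hεlim.eventually (gt_mem_nhds h0)] with n hn
        have h2 : ψ n =ᶠ[nhds x] fun y => η y * (v y - ε n) := by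
          filter_upwards [hvc.continuousAt.eventually (lt_mem_nhds hn)] with y hy
          simp only [hψ]
          rw [max_eq_left (by linarith)]
        have h3 : HasFDerivAt (fun y => η y * (v y - ε n))
            (η x • fderiv ℝ v x + (v x - ε n) • fderiv ℝ η x) x :=
          hx'.hasFDerivAt.mul (hx.hasFDerivAt.sub_const _)
        rw [h2.fderiv_eq, h3.fderiv]
        simp [fderiv_apply_gradient_self]
      · rw [gradient_max_zero_of_nonpos h0]
        have h1 : ∀ n, fderiv ℝ (ψ n) x = 0 := fun n => by
          have h2 : ψ n =ᶠ[nhds x] fun y => 0 := by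
            filter_upwards [hvc.continuousAt.eventually (gt_mem_nhds (h0.trans_lt (hε0 n)))]
              with y hy
            simp only [hψ]
            rw [max_eq_right (by linarith), mul_zero]
          rw [h2.fderiv_eq]
          simp
        simp [h1]
  have t2 : Tendsto (fun n => ∫ x, v x * ψ n x) atTop (nhds (∫ x, η x * max (v x) 0 ^ 2)) := by
    refine tendsto_integral_of_dominated_convergence
      ((tsupport η).indicator fun _ => (W * (A * W) : ℝ))
      (fun n => ?_) (integrable_const_indicator hc _) (fun n => Eventually.of_forall fun x => ?_)
      (Eventually.of_forall fun x => ?_)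
    · have h3 := (hψL n).continuous
      exact Continuous.aestronglyMeasurable (by fun_prop)
    · by_cases hx : x ∈ tsupport η
      · rw [indicator_of_mem hx, norm_mul]
        refine mul_le_mul (hW x) ?_ (norm_nonneg _) W.2
        simp only [hψ]
        rw [norm_mul]
        exact mul_le_mul (hA x) (hcutW n x) (norm_nonneg _) A.2
      · rw [indicator_of_notMem hx]
        have : ψ n x = 0 := by
          by_contra h
          exact hx (hψη n (subset_tsupport _ h))
        simp [this]
    · have h1 : Tendsto (fun n => v x * (η x * max (v x - ε n) 0)) atTop
          (nhds (v x * (η x * max (v x - 0) 0))) :=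
        (((hεlim.const_sub (v x)).max tendsto_const_nhds).const_mul _).const_mul _
      have h2 : η x * max (v x) 0 ^ 2 = v x * (η x * max (v x - 0) 0) := by
        rw [sub_zero]
        rcases le_total 0 (v x) with h | h
        · rw [max_eq_left h]; ring
        · rw [max_eq_right h]; ring
      rw [h2]
      exact h1
  simp_rw [heq] at t1
  exact tendsto_nhds_unique t1 t2

end PositivePart

/-! ### Spherical means of a Lipschitz function -/

section SphericalMeans

variable {E : Type*} [NormedAddCommGroup E] [InnerProductSpace ℝ E] [FiniteDimensional ℝ E]
  [MeasurableSpace E] [BorelSpace E]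

/-- The integral of `‖∇w‖²` over directions at radius `s`. -/
def sphEnergy (w : E → ℝ) (s : ℝ) : ℝ :=
  ∫ θ : sphere (0 : E) 1, ‖fderiv ℝ w (s • (θ : E))‖ ^ 2 ∂(volume : Measure E).toSphere

/-- The integral of `w²` over directions at radius `s`. -/
def sphMass (w : E → ℝ) (s : ℝ) : ℝ :=
  ∫ θ : sphere (0 : E) 1, w (s • (θ : E)) ^ 2 ∂(volume : Measure E).toSphere

/-- The integral of `w ∂ᵣw` over directions at radius `s`. -/
def sphFlux (w : E → ℝ) (s : ℝ) : ℝ :=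
  ∫ θ : sphere (0 : E) 1, w (s • (θ : E)) * fderiv ℝ w (s • (θ : E)) θ
    ∂(volume : Measure E).toSphere

variable (E) in
/-- The area of the unit sphere. -/
def sphArea : ℝ := (volume : Measure E).toSphere.real univ

lemma sphArea_nonneg : 0 ≤ sphArea E := measureReal_nonneg

variable {w : E → ℝ} {K : NNReal}

lemma measurable_fderiv_smul (w : E → ℝ) :
    Measurable fun p : ℝ × sphere (0 : E) 1 => fderiv ℝ w (p.1 • (p.2 : E)) :=
  (measurable_fderiv ℝ w).comp (by fun_prop)

lemma measurable_fderiv_smul_apply (w : E → ℝ) :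
    Measurable fun p : ℝ × sphere (0 : E) 1 => fderiv ℝ w (p.1 • (p.2 : E)) p.2 :=
  Continuous.measurable2 (c := fun (f : E →L[ℝ] ℝ) (v : E) => f v) (by fun_prop)
    (measurable_fderiv_smul w) (by fun_prop)

lemma measurable_sphere_slice {F : Type*} [MeasurableSpace F] {f : ℝ × sphere (0 : E) 1 → F}
    (hf : Measurable f) (s : ℝ) : Measurable fun θ => f (s, θ) :=
  hf.comp (by fun_prop)

lemma measurable_sphEnergy (w : E → ℝ) : Measurable (sphEnergy w) :=
  (((measurable_fderiv_smul w).norm.pow_const 2).stronglyMeasurable.integral_prod_right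
    (ν := (volume : Measure E).toSphere)).measurable

lemma measurable_sphMass (hw : Continuous w) : Measurable (sphMass w) := by
  have h : Measurable fun p : ℝ × sphere (0 : E) 1 => w (p.1 • (p.2 : E)) ^ 2 :=
    (hw.measurable.comp (by fun_prop)).pow_const 2
  exact (h.stronglyMeasurable.integral_prod_right (ν := (volume : Measure E).toSphere)).measurable

lemma measurable_sphFlux (hw : Continuous w) : Measurable (sphFlux w) := by
  have h : Measurable fun p : ℝ × sphere (0 : E) 1 =>
      w (p.1 • (p.2 : E)) * fderiv ℝ w (p.1 • (p.2 : E)) p.2 :=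
    (hw.measurable.comp (by fun_prop)).mul (measurable_fderiv_smul_apply w)
  exact (h.stronglyMeasurable.integral_prod_right (ν := (volume : Measure E).toSphere)).measurable

lemma abs_le_mul_norm (hw : LipschitzWith K w) (h0 : w 0 = 0) (x : E) : |w x| ≤ K * ‖x‖ := by
  have := hw.dist_le_mul x 0
  rwa [h0, Real.dist_eq, sub_zero, dist_zero_right] at this

lemma abs_sphere_le (hw : LipschitzWith K w) (h0 : w 0 = 0) {s : ℝ} (hs : 0 ≤ s)
    (θ : sphere (0 : E) 1) : |w (s • (θ : E))| ≤ K * s := by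
  simpa [norm_smul, abs_of_nonneg hs] using abs_le_mul_norm hw h0 (s • (θ : E))

lemma norm_fderiv_sq_le (hw : LipschitzWith K w) (x : E) : ‖fderiv ℝ w x‖ ^ 2 ≤ (K : ℝ) ^ 2 :=
  pow_le_pow_left₀ (norm_nonneg _) (norm_fderiv_le_of_lipschitz ℝ hw) 2

lemma abs_fderiv_sphere_le (hw : LipschitzWith K w) (x : E) (θ : sphere (0 : E) 1) :
    |fderiv ℝ w x θ| ≤ K := by
  have h := (fderiv ℝ w x).le_of_opNorm_le (norm_fderiv_le_of_lipschitz ℝ hw) (θ : E)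
  simpa using h

lemma abs_integral_sphere_le {f : sphere (0 : E) 1 → ℝ} {C : ℝ} (h : ∀ θ, |f θ| ≤ C) :
    |∫ θ, f θ ∂(volume : Measure E).toSphere| ≤ C * sphArea E :=
  norm_integral_le_of_norm_le_const (μ := (volume : Measure E).toSphere) (f := f)
    (.of_forall fun θ => h θ)

lemma abs_sphEnergy_le (hw : LipschitzWith K w) (s : ℝ) :
    |sphEnergy w s| ≤ K ^ 2 * sphArea E :=
  abs_integral_sphere_le fun θ => by
    rw [abs_of_nonneg (sq_nonneg _)]
    exact norm_fderiv_sq_le hw _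

lemma sphEnergy_nonneg (w : E → ℝ) (s : ℝ) : 0 ≤ sphEnergy w s :=
  integral_nonneg fun _ => sq_nonneg _

lemma sphMass_nonneg (w : E → ℝ) (s : ℝ) : 0 ≤ sphMass w s :=
  integral_nonneg fun _ => sq_nonneg _

lemma abs_sphMass_le (hw : LipschitzWith K w) (h0 : w 0 = 0) {s : ℝ} (hs : 0 ≤ s) :
    |sphMass w s| ≤ (K * s) ^ 2 * sphArea E :=
  abs_integral_sphere_le fun θ => by
    rw [abs_of_nonneg (sq_nonneg _), ← sq_abs]
    exact pow_le_pow_left₀ (abs_nonneg _) (abs_sphere_le hw h0 hs θ) 2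

lemma abs_sphFlux_le (hw : LipschitzWith K w) (h0 : w 0 = 0) {s : ℝ} (hs : 0 ≤ s) :
    |sphFlux w s| ≤ K * s * K * sphArea E :=
  abs_integral_sphere_le fun θ => by
    rw [abs_mul]
    exact mul_le_mul (abs_sphere_le hw h0 hs θ) (abs_fderiv_sphere_le hw _ θ) (abs_nonneg _)
      (by positivity)

lemma integrable_norm_fderiv_sq_sphere (hw : LipschitzWith K w) (s : ℝ) :
    Integrable (fun θ : sphere (0 : E) 1 => ‖fderiv ℝ w (s • (θ : E))‖ ^ 2)
      (volume : Measure E).toSphere :=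
  .of_bound (measurable_sphere_slice ((measurable_fderiv_smul w).norm.pow_const 2)
    s).aestronglyMeasurable (K ^ 2) (.of_forall fun θ => by
      rw [Real.norm_of_nonneg (sq_nonneg _)]
      exact norm_fderiv_sq_le hw _)

lemma integrable_fderiv_apply_sq_sphere (hw : LipschitzWith K w) (s : ℝ) :
    Integrable (fun θ : sphere (0 : E) 1 => fderiv ℝ w (s • (θ : E)) θ ^ 2)
      (volume : Measure E).toSphere :=
  .of_bound (measurable_sphere_slice ((measurable_fderiv_smul_apply w).pow_const 2)
    s).aestronglyMeasurable (K ^ 2) (.of_forall fun θ => by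
      rw [Real.norm_of_nonneg (sq_nonneg _), ← sq_abs]
      exact pow_le_pow_left₀ (abs_nonneg _) (abs_fderiv_sphere_le hw _ θ) 2)

lemma integrable_sq_sphere (hw : Continuous w) (s : ℝ) :
    Integrable (fun θ : sphere (0 : E) 1 => w (s • (θ : E)) ^ 2)
      (volume : Measure E).toSphere :=
  (by fun_prop : Continuous fun θ : sphere (0 : E) 1 => w (s • (θ : E)) ^ 2).integrable_of_hasCompactSupport
    (.of_compactSpace _)

lemma integrable_mul_fderiv_apply_sphere (hw : LipschitzWith K w) (h0 : w 0 = 0) {s : ℝ}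
    (hs : 0 ≤ s) :
    Integrable (fun θ : sphere (0 : E) 1 => w (s • (θ : E)) * fderiv ℝ w (s • (θ : E)) θ)
      (volume : Measure E).toSphere := by
  have h : Measurable fun p : ℝ × sphere (0 : E) 1 =>
      w (p.1 • (p.2 : E)) * fderiv ℝ w (p.1 • (p.2 : E)) p.2 :=
    (hw.continuous.measurable.comp (by fun_prop)).mul (measurable_fderiv_smul_apply w)
  refine .of_bound (measurable_sphere_slice h s).aestronglyMeasurable (K * s * K)
    (.of_forall fun θ => ?_)
  rw [Real.norm_eq_abs, abs_mul]
  exact mul_le_mul (abs_sphere_le hw h0 hs θ) (abs_fderiv_sphere_le hw _ θ) (abs_nonneg _)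
    (by positivity)

lemma sphFlux_sq_le (hw : LipschitzWith K w) (h0 : w 0 = 0) {s : ℝ} (hs : 0 ≤ s) :
    sphFlux w s ^ 2 ≤ sphMass w s * ∫ θ : sphere (0 : E) 1, fderiv ℝ w (s • (θ : E)) θ ^ 2
      ∂(volume : Measure E).toSphere := by
  have h := sq_integral_mul_le (μ := (volume : Measure E).toSphere)
    (f := fun θ : sphere (0 : E) 1 => w (s • (θ : E)))
    (g := fun θ : sphere (0 : E) 1 => fderiv ℝ w (s • (θ : E)) θ)
    ((integrable_sq_sphere hw.continuous s).congr (.of_forall fun θ => by simp [sq]))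
    ((integrable_fderiv_apply_sq_sphere hw s).congr (.of_forall fun θ => by simp [sq]))
    (integrable_mul_fderiv_apply_sphere hw h0 hs)
  simpa only [sphFlux, sphMass, sq] using h

lemma sq_mul_sphEnergy (hw : LipschitzWith K w) (s : ℝ) :
    s ^ 2 * sphEnergy w s = s ^ 2 * (∫ θ : sphere (0 : E) 1, fderiv ℝ w (s • (θ : E)) θ ^ 2
      ∂(volume : Measure E).toSphere) +
      ∫ θ : sphere (0 : E) 1, tangSq w s θ ∂(volume : Measure E).toSphere := by
  have h : ∫ θ : sphere (0 : E) 1, tangSq w s θ ∂(volume : Measure E).toSphere =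
      s ^ 2 * (sphEnergy w s - ∫ θ : sphere (0 : E) 1, fderiv ℝ w (s • (θ : E)) θ ^ 2
      ∂(volume : Measure E).toSphere) := by
    unfold sphEnergy
    rw [← integral_sub (integrable_norm_fderiv_sq_sphere hw s)
      (integrable_fderiv_apply_sq_sphere hw s), ← integral_const_mul]
    rfl
  rw [h]
  ring

end SphericalMeans

/-! ### The flux of a function satisfying the energy identity -/

section Flux

/-- The piecewise linear cutoff equal to `1` before `s` and to `0` after `s + δ`. -/
def linCutoff (s δ t : ℝ) : ℝ := min 1 (max 0 ((s + δ - t) / δ))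

variable {s δ t : ℝ}

lemma linCutoff_nonneg : 0 ≤ linCutoff s δ t := le_min zero_le_one (le_max_left _ _)

lemma linCutoff_le_one : linCutoff s δ t ≤ 1 := min_le_left _ _

lemma linCutoff_of_le (hδ : 0 < δ) (h : t ≤ s) : linCutoff s δ t = 1 := by
  have : 1 ≤ (s + δ - t) / δ := by rw [le_div_iff₀ hδ]; linarith
  rw [linCutoff, max_eq_right (by linarith), min_eq_left this]

lemma linCutoff_of_ge (hδ : 0 < δ) (h : s + δ ≤ t) : linCutoff s δ t = 0 := by
  have : (s + δ - t) / δ ≤ 0 := div_nonpos_of_nonpos_of_nonneg (by linarith) hδ.le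
  rw [linCutoff, max_eq_left this, min_eq_right zero_le_one]

lemma linCutoff_of_mem (hδ : 0 < δ) (h : t ∈ Icc s (s + δ)) :
    linCutoff s δ t = (s + δ - t) / δ := by
  have h1 : (s + δ - t) / δ ≤ 1 := by rw [div_le_iff₀ hδ]; linarith [h.1]
  have h2 : 0 ≤ (s + δ - t) / δ := div_nonneg (by linarith [h.2]) hδ.le
  rw [linCutoff, max_eq_right h2, min_eq_right h1]

lemma lipschitzWith_linCutoff (hδ : 0 < δ) : LipschitzWith (Real.toNNReal δ⁻¹) (linCutoff s δ) := by
  refine LipschitzWith.const_min (LipschitzWith.const_max ?_ _) _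
  refine LipschitzWith.of_dist_le_mul fun x y => ?_
  rw [Real.coe_toNNReal _ (by positivity), Real.dist_eq, Real.dist_eq,
    show (s + δ - x) / δ - (s + δ - y) / δ = -(δ⁻¹ * (x - y)) by field_simp; ring, abs_neg, abs_mul,
    abs_of_pos (by positivity)]

variable {E : Type*} [NormedAddCommGroup E] [InnerProductSpace ℝ E]

lemma lipschitzWith_linCutoff_norm (hδ : 0 < δ) :
    LipschitzWith (Real.toNNReal δ⁻¹) (fun x : E => linCutoff s δ ‖x‖) := by
  have h := (lipschitzWith_linCutoff (s := s) hδ).comp (lipschitzWith_one_norm (E := E))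
  rwa [mul_one] at h

lemma tsupport_linCutoff_norm (hδ : 0 < δ) :
    tsupport (fun x : E => linCutoff s δ ‖x‖) ⊆ closedBall 0 (s + δ) := by
  refine closure_minimal (fun x hx => ?_) isClosed_closedBall
  by_contra h
  rw [mem_closedBall_zero_iff, not_le] at h
  exact hx (linCutoff_of_ge hδ h.le)

lemma fderiv_linCutoff_norm_of_lt (hδ : 0 < δ) {x : E} (hx : ‖x‖ < s) :
    fderiv ℝ (fun x : E => linCutoff s δ ‖x‖) x = 0 := by
  have h : (fun x : E => linCutoff s δ ‖x‖) =ᶠ[nhds x] fun _ => 1 := by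
    filter_upwards [continuous_norm.continuousAt.eventually_lt continuousAt_const hx] with y hy
    exact linCutoff_of_le hδ hy.le
  rw [h.fderiv_eq]
  simp

lemma fderiv_linCutoff_norm_of_gt (hδ : 0 < δ) {x : E} (hx : s + δ < ‖x‖) :
    fderiv ℝ (fun x : E => linCutoff s δ ‖x‖) x = 0 := by
  have h : (fun x : E => linCutoff s δ ‖x‖) =ᶠ[nhds x] fun _ => 0 := by
    filter_upwards [continuousAt_const.eventually_lt continuous_norm.continuousAt hx] with y hy
    exact linCutoff_of_ge hδ hy.le
  rw [h.fderiv_eq]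
  simp

lemma fderiv_linCutoff_norm_of_mem (hδ : 0 < δ) {x : E} (hs : 0 ≤ s) (h1 : s < ‖x‖)
    (h2 : ‖x‖ < s + δ) :
    fderiv ℝ (fun x : E => linCutoff s δ ‖x‖) x = -(1 / (δ * ‖x‖)) • innerSL ℝ x := by
  have h : (fun x : E => linCutoff s δ ‖x‖) =ᶠ[nhds x] fun y => (s + δ - ‖y‖) * δ⁻¹ := by
    filter_upwards [continuousAt_const.eventually_lt continuous_norm.continuousAt h1,
      continuous_norm.continuousAt.eventually_lt continuousAt_const h2] with y hy1 hy2
    rw [linCutoff_of_mem hδ ⟨hy1.le, hy2.le⟩, div_eq_mul_inv]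
  have hx : x ≠ 0 := norm_pos_iff.1 (hs.trans_lt h1)
  rw [h.fderiv_eq, (((hasFDerivAt_norm_of_ne_zero hx).const_sub (s + δ)).mul_const δ⁻¹).fderiv]
  ext v
  simp
  ring

variable [FiniteDimensional ℝ E] [MeasurableSpace E] [BorelSpace E]

/-- The weak form of `w Δw = -w²` in the unit ball, tested against `η`, with `Δw` integrated
by parts. -/
def EnergyIdentity (w : E → ℝ) : Prop :=
  ∀ (η : E → ℝ) (L : NNReal), LipschitzWith L η → HasCompactSupport η →
    tsupport η ⊆ ball 0 1 →
    ∫ x, (η x * ‖gradient w x‖ ^ 2 + w x * fderiv ℝ η x (gradient w x)) = ∫ x, η x * w x ^ 2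

variable {w : E → ℝ} {K : NNReal}

/-- The radial density of `‖∇w‖² - w²`. -/
def radDensity (w : E → ℝ) (t : ℝ) : ℝ :=
  t ^ (Module.finrank ℝ E - 1) * (sphEnergy w t - sphMass w t)

/-- The total flux of `w ∇w` through the sphere of radius `t`. -/
def radFlux (w : E → ℝ) (t : ℝ) : ℝ := t ^ (Module.finrank ℝ E - 1) * sphFlux w t

lemma measurable_radDensity (hw : Continuous w) : Measurable (radDensity w) :=
  (measurable_id.pow_const _).mul ((measurable_sphEnergy w).sub (measurable_sphMass hw))

lemma measurable_radFlux (hw : Continuous w) : Measurable (radFlux w) :=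
  (measurable_id.pow_const _).mul (measurable_sphFlux hw)

variable (E) in
lemma pow_finrank_sub_one_le_one {t : ℝ} (h0 : 0 ≤ t) (h1 : t ≤ 1) :
    t ^ (Module.finrank ℝ E - 1) ≤ 1 := pow_le_one₀ h0 h1

lemma abs_radDensity_le (hw : LipschitzWith K w) (h0 : w 0 = 0) (ht : t ∈ Icc (0 : ℝ) 1) :
    |radDensity w t| ≤ t ^ (Module.finrank ℝ E - 1) * (2 * K ^ 2 * sphArea E) := by
  have h1 := abs_sphEnergy_le hw t
  have h2 := abs_sphMass_le hw h0 ht.1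
  have h3 : (K * t) ^ 2 * sphArea E ≤ K ^ 2 * sphArea E := by
    refine mul_le_mul_of_nonneg_right ?_ sphArea_nonneg
    refine pow_le_pow_left₀ (mul_nonneg K.2 ht.1) ?_ 2
    exact mul_le_of_le_one_right K.2 ht.2
  rw [radDensity, abs_mul, abs_of_nonneg (pow_nonneg ht.1 _)]
  refine mul_le_mul_of_nonneg_left ?_ (pow_nonneg ht.1 _)
  refine (abs_sub _ _).trans ?_
  linarith

lemma abs_radDensity_le' (hw : LipschitzWith K w) (h0 : w 0 = 0) (ht : t ∈ Icc (0 : ℝ) 1) :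
    |radDensity w t| ≤ 2 * K ^ 2 * sphArea E :=
  (abs_radDensity_le hw h0 ht).trans (mul_le_of_le_one_left
    (mul_nonneg (by positivity) sphArea_nonneg) (pow_finrank_sub_one_le_one E ht.1 ht.2))

lemma abs_radFlux_le (hw : LipschitzWith K w) (h0 : w 0 = 0) (ht : t ∈ Icc (0 : ℝ) 1) :
    |radFlux w t| ≤ K * K * sphArea E := by
  rw [radFlux, abs_mul, abs_of_nonneg (pow_nonneg ht.1 _)]
  refine (mul_le_mul (pow_finrank_sub_one_le_one E ht.1 ht.2) (abs_sphFlux_le hw h0 ht.1)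
    (abs_nonneg _) zero_le_one).trans ?_
  rw [one_mul]
  refine mul_le_mul_of_nonneg_right ?_ sphArea_nonneg
  exact mul_le_mul_of_nonneg_right (mul_le_of_le_one_right K.2 ht.2) K.2

lemma intervalIntegrable_of_abs_le {f : ℝ → ℝ} (hf : Measurable f) {C a b : ℝ}
    (ha : 0 ≤ a) (hab : a ≤ b) (hb : b ≤ 1) (h : ∀ t ∈ Icc (0 : ℝ) 1, |f t| ≤ C) :
    IntervalIntegrable f volume a b := by
  rw [intervalIntegrable_iff_integrableOn_Ioc_of_le hab]
  refine Measure.integrableOn_of_bounded (M := C) (by simp) hf.aestronglyMeasurable ?_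
  filter_upwards [ae_restrict_mem measurableSet_Ioc] with t ht
  exact h t ⟨ha.trans ht.1.le, ht.2.trans hb⟩

lemma intervalIntegrable_radDensity (hw : LipschitzWith K w) (h0 : w 0 = 0) {a b : ℝ}
    (ha : 0 ≤ a) (hab : a ≤ b) (hb : b ≤ 1) : IntervalIntegrable (radDensity w) volume a b :=
  intervalIntegrable_of_abs_le (measurable_radDensity hw.continuous) ha hab hb
    fun _ ht => abs_radDensity_le' hw h0 ht

lemma intervalIntegrable_radFlux (hw : LipschitzWith K w) (h0 : w 0 = 0) {a b : ℝ}
    (ha : 0 ≤ a) (hab : a ≤ b) (hb : b ≤ 1) : IntervalIntegrable (radFlux w) volume a b :=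
  intervalIntegrable_of_abs_le (measurable_radFlux hw.continuous) ha hab hb
    fun _ ht => abs_radFlux_le hw h0 ht

end Flux

section FluxIdentity

variable {E : Type*} [NormedAddCommGroup E] [InnerProductSpace ℝ E] [FiniteDimensional ℝ E]
  [MeasurableSpace E] [BorelSpace E] {w : E → ℝ} {K : NNReal} {s δ t : ℝ}

/-- The integrand of `EnergyIdentity` for the test function `linCutoff s δ ‖x‖`. -/
def cutoffIntegrand (w : E → ℝ) (s δ : ℝ) (x : E) : ℝ :=
  linCutoff s δ ‖x‖ * ‖gradient w x‖ ^ 2 +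
    w x * fderiv ℝ (fun y : E => linCutoff s δ ‖y‖) x (gradient w x) - linCutoff s δ ‖x‖ * w x ^ 2

lemma cutoffIntegrand_eq_zero (hδ : 0 < δ) {x : E} (hx : s + δ < ‖x‖) :
    cutoffIntegrand w s δ x = 0 := by
  rw [cutoffIntegrand, fderiv_linCutoff_norm_of_gt hδ hx, linCutoff_of_ge hδ hx.le]
  simp

lemma integral_cutoffIntegrand (hw : LipschitzWith K w) (h0 : w 0 = 0) (hid : EnergyIdentity w)
    (hδ : 0 < δ) (hsδ : s + δ < 1) :
    Integrable (cutoffIntegrand w s δ) ∧ ∫ x, cutoffIntegrand w s δ x = 0 := by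
  have hL := lipschitzWith_linCutoff_norm (E := E) (s := s) hδ
  have hts := tsupport_linCutoff_norm (E := E) (s := s) hδ
  have hc : HasCompactSupport (fun x : E => linCutoff s δ ‖x‖) :=
    (isCompact_closedBall (0 : E) (s + δ)).of_isClosed_subset (isClosed_tsupport _) hts
  have hid' := hid _ _ hL hc (hts.trans (closedBall_subset_ball hsδ))
  have hS := isCompact_closedBall (0 : E) (s + δ)
  have hout : ∀ x ∉ closedBall (0 : E) (s + δ), s + δ < ‖x‖ := fun x hx => by
    simpa using hx
  have hw1 : ∀ x ∈ closedBall (0 : E) (s + δ), |w x| ≤ K := fun x hx =>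
    (abs_le_mul_norm hw h0 x).trans
      (mul_le_of_le_one_right K.2 ((mem_closedBall_zero_iff.1 hx).trans hsδ.le))
  have hη : ∀ x : E, |linCutoff s δ ‖x‖| ≤ 1 := fun x => by
    rw [abs_of_nonneg linCutoff_nonneg]
    exact linCutoff_le_one
  have hg : ∀ x, ‖gradient w x‖ ≤ K := fun x => by
    rw [norm_gradient]
    exact norm_fderiv_le_of_lipschitz ℝ hw
  have i1 : Integrable (fun x => linCutoff s δ ‖x‖ * ‖gradient w x‖ ^ 2 +
      w x * fderiv ℝ (fun y : E => linCutoff s δ ‖y‖) x (gradient w x)) := by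
    refine (integrable_const_indicator hS (1 * (K : ℝ) ^ 2 +
      K * ((Real.toNNReal δ⁻¹ : ℝ) * K))).mono' ?_ (.of_forall fun x => ?_)
    · refine Measurable.aestronglyMeasurable (Measurable.add ?_ ?_)
      · exact hL.continuous.measurable.mul ((measurable_gradient w).norm.pow_const 2)
      · exact hw.continuous.measurable.mul
          (Continuous.measurable2 (c := fun (f : E →L[ℝ] ℝ) (a : E) => f a) (by fun_prop)
          (measurable_fderiv ℝ _) (measurable_gradient w))
    · by_cases hx : x ∈ closedBall (0 : E) (s + δ)
      · rw [indicator_of_mem hx]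
        refine (norm_add_le _ _).trans (add_le_add ?_ ?_)
        · rw [norm_mul, norm_pow, norm_norm]
          exact mul_le_mul (hη x) (pow_le_pow_left₀ (norm_nonneg _) (hg x) 2) (by positivity)
            zero_le_one
        · rw [norm_mul]
          refine mul_le_mul (hw1 x hx) ?_ (norm_nonneg _) K.2
          exact (ContinuousLinearMap.le_opNorm _ _).trans
            (mul_le_mul (norm_fderiv_le_of_lipschitz ℝ hL) (hg x) (norm_nonneg _) (by positivity))
      · rw [indicator_of_notMem hx, fderiv_linCutoff_norm_of_gt hδ (hout x hx),
          linCutoff_of_ge hδ (hout x hx).le]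
        simp
  have i2 : Integrable (fun x => linCutoff s δ ‖x‖ * w x ^ 2) := by
    refine Continuous.integrable_of_hasCompactSupport ?_ hc.mul_right
    exact hL.continuous.mul (hw.continuous.pow 2)
  refine ⟨i1.sub i2, ?_⟩
  unfold cutoffIntegrand
  rw [integral_sub i1 i2, hid', sub_self]

lemma inner_gradient (w : E → ℝ) (x v : E) : inner ℝ v (gradient w x) = fderiv ℝ w x v := by
  rw [real_inner_comm, ← toDual_gradient, InnerProductSpace.toDual_apply_apply]

lemma integral_sphere_cutoffIntegrand_of_lt (hw : LipschitzWith K w) (hδ : 0 < δ) (ht : 0 < t)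
    (hts : t < s) :
    ∫ θ : sphere (0 : E) 1, cutoffIntegrand w s δ (t • (θ : E)) ∂(volume : Measure E).toSphere =
      sphEnergy w t - sphMass w t := by
  rw [sphEnergy, sphMass, ← integral_sub (integrable_norm_fderiv_sq_sphere hw t)
    (integrable_sq_sphere hw.continuous t)]
  refine integral_congr_ae (.of_forall fun θ => ?_)
  have hn : ‖t • (θ : E)‖ = t := by simp [norm_smul, abs_of_pos ht]
  have hlt : ‖t • (θ : E)‖ < s := by rwa [hn]
  simp only [cutoffIntegrand]
  rw [fderiv_linCutoff_norm_of_lt hδ hlt, linCutoff_of_le hδ hlt.le, norm_gradient]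
  simp

lemma integral_sphere_cutoffIntegrand_of_mem (hw : LipschitzWith K w) (h0 : w 0 = 0) (hδ : 0 < δ)
    (hs : 0 < s) (h1 : s < t) (h2 : t < s + δ) :
    ∫ θ : sphere (0 : E) 1, cutoffIntegrand w s δ (t • (θ : E)) ∂(volume : Measure E).toSphere =
      linCutoff s δ t * (sphEnergy w t - sphMass w t) - δ⁻¹ * sphFlux w t := by
  have ht : 0 < t := hs.trans h1
  have i1 := integrable_norm_fderiv_sq_sphere hw t
  have i2 := integrable_sq_sphere hw.continuous t
  have i3 := integrable_mul_fderiv_apply_sphere hw h0 ht.le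
  have i12 : Integrable (fun θ : sphere (0 : E) 1 => ‖fderiv ℝ w (t • (θ : E))‖ ^ 2 -
      w (t • (θ : E)) ^ 2) (volume : Measure E).toSphere := i1.sub i2
  rw [sphEnergy, sphMass, sphFlux, ← integral_sub i1 i2, ← integral_const_mul,
    ← integral_const_mul, ← integral_sub (i12.const_mul _) (i3.const_mul _)]
  refine integral_congr_ae (.of_forall fun θ => ?_)
  have hn : ‖t • (θ : E)‖ = t := by simp [norm_smul, abs_of_pos ht]
  simp only [cutoffIntegrand]
  rw [fderiv_linCutoff_norm_of_mem hδ hs.le (by rwa [hn]) (by rwa [hn]), norm_gradient, hn]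
  simp only [_root_.smul_apply, innerSL_apply_apply, inner_gradient, map_smul, smul_eq_mul]
  field_simp
  ring

lemma integral_sphere_cutoffIntegrand_of_gt (hδ : 0 < δ) (ht : 0 < t) (h : s + δ < t) :
    ∫ θ : sphere (0 : E) 1, cutoffIntegrand w s δ (t • (θ : E)) ∂(volume : Measure E).toSphere =
      0 := by
  rw [integral_eq_zero_of_ae (.of_forall fun θ => ?_)]
  exact cutoffIntegrand_eq_zero hδ (by simpa [norm_smul, abs_of_pos ht] using h)

lemma intervalIntegrable_linCutoff_mul_radDensity (hw : LipschitzWith K w) (h0 : w 0 = 0)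
    {a b : ℝ} (hδ : 0 < δ) (ha : 0 ≤ a) (hab : a ≤ b) (hb : b ≤ 1) :
    IntervalIntegrable (fun t => linCutoff s δ t * radDensity w t) volume a b := by
  refine intervalIntegrable_of_abs_le (C := 1 * (2 * K ^ 2 * sphArea E))
    ((lipschitzWith_linCutoff hδ).continuous.measurable.mul
    (measurable_radDensity hw.continuous)) ha hab hb fun t ht => ?_
  rw [Pi.mul_apply, abs_mul, abs_of_nonneg linCutoff_nonneg]
  exact mul_le_mul linCutoff_le_one (abs_radDensity_le' hw h0 ht) (abs_nonneg _) zero_le_one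

lemma integral_radDensity_add [Nontrivial E] (hw : LipschitzWith K w) (h0 : w 0 = 0)
    (hid : EnergyIdentity w) (hs : 0 < s) (hδ : 0 < δ) (hsδ : s + δ < 1) :
    (∫ t in 0..s, radDensity w t) + (∫ t in s..(s + δ), linCutoff s δ t * radDensity w t) =
      δ⁻¹ * ∫ t in s..(s + δ), radFlux w t := by
  obtain ⟨hi, hz⟩ := integral_cutoffIntegrand hw h0 hid hδ hsδ
  obtain ⟨hp, hq⟩ := integral_polar hi
  rw [hz] at hq
  set F : ℝ → ℝ := fun t => t ^ (Module.finrank ℝ E - 1) *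
    ∫ θ : sphere (0 : E) 1, cutoffIntegrand w s δ (t • (θ : E)) ∂(volume : Measure E).toSphere
    with hF
  have hne : ∀ a : ℝ, ∀ᵐ t : ℝ, t ≠ a := fun a => by simp [ae_iff, measure_singleton]
  have hI : ∀ a b, 0 ≤ a → a ≤ b → IntervalIntegrable F volume a b := fun a b ha hab => by
    rw [intervalIntegrable_iff_integrableOn_Ioc_of_le hab]
    exact hp.mono_set fun t ht => ha.trans_lt ht.1
  have e0 : ∫ t in Ioi (0 : ℝ), F t = ∫ t in 0..(s + δ), F t := by
    rw [intervalIntegral.integral_of_le (by positivity)]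
    refine setIntegral_eq_of_subset_of_forall_sdiff_eq_zero measurableSet_Ioi
      (fun t ht => ht.1) fun t ht => ?_
    have h1 : 0 < t := ht.1
    have h2 : s + δ < t := by
      by_contra h
      exact ht.2 ⟨h1, not_lt.1 h⟩
    simp only [hF]
    rw [integral_sphere_cutoffIntegrand_of_gt hδ h1 h2, mul_zero]
  have e1 : ∫ t in 0..s, F t = ∫ t in 0..s, radDensity w t := by
    refine intervalIntegral.integral_congr_ae ?_
    filter_upwards [hne s] with t hts ht
    rw [uIoc_of_le hs.le] at ht
    simp only [hF, radDensity]
    rw [integral_sphere_cutoffIntegrand_of_lt hw hδ ht.1 (lt_of_le_of_ne ht.2 hts)]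
  have e2 : ∫ t in s..(s + δ), F t =
      ∫ t in s..(s + δ), (linCutoff s δ t * radDensity w t - δ⁻¹ * radFlux w t) := by
    refine intervalIntegral.integral_congr_ae ?_
    filter_upwards [hne (s + δ)] with t hts ht
    rw [uIoc_of_le (by linarith)] at ht
    simp only [hF, radDensity, radFlux]
    rw [integral_sphere_cutoffIntegrand_of_mem hw h0 hδ hs ht.1 (lt_of_le_of_ne ht.2 hts)]
    ring
  rw [intervalIntegral.integral_sub
    (intervalIntegrable_linCutoff_mul_radDensity hw h0 hδ hs.le (by linarith) hsδ.le)
    ((intervalIntegrable_radFlux hw h0 hs.le (by linarith) hsδ.le).const_mul _),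
    intervalIntegral.integral_const_mul] at e2
  have e3 := intervalIntegral.integral_add_adjacent_intervals (hI 0 s le_rfl hs.le)
    (hI s (s + δ) hs.le (by linarith))
  linarith

/-- For almost every radius, the flux of `w ∇w` equals the integral of its divergence. -/
theorem ae_radFlux_eq_integral_radDensity [Nontrivial E] (hw : LipschitzWith K w) (h0 : w 0 = 0)
    (hid : EnergyIdentity w) :
    ∀ᵐ s : ℝ, s ∈ Ioo (0 : ℝ) 1 → radFlux w s = ∫ t in 0..s, radDensity w t := by
  have h_int := intervalIntegrable_radFlux hw h0 le_rfl zero_le_one le_rfl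
  filter_upwards [h_int.ae_hasDerivAt_integral] with s hs hs01
  have h1 := hs (by rw [uIcc_of_le zero_le_one]; exact ⟨hs01.1.le, hs01.2.le⟩) 0
    (by simp)
  have h2 : Tendsto (fun δ : ℝ => δ⁻¹ * ∫ t in s..(s + δ), radFlux w t) (nhdsWithin 0 (Ioi 0))
      (nhds (radFlux w s)) := by
    have h3 := (hasDerivAt_iff_tendsto_slope_zero.1 h1).mono_left
      (nhdsWithin_mono 0 fun x hx => (ne_of_gt hx : x ≠ 0))
    refine h3.congr' ?_
    filter_upwards [Ioo_mem_nhdsGT (show (0 : ℝ) < 1 - s by linarith [hs01.2])] with δ hδ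
    rw [intervalIntegral.integral_interval_sub_left
      (intervalIntegrable_radFlux hw h0 le_rfl (by linarith [hs01.1, hδ.1]) (by linarith [hδ.2]))
      (intervalIntegrable_radFlux hw h0 le_rfl hs01.1.le hs01.2.le), smul_eq_mul]
  set C : ℝ := 2 * K ^ 2 * sphArea E
  have h4 : Tendsto (fun δ : ℝ => δ⁻¹ * ∫ t in s..(s + δ), radFlux w t) (nhdsWithin 0 (Ioi 0))
      (nhds (∫ t in 0..s, radDensity w t)) := by
    have h5 : Tendsto (fun δ : ℝ => C * δ) (nhdsWithin 0 (Ioi 0)) (nhds 0) := by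
      have : Tendsto (fun δ : ℝ => C * δ) (nhds 0) (nhds (C * 0)) := tendsto_id.const_mul C
      rw [mul_zero] at this
      exact this.mono_left nhdsWithin_le_nhds
    refine tendsto_iff_norm_sub_tendsto_zero.2 (squeeze_zero' (.of_forall fun _ => norm_nonneg _)
      ?_ h5)
    filter_upwards [Ioo_mem_nhdsGT (show (0 : ℝ) < 1 - s by linarith [hs01.2])] with δ hδ
    rw [← integral_radDensity_add hw h0 hid hs01.1 hδ.1 (by linarith [hδ.2]), add_sub_cancel_left]
    have h6 := intervalIntegral.norm_integral_le_of_norm_le_const (a := s) (b := s + δ)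
      (f := fun t => linCutoff s δ t * radDensity w t) (C := C) fun t ht => ?_
    · rwa [add_sub_cancel_left, abs_of_pos hδ.1] at h6
    · rw [uIoc_of_le (by linarith [hδ.1])] at ht
      rw [Real.norm_eq_abs, abs_mul, abs_of_nonneg linCutoff_nonneg]
      refine (mul_le_mul linCutoff_le_one (abs_radDensity_le' hw h0
        ⟨by linarith [hs01.1, ht.1], by linarith [ht.2, hδ.2]⟩) (abs_nonneg _)
        zero_le_one).trans (one_mul _).le
  exact tendsto_nhds_unique h2 h4

end FluxIdentity

/-! ### Derivatives of the spherical means -/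

section RadialODE

lemma AbsolutelyContinuousOnInterval.le_of_ae_hasDerivAt_nonneg {f : ℝ → ℝ} {a b : ℝ}
    (hab : a ≤ b) (hf : AbsolutelyContinuousOnInterval f a b)
    (h : ∀ᵐ x, x ∈ Ioo a b → ∃ f', HasDerivAt f f' x ∧ 0 ≤ f') : f a ≤ f b := by
  rw [← sub_nonneg, ← hf.integral_deriv_eq_sub]
  refine intervalIntegral.integral_nonneg_of_ae_restrict hab ?_
  rw [EventuallyLE, ← restrict_Ioo_eq_restrict_Icc, ae_restrict_iff' measurableSet_Ioo]
  filter_upwards [h] with x hx hxab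
  obtain ⟨f', h1, h2⟩ := hx hxab
  rwa [h1.deriv]

variable {E : Type*} [NormedAddCommGroup E] [InnerProductSpace ℝ E] [FiniteDimensional ℝ E]
  [MeasurableSpace E] [BorelSpace E] {w : E → ℝ} {K : NNReal}

lemma abs_sq_sub_sq_sphere_le (hw : LipschitzWith K w) (h0 : w 0 = 0) {s t : ℝ}
    (hs : s ∈ Icc (0 : ℝ) 1) (ht : t ∈ Icc (0 : ℝ) 1) (θ : sphere (0 : E) 1) :
    |w (s • (θ : E)) ^ 2 - w (t • (θ : E)) ^ 2| ≤ 2 * K ^ 2 * |s - t| := by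
  have h1 : |w (s • (θ : E)) - w (t • (θ : E))| ≤ K * |s - t| := by
    have := hw.dist_le_mul (s • (θ : E)) (t • (θ : E))
    rwa [dist_eq_norm, dist_eq_norm, ← sub_smul, norm_smul, norm_eq_of_mem_sphere, mul_one] at this
  have h2 : |w (s • (θ : E)) + w (t • (θ : E))| ≤ 2 * K := by
    have e1 := abs_sphere_le hw h0 hs.1 θ
    have e2 := abs_sphere_le hw h0 ht.1 θ
    have e3 : (K : ℝ) * s ≤ K := mul_le_of_le_one_right K.2 hs.2
    have e4 : (K : ℝ) * t ≤ K := mul_le_of_le_one_right K.2 ht.2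
    exact (abs_add_le _ _).trans (by linarith)
  rw [sq_sub_sq, abs_mul]
  calc _ ≤ 2 * K * (K * |s - t|) := mul_le_mul h2 h1 (abs_nonneg _) (by positivity)
    _ = _ := by ring

lemma lipschitzOnWith_sphMass (hw : LipschitzWith K w) (h0 : w 0 = 0) :
    LipschitzOnWith (Real.toNNReal (2 * K ^ 2 * sphArea E)) (sphMass w) (Icc 0 1) := by
  refine LipschitzOnWith.of_dist_le_mul fun s hs t ht => ?_
  have hV := sphArea_nonneg (E := E)
  rw [Real.coe_toNNReal _ (by positivity), Real.dist_eq, Real.dist_eq, sphMass, sphMass,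
    ← integral_sub (integrable_sq_sphere hw.continuous s) (integrable_sq_sphere hw.continuous t)]
  refine (abs_integral_sphere_le (abs_sq_sub_sq_sphere_le hw h0 hs ht)).trans (le_of_eq ?_)
  ring

lemma hasDerivAt_sphMass (hw : LipschitzWith K w) (h0 : w 0 = 0) {t : ℝ} (ht : t ∈ Ioo (0 : ℝ) 1)
    (hd : ∀ᵐ θ : sphere (0 : E) 1 ∂(volume : Measure E).toSphere,
      DifferentiableAt ℝ w (t • (θ : E))) :
    HasDerivAt (sphMass w) (2 * sphFlux w t) t := by
  have h := hasDerivAt_integral_of_dominated_loc_of_lip (𝕜 := ℝ)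
    (μ := (volume : Measure E).toSphere) (F := fun (s : ℝ) (θ : sphere (0 : E) 1) =>
      w (s • (θ : E)) ^ 2) (F' := fun θ : sphere (0 : E) 1 =>
      2 * (w (t • (θ : E)) * fderiv ℝ w (t • (θ : E)) θ)) (bound := fun _ => 2 * (K : ℝ) ^ 2)
    (Ioo_mem_nhds ht.1 ht.2)
    (.of_forall fun s => (integrable_sq_sphere hw.continuous s).aestronglyMeasurable)
    (integrable_sq_sphere hw.continuous t)
    ((integrable_mul_fderiv_apply_sphere hw h0 ht.1.le).const_mul 2).aestronglyMeasurable
    (.of_forall fun θ => ?_) (integrable_const _) ?_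
  · refine h.2.congr_deriv ?_
    rw [integral_const_mul, sphFlux]
  · refine LipschitzOnWith.of_dist_le_mul fun s hs r hr => ?_
    rw [Real.coe_nnabs, abs_of_nonneg (by positivity), Real.dist_eq, Real.dist_eq]
    exact abs_sq_sub_sq_sphere_le hw h0 ⟨hs.1.le, hs.2.le⟩ ⟨hr.1.le, hr.2.le⟩ θ
  · filter_upwards [hd] with θ hθ
    have h1 : HasDerivAt (fun s : ℝ => s • (θ : E)) (θ : E) t := by
      simpa using (hasDerivAt_id t).smul_const (θ : E)
    have h2 := (hθ.hasFDerivAt.comp_hasDerivAt t h1).pow 2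
    refine h2.congr_deriv ?_
    simp only [Function.comp_apply]
    norm_num
    ring

/-- The radial form of the weighted Dirichlet integral, `∫ |∇w|² |x|^{2-n}` over the ball. -/
def radEnergy (w : E → ℝ) (r : ℝ) : ℝ := ∫ t in 0..r, t * sphEnergy w t

/-- The integral of `t` times the spherical mass. -/
def radMass (w : E → ℝ) (r : ℝ) : ℝ := ∫ t in 0..r, t * sphMass w t

lemma abs_mul_sphEnergy_le (hw : LipschitzWith K w) {t : ℝ} (ht : t ∈ Icc (0 : ℝ) 1) :
    |t * sphEnergy w t| ≤ K ^ 2 * sphArea E := by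
  rw [abs_mul, abs_of_nonneg ht.1]
  exact (mul_le_of_le_one_left (abs_nonneg _) ht.2).trans (abs_sphEnergy_le hw t)

lemma abs_sphMass_le' (hw : LipschitzWith K w) (h0 : w 0 = 0) {t : ℝ} (ht : t ∈ Icc (0 : ℝ) 1) :
    |sphMass w t| ≤ K ^ 2 * sphArea E * t := by
  refine (abs_sphMass_le hw h0 ht.1).trans ?_
  have : t ^ 2 ≤ t := by nlinarith [ht.1, ht.2]
  have hV := sphArea_nonneg (E := E)
  calc (K * t) ^ 2 * sphArea E = K ^ 2 * sphArea E * t ^ 2 := by ring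
    _ ≤ _ := mul_le_mul_of_nonneg_left this (by positivity)

lemma abs_mul_sphMass_le (hw : LipschitzWith K w) (h0 : w 0 = 0) {t : ℝ}
    (ht : t ∈ Icc (0 : ℝ) 1) : |t * sphMass w t| ≤ K ^ 2 * sphArea E := by
  rw [abs_mul, abs_of_nonneg ht.1]
  have hV := sphArea_nonneg (E := E)
  refine (mul_le_of_le_one_left (abs_nonneg _) ht.2).trans ((abs_sphMass_le' hw h0 ht).trans ?_)
  exact mul_le_of_le_one_right (by positivity) ht.2

lemma intervalIntegrable_mul_sphEnergy (hw : LipschitzWith K w) :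
    IntervalIntegrable (fun t => t * sphEnergy w t) volume 0 1 :=
  intervalIntegrable_of_abs_le (measurable_id.mul (measurable_sphEnergy w)) le_rfl zero_le_one
    le_rfl fun _ ht => abs_mul_sphEnergy_le hw ht

lemma intervalIntegrable_mul_sphMass (hw : LipschitzWith K w) (h0 : w 0 = 0) :
    IntervalIntegrable (fun t => t * sphMass w t) volume 0 1 :=
  intervalIntegrable_of_abs_le (measurable_id.mul (measurable_sphMass hw.continuous)) le_rfl
    zero_le_one le_rfl fun _ ht => abs_mul_sphMass_le hw h0 ht

lemma absolutelyContinuous_radEnergy (hw : LipschitzWith K w) :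
    AbsolutelyContinuousOnInterval (radEnergy w) 0 1 :=
  (intervalIntegrable_mul_sphEnergy hw).absolutelyContinuousOnInterval_intervalIntegral (by simp)

lemma abs_intervalIntegral_le {f : ℝ → ℝ} {C r : ℝ} (h0 : 0 ≤ r) (h : ∀ t ∈ Icc 0 r, |f t| ≤ C) :
    |∫ t in 0..r, f t| ≤ C * r := by
  have h1 := intervalIntegral.norm_integral_le_of_norm_le_const (a := 0) (b := r) (f := f) (C := C)
    fun t ht => by
      rw [uIoc_of_le h0] at ht
      exact h t ⟨ht.1.le, ht.2⟩
  rwa [sub_zero, abs_of_nonneg h0] at h1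

lemma hasDerivAt_pow_inv {r : ℝ} (hr : 0 < r) (p : ℕ) :
    HasDerivAt (fun s : ℝ => (s ^ p)⁻¹) (-(p * (r ^ (p + 1))⁻¹)) r := by
  refine (((hasDerivAt_pow p r).inv (pow_ne_zero p hr.ne'))).congr_deriv ?_
  rcases p with _ | q
  · simp
  · simp only [Nat.add_sub_cancel]
    field_simp
    ring

/-- The defect in the radial energy balance. -/
def radDefect (w : E → ℝ) (r : ℝ) : ℝ :=
  radEnergy w r - radMass w r -
    (∫ t in 0..r, radDensity w t) * (r ^ (Module.finrank ℝ E - 2))⁻¹ -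
    ((Module.finrank ℝ E - 2 : ℕ) : ℝ) / 2 * sphMass w r

lemma absolutelyContinuous_radDefect (hw : LipschitzWith K w) (h0 : w 0 = 0) {a b : ℝ}
    (ha : 0 < a) (hab : a ≤ b) (hb : b ≤ 1) :
    AbsolutelyContinuousOnInterval (radDefect w) a b := by
  have hsub : uIcc a b ⊆ uIcc 0 1 := by
    rw [uIcc_of_le hab, uIcc_of_le zero_le_one]
    exact Icc_subset_Icc ha.le hb
  have h1 := (absolutelyContinuous_radEnergy hw).mono hsub
  have h2 : AbsolutelyContinuousOnInterval (radMass w) a b :=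
    ((intervalIntegrable_mul_sphMass hw h0).absolutelyContinuousOnInterval_intervalIntegral
      (c := 0) (by simp)).mono hsub
  have h3 : AbsolutelyContinuousOnInterval (fun r => ∫ t in 0..r, radDensity w t) a b :=
    ((intervalIntegrable_radDensity hw h0 le_rfl zero_le_one
      le_rfl).absolutelyContinuousOnInterval_intervalIntegral (c := 0) (by simp)).mono hsub
  have h4 : AbsolutelyContinuousOnInterval (fun r : ℝ => (r ^ (Module.finrank ℝ E - 2))⁻¹) a b := by
    refine ContDiffOn.absolutelyContinuousOnInterval
      (ContDiffOn.inv (contDiff_id.pow _).contDiffOn fun x hx => ?_)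
    rw [uIcc_of_le hab] at hx
    exact pow_ne_zero _ (ha.trans_le hx.1).ne'
  have h5 : AbsolutelyContinuousOnInterval (sphMass w) a b :=
    LipschitzOnWith.absolutelyContinuousOnInterval ((lipschitzOnWith_sphMass hw h0).mono
      (hsub.trans (by rw [uIcc_of_le zero_le_one])))
  exact ((h1.sub h2).sub (h3.mul h4)).sub (h5.const_mul _)

variable [Nontrivial E]

lemma ae_forall_sphere_differentiableAt (hw : LipschitzWith K w) :
    ∀ᵐ t : ℝ, t ∈ Ioo (0 : ℝ) 1 → ∀ᵐ θ : sphere (0 : E) 1 ∂(volume : Measure E).toSphere,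
      DifferentiableAt ℝ w (t • (θ : E)) := by
  have h := ae_polar hw.ae_differentiableAt
  rw [ae_restrict_iff' measurableSet_Ioi] at h
  filter_upwards [h] with t ht ht' using ht ht'.1

lemma ae_hasDerivAt_radEnergy (hw : LipschitzWith K w) :
    ∀ᵐ r : ℝ, r ∈ Ioo (0 : ℝ) 1 → HasDerivAt (radEnergy w) (r * sphEnergy w r) r := by
  filter_upwards [(intervalIntegrable_mul_sphEnergy hw).ae_hasDerivAt_integral] with r h hr
  exact h (by rw [uIcc_of_le zero_le_one]; exact ⟨hr.1.le, hr.2.le⟩) 0 (by simp)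

lemma ae_hasDerivAt_radDefect (hw : LipschitzWith K w) (h0 : w 0 = 0) (hid : EnergyIdentity w)
    (hn : 2 ≤ Module.finrank ℝ E) :
    ∀ᵐ r : ℝ, r ∈ Ioo (0 : ℝ) 1 → HasDerivAt (radDefect w) 0 r := by
  filter_upwards [ae_hasDerivAt_radEnergy hw, ae_forall_sphere_differentiableAt hw,
    (intervalIntegrable_mul_sphMass hw h0).ae_hasDerivAt_integral,
    (intervalIntegrable_radDensity hw h0 le_rfl zero_le_one le_rfl).ae_hasDerivAt_integral,
    ae_radFlux_eq_integral_radDensity hw h0 hid] with r h1 h2 h3 h4 h5 hr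
  have hr' : r ∈ uIcc (0 : ℝ) 1 := by
    rw [uIcc_of_le zero_le_one]
    exact ⟨hr.1.le, hr.2.le⟩
  have e3 : HasDerivAt (radMass w) (r * sphMass w r) r := h3 hr' 0 (by simp)
  have e4 := h4 hr' 0 (by simp)
  have e5 := h5 hr
  have h := (((h1 hr).sub e3).sub (e4.mul
    (hasDerivAt_pow_inv hr.1 (Module.finrank ℝ E - 2)))).sub
    ((hasDerivAt_sphMass hw h0 hr (h2 hr)).const_mul (((Module.finrank ℝ E - 2 : ℕ) : ℝ) / 2))
  refine h.congr_deriv ?_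
  have hr0 := hr.1.ne'
  obtain ⟨p, hp⟩ : ∃ p, Module.finrank ℝ E = p + 2 := ⟨_, (Nat.sub_add_cancel hn).symm⟩
  rw [← e5, radFlux, radDensity, hp, Nat.add_sub_cancel, show p + 2 - 1 = p + 1 by omega]
  field_simp
  ring

lemma abs_radDefect_le (hw : LipschitzWith K w) (h0 : w 0 = 0) (hn : 2 ≤ Module.finrank ℝ E)
    {r : ℝ} (hr : r ∈ Ioo (0 : ℝ) 1) :
    |radDefect w r| ≤ (4 * K ^ 2 * sphArea E +
      ((Module.finrank ℝ E - 2 : ℕ) : ℝ) / 2 * (K ^ 2 * sphArea E)) * r := by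
  have hr' : ∀ t ∈ Icc 0 r, t ∈ Icc (0 : ℝ) 1 := fun t ht => ⟨ht.1, ht.2.trans hr.2.le⟩
  have hV := sphArea_nonneg (E := E)
  have h1 : |radEnergy w r| ≤ K ^ 2 * sphArea E * r :=
    abs_intervalIntegral_le hr.1.le fun t ht => abs_mul_sphEnergy_le hw (hr' t ht)
  have h2 : |radMass w r| ≤ K ^ 2 * sphArea E * r :=
    abs_intervalIntegral_le hr.1.le fun t ht => abs_mul_sphMass_le hw h0 (hr' t ht)
  have h3 : |(∫ t in 0..r, radDensity w t) * (r ^ (Module.finrank ℝ E - 2))⁻¹| ≤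
      2 * K ^ 2 * sphArea E * r := by
    rw [abs_mul, abs_of_nonneg (inv_nonneg.2 (pow_nonneg hr.1.le _)),
      mul_inv_le_iff₀ (pow_pos hr.1 _)]
    refine abs_intervalIntegral_le (C := r ^ (Module.finrank ℝ E - 2) * (2 * K ^ 2 * sphArea E))
      hr.1.le (fun t ht => ?_) |>.trans (le_of_eq (by ring))
    refine (abs_radDensity_le hw h0 (hr' t ht)).trans (mul_le_mul_of_nonneg_right ?_
      (by positivity))
    calc t ^ (Module.finrank ℝ E - 1) ≤ r ^ (Module.finrank ℝ E - 1) :=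
          pow_le_pow_left₀ ht.1 ht.2 _
      _ ≤ r ^ (Module.finrank ℝ E - 2) := pow_le_pow_of_le_one hr.1.le hr.2.le (by omega)
  have h4 : |((Module.finrank ℝ E - 2 : ℕ) : ℝ) / 2 * sphMass w r| ≤
      ((Module.finrank ℝ E - 2 : ℕ) : ℝ) / 2 * (K ^ 2 * sphArea E * r) := by
    rw [abs_mul, abs_of_nonneg (by positivity)]
    exact mul_le_mul_of_nonneg_left (abs_sphMass_le' hw h0 ⟨hr.1.le, hr.2.le⟩) (by positivity)
  rw [radDefect]
  refine (abs_sub _ _).trans ?_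
  refine (add_le_add ((abs_sub _ _).trans (add_le_add (abs_sub _ _) h3)) h4).trans ?_
  linarith

theorem radDefect_eq_zero (hw : LipschitzWith K w) (h0 : w 0 = 0) (hid : EnergyIdentity w)
    (hn : 2 ≤ Module.finrank ℝ E) {r : ℝ} (hr : r ∈ Ioo (0 : ℝ) 1) : radDefect w r = 0 := by
  obtain ⟨C, hC⟩ : ∃ C, ∀ s ∈ Ioo (0 : ℝ) 1, |radDefect w s| ≤ C * s :=
    ⟨_, fun s hs => abs_radDefect_le hw h0 hn hs⟩
  have hconst : ∀ ε ∈ Ioo 0 r, |radDefect w r| ≤ C * ε := fun ε hε => by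
    obtain ⟨c, hc⟩ := (absolutelyContinuous_radDefect hw h0 hε.1 hε.2.le
      hr.2.le).const_of_ae_hasDerivAt_zero (by
        filter_upwards [ae_hasDerivAt_radDefect hw h0 hid hn] with x hx hx'
        rw [uIcc_of_le hε.2.le] at hx'
        exact hx ⟨hε.1.trans_le hx'.1, hx'.2.trans_lt hr.2⟩)
    rw [uIcc_of_le hε.2.le] at hc
    rw [hc r ⟨hε.2.le, le_rfl⟩, ← hc ε ⟨le_rfl, hε.2.le⟩]
    exact hC ε ⟨hε.1, hε.2.trans hr.2⟩
  have h : Tendsto (fun ε : ℝ => C * ε) (nhdsWithin 0 (Ioi 0)) (nhds 0) := by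
    have : Tendsto (fun ε : ℝ => C * ε) (nhds 0) (nhds (C * 0)) := tendsto_id.const_mul C
    rw [mul_zero] at this
    exact this.mono_left nhdsWithin_le_nhds
  have h2 : |radDefect w r| ≤ 0 := ge_of_tendsto h
    (by filter_upwards [Ioo_mem_nhdsGT hr.1] with ε hε using hconst ε hε)
  exact abs_nonpos_iff.1 h2

end RadialODE

section RadialInequality

lemma exists_radial_exponent {A a b m τ r k : ℝ} (hm : 0 < m) (hA : 0 ≤ A) (ha : 0 ≤ a)
    (hτ : 0 ≤ τ) (hk : 0 ≤ k) (hb : b ^ 2 ≤ m * a) (hAb : A ≤ r * b + (k + r ^ 2) * m) :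
    ∃ γ, 0 ≤ γ ∧ τ = γ * (γ + 2 * k) * m ∧ 2 * (γ - r ^ 2) * A ≤ r ^ 2 * a + τ := by
  have hk2 : 0 ≤ k ^ 2 + τ / m := by positivity
  have hs := Real.sq_sqrt hk2
  have hks : k ≤ √(k ^ 2 + τ / m) := Real.le_sqrt_of_sq_le (by linarith [div_nonneg hτ hm.le])
  obtain ⟨γ, hγ⟩ : ∃ γ, γ = √(k ^ 2 + τ / m) - k := ⟨_, rfl⟩
  have hτγ : τ = γ * (γ + 2 * k) * m := by
    have : γ * (γ + 2 * k) = τ / m := by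
      rw [hγ]
      linear_combination hs
    rw [this, div_mul_cancel₀ _ hm.ne']
  refine ⟨γ, by linarith, hτγ, ?_⟩
  have hra : 0 ≤ r ^ 2 * a := by positivity
  rcases le_total γ (r ^ 2) with h | h
  · nlinarith
  · have h1 : 2 * (γ - r ^ 2) * A ≤ 2 * (γ - r ^ 2) * (r * b + (k + r ^ 2) * m) :=
      mul_le_mul_of_nonneg_left hAb (by linarith)
    refine h1.trans ?_
    have h2 : 0 ≤ m * (r ^ 2 * a + τ - 2 * (γ - r ^ 2) * (r * b + (k + r ^ 2) * m)) := by
      have h3 : r ^ 2 * b ^ 2 ≤ r ^ 2 * (m * a) := mul_le_mul_of_nonneg_left hb (sq_nonneg r)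
      have h4 : 0 ≤ (r * b - (γ - r ^ 2) * m) ^ 2 + m ^ 2 * (2 * r ^ 2 * k + r ^ 4) := by positivity
      rw [hτγ]
      linarith
    linarith [nonneg_of_mul_nonneg_right h2 hm]

variable {E : Type*} [NormedAddCommGroup E] [InnerProductSpace ℝ E] [FiniteDimensional ℝ E]
  [MeasurableSpace E] [BorelSpace E] {w : E → ℝ} {K : NNReal}

lemma neg_le_integral_radDensity (hw : LipschitzWith K w) (h0 : w 0 = 0)
    (hn : 2 ≤ Module.finrank ℝ E) {t B : ℝ} (ht : t ∈ Ioo (0 : ℝ) 1)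
    (hB : ∀ s ∈ Icc 0 t, sphMass w s ≤ B) (hB0 : 0 ≤ B) :
    -(B * t ^ Module.finrank ℝ E / 2) ≤ ∫ s in 0..t, radDensity w s := by
  have h1 : ∫ s in 0..t, -(B * s ^ (Module.finrank ℝ E - 1)) =
      -(B * (t ^ Module.finrank ℝ E / Module.finrank ℝ E)) := by
    rw [intervalIntegral.integral_neg, intervalIntegral.integral_const_mul, integral_pow]
    have h2 : (((Module.finrank ℝ E - 1 : ℕ) : ℝ) + 1) = Module.finrank ℝ E := by
      exact_mod_cast Nat.sub_add_cancel (by omega : 1 ≤ Module.finrank ℝ E)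
    rw [h2, Nat.sub_add_cancel (by omega), zero_pow (by omega), sub_zero]
  calc -(B * t ^ Module.finrank ℝ E / 2)
      ≤ -(B * (t ^ Module.finrank ℝ E / Module.finrank ℝ E)) := by
        rw [mul_div_assoc]
        refine neg_le_neg (mul_le_mul_of_nonneg_left ?_ hB0)
        exact div_le_div_of_nonneg_left (pow_nonneg ht.1.le _) two_pos (by exact_mod_cast hn)
    _ = ∫ s in 0..t, -(B * s ^ (Module.finrank ℝ E - 1)) := h1.symm
    _ ≤ _ := by
        refine intervalIntegral.integral_mono_on ht.1.le
          (Continuous.intervalIntegrable (by fun_prop) _ _)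
          (intervalIntegrable_radDensity hw h0 le_rfl ht.1.le ht.2.le) fun s hs => ?_
        have h2 := hB s hs
        have h3 := sphEnergy_nonneg w s
        have h4 : 0 ≤ s ^ (Module.finrank ℝ E - 1) := pow_nonneg hs.1 _
        rw [radDensity]
        nlinarith

lemma radEnergy_nonneg (w : E → ℝ) {r : ℝ} (hr : 0 ≤ r) : 0 ≤ radEnergy w r :=
  intervalIntegral.integral_nonneg hr fun t ht => mul_nonneg ht.1 (sphEnergy_nonneg w t)

variable [Nontrivial E]

lemma radMass_le (hw : LipschitzWith K w) (h0 : w 0 = 0) (hid : EnergyIdentity w)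
    (hn : 2 ≤ Module.finrank ℝ E) {r : ℝ} (hr : r ∈ Ioo (0 : ℝ) 1) :
    radMass w r ≤ r ^ 2 * sphMass w r := by
  have hL := lipschitzOnWith_sphMass hw h0
  obtain ⟨ρ, hρ, hmax⟩ := isCompact_Icc.exists_isMaxOn (nonempty_Icc.2 hr.1.le)
    (hL.continuousOn.mono (Icc_subset_Icc_right hr.2.le))
  set B := sphMass w ρ with hBdef
  have hB0 : 0 ≤ B := sphMass_nonneg w ρ
  have hB : ∀ s ∈ Icc 0 r, sphMass w s ≤ B := fun s hs => hmax hs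
  have hac : AbsolutelyContinuousOnInterval (fun t => sphMass w t + B * t ^ 2 / 2) ρ r := by
    refine AbsolutelyContinuousOnInterval.add (LipschitzOnWith.absolutelyContinuousOnInterval
      (hL.mono ?_)) (ContDiffOn.absolutelyContinuousOnInterval ?_)
    · rw [uIcc_of_le hρ.2]
      exact Icc_subset_Icc hρ.1 hr.2.le
    · exact ContDiff.contDiffOn (by fun_prop)
  have hmono := hac.le_of_ae_hasDerivAt_nonneg hρ.2 (by
    filter_upwards [ae_forall_sphere_differentiableAt hw,
      ae_radFlux_eq_integral_radDensity hw h0 hid] with t h1 h2 ht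
    have ht1 : t ∈ Ioo (0 : ℝ) 1 := ⟨hρ.1.trans_lt ht.1, ht.2.trans hr.2⟩
    refine ⟨_, (hasDerivAt_sphMass hw h0 ht1 (h1 ht1)).add
      (((hasDerivAt_pow 2 t).const_mul B).div_const 2), ?_⟩
    have h3 := neg_le_integral_radDensity hw h0 hn ht1
      (fun s hs => hB s ⟨hs.1, hs.2.trans ht.2.le⟩) hB0
    rw [← h2 ht1, radFlux, show t ^ Module.finrank ℝ E = t ^ (Module.finrank ℝ E - 1) * t by
      rw [← pow_succ, Nat.sub_add_cancel (by omega)]] at h3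
    have h4 : 0 ≤ t ^ (Module.finrank ℝ E - 1) * (2 * sphFlux w t + B * t) := by linarith
    have h5 := nonneg_of_mul_nonneg_right h4 (pow_pos ht1.1 _)
    norm_num
    linarith)
  have hI : radMass w r ≤ B * r ^ 2 / 2 := by
    have h1 : ∫ t in 0..r, t * B = B * r ^ 2 / 2 := by
      rw [intervalIntegral.integral_mul_const, integral_id]
      ring
    rw [← h1]
    refine intervalIntegral.integral_mono_on hr.1.le
      (intervalIntegrable_of_abs_le (measurable_id.mul (measurable_sphMass hw.continuous)) le_rfl
        hr.1.le hr.2.le fun _ ht => abs_mul_sphMass_le hw h0 ht)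
      (Continuous.intervalIntegrable (by fun_prop) _ _) fun t ht =>
      mul_le_mul_of_nonneg_left (hB t ht) ht.1
  have h1 : B / 2 ≤ sphMass w r := by
    have h2 : r ^ 2 ≤ 1 := pow_le_one₀ hr.1.le hr.2.le
    have h3 : 0 ≤ B * ρ ^ 2 / 2 := by positivity
    have h4 : B * r ^ 2 ≤ B * 1 := mul_le_mul_of_nonneg_left h2 hB0
    simp only [← hBdef] at hmono
    linarith
  calc radMass w r ≤ r ^ 2 * (B / 2) := hI.trans (le_of_eq (by ring))
    _ ≤ _ := mul_le_mul_of_nonneg_left h1 (sq_nonneg r)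

theorem ae_radEnergy_growth (hw : LipschitzWith K w) (h0 : w 0 = 0) (hid : EnergyIdentity w)
    (hn : 2 ≤ Module.finrank ℝ E) :
    ∀ᵐ r : ℝ, r ∈ Ioo (0 : ℝ) 1 → radEnergy w r = 0 ∨ (0 < sphMass w r ∧ ∃ γ, 0 ≤ γ ∧
      ∫ θ : sphere (0 : E) 1, tangSq w r θ ∂(volume : Measure E).toSphere =
        γ * (γ + Module.finrank ℝ E - 2) * sphMass w r ∧
      2 * (γ - r ^ 2) * radEnergy w r ≤ r * (r * sphEnergy w r)) := by
  filter_upwards [ae_radFlux_eq_integral_radDensity hw h0 hid] with r h1 hr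
  obtain ⟨k, hk⟩ : ∃ k : ℝ, k = ((Module.finrank ℝ E - 2 : ℕ) : ℝ) / 2 := ⟨_, rfl⟩
  have hk0 : 0 ≤ k := by rw [hk]; positivity
  have hkn : 2 * k = Module.finrank ℝ E - 2 := by
    rw [hk, Nat.cast_sub hn]
    push_cast
    ring
  have hA := radEnergy_nonneg w hr.1.le
  have hAb : radEnergy w r ≤ r * sphFlux w r + (k + r ^ 2) * sphMass w r := by
    have h2 := radDefect_eq_zero hw h0 hid hn hr
    have h3 := radMass_le hw h0 hid hn hr
    have h4 : radFlux w r * (r ^ (Module.finrank ℝ E - 2))⁻¹ = r * sphFlux w r := by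
      have : r ^ (Module.finrank ℝ E - 1) = r ^ (Module.finrank ℝ E - 2) * r := by
        rw [← pow_succ]
        congr 1
        omega
      rw [radFlux, this]
      have := (pow_pos hr.1 (Module.finrank ℝ E - 2)).ne'
      field_simp
    rw [radDefect, ← h1 hr, h4, ← hk] at h2
    linarith
  have hb := sphFlux_sq_le hw h0 hr.1.le
  set a := ∫ θ : sphere (0 : E) 1, fderiv ℝ w (r • (θ : E)) θ ^ 2 ∂(volume : Measure E).toSphere
  have ha : 0 ≤ a := integral_nonneg fun _ => sq_nonneg _
  rcases (sphMass_nonneg w r).eq_or_lt with hm | hm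
  · left
    rw [← hm, zero_mul] at hb
    have : sphFlux w r = 0 := pow_eq_zero_iff two_ne_zero |>.1 (le_antisymm hb (sq_nonneg _))
    rw [this, ← hm] at hAb
    linarith
  · right
    refine ⟨hm, ?_⟩
    obtain ⟨γ, h2, h3, h4⟩ := exists_radial_exponent hm hA ha
      (integral_nonneg fun θ => tangSq_nonneg w r (norm_eq_of_mem_sphere θ)) hk0 hb hAb
    refine ⟨γ, h2, ?_, ?_⟩
    · rw [h3, hkn]
      ring
    · refine h4.trans (le_of_eq ?_)
      rw [← sq_mul_sphEnergy hw r]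
      ring

end RadialInequality

/-! ### Monotonicity of the product of weighted energies -/

section ProductMonotonicity

variable {E : Type*} [NormedAddCommGroup E] [InnerProductSpace ℝ E] [FiniteDimensional ℝ E]
  [MeasurableSpace E] [BorelSpace E] [Nontrivial E] {w : E → ℝ} {K : NNReal}

lemma pow_mul_zpow_two_sub {n : ℕ} (hn : 1 ≤ n) {s : ℝ} (hs : 0 < s) :
    s ^ (n - 1) * s ^ ((2 : ℤ) - n) = s := by
  rw [← zpow_natCast, ← zpow_add₀ hs.ne', Nat.cast_sub hn]
  norm_num

lemma integral_ball_eq_radEnergy (hw : LipschitzWith K w) {r : ℝ} (hr : 0 < r) :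
    ∫ x in ball (0 : E) r, ‖gradient w x‖ ^ 2 * ‖x‖ ^ ((2 : ℤ) - (Module.finrank ℝ E : ℤ)) =
      radEnergy w r := by
  have hn : 1 ≤ Module.finrank ℝ E := Module.finrank_pos
  have hdom : IntegrableOn (fun x : E => (K : ℝ) ^ 2 * ‖x‖ ^ ((2 : ℤ) - (Module.finrank ℝ E : ℤ)))
      (ball 0 r) := by
    refine (integrableOn_fun_norm_addHaar volume
      (f := fun s => (K : ℝ) ^ 2 * s ^ ((2 : ℤ) - (Module.finrank ℝ E : ℤ)))).2 ?_
    have h1 : IntegrableOn (fun s : ℝ => (K : ℝ) ^ 2 * s) (Ioo 0 r) :=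
      (Continuous.integrableOn_Icc (by fun_prop)).mono_set Ioo_subset_Icc_self
    refine h1.congr_fun (fun s hs => ?_) measurableSet_Ioo
    simp only [smul_eq_mul]
    rw [mul_left_comm, pow_mul_zpow_two_sub hn hs.1]
  have h_int : IntegrableOn
      (fun x : E => ‖gradient w x‖ ^ 2 * ‖x‖ ^ ((2 : ℤ) - (Module.finrank ℝ E : ℤ)))
      (ball 0 r) := by
    refine hdom.mono' (Measurable.aestronglyMeasurable ?_) (.of_forall fun x => ?_)
    · exact ((measurable_gradient w).norm.pow_const 2).mul
        ((measurable_id.pow_const _).comp measurable_norm)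
    · rw [Real.norm_of_nonneg (by positivity), norm_gradient]
      exact mul_le_mul_of_nonneg_right (norm_fderiv_sq_le hw x) (by positivity)
  rw [← integral_indicator measurableSet_ball,
    (integral_polar (h_int.integrable_indicator measurableSet_ball)).2, radEnergy,
    intervalIntegral.integral_of_le hr.le, integral_Ioc_eq_integral_Ioo]
  rw [setIntegral_eq_of_subset_of_forall_sdiff_eq_zero measurableSet_Ioi
    (fun t ht => ht.1 : Ioo 0 r ⊆ Ioi 0) fun t ht => ?_]
  · refine setIntegral_congr_fun measurableSet_Ioo fun s hs => ?_
    have h1 : ∀ θ : sphere (0 : E) 1, (ball (0 : E) r).indicator (fun x : E =>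
        ‖gradient w x‖ ^ 2 * ‖x‖ ^ ((2 : ℤ) - (Module.finrank ℝ E : ℤ))) (s • (θ : E)) =
        s ^ ((2 : ℤ) - (Module.finrank ℝ E : ℤ)) * ‖fderiv ℝ w (s • (θ : E))‖ ^ 2 := fun θ => by
      have h2 : ‖s • (θ : E)‖ = s := by
        rw [norm_smul, norm_eq_of_mem_sphere, mul_one, Real.norm_of_nonneg hs.1.le]
      rw [indicator_of_mem (by rw [mem_ball_zero_iff, h2]; exact hs.2), norm_gradient, h2, mul_comm]
    simp only [h1]
    rw [integral_const_mul, ← mul_assoc, pow_mul_zpow_two_sub hn hs.1, sphEnergy]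
  · have h0 : 0 < t := ht.1
    have h1 : r ≤ t := not_lt.1 fun h => ht.2 ⟨h0, h⟩
    have h2 : ∀ θ : sphere (0 : E) 1, (ball (0 : E) r).indicator (fun x : E =>
        ‖gradient w x‖ ^ 2 * ‖x‖ ^ ((2 : ℤ) - (Module.finrank ℝ E : ℤ))) (t • (θ : E)) = 0 := by
      intro θ
      refine indicator_of_notMem ?_ _
      rw [mem_ball_zero_iff, norm_smul, norm_eq_of_mem_sphere, mul_one, Real.norm_of_nonneg h0.le]
      exact not_lt.2 h1
    simp only [h2, integral_zero, mul_zero]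

lemma exp_mul_deriv_nonneg {r A₁ A₂ D₁ D₂ : ℝ} (hr : 0 < r) (hr1 : r < 1)
    (h : 4 * (1 - r ^ 2) * (A₁ * A₂) ≤ r * (D₁ * A₂ + A₁ * D₂)) (hA : 0 ≤ A₁ * A₂) :
    0 ≤ (4 * Real.exp (4 * r) * (r ^ 4)⁻¹ + Real.exp (4 * r) * -(4 * (r ^ 5)⁻¹)) * (A₁ * A₂) +
      Real.exp (4 * r) * (r ^ 4)⁻¹ * (D₁ * A₂ + A₁ * D₂) := by
  have h1 : (4 * Real.exp (4 * r) * (r ^ 4)⁻¹ + Real.exp (4 * r) * -(4 * (r ^ 5)⁻¹)) * (A₁ * A₂) +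
      Real.exp (4 * r) * (r ^ 4)⁻¹ * (D₁ * A₂ + A₁ * D₂) =
      Real.exp (4 * r) * (r ^ 5)⁻¹ * (r * (D₁ * A₂ + A₁ * D₂) - 4 * (1 - r) * (A₁ * A₂)) := by
    field_simp
    ring
  rw [h1]
  have h2 : 4 * (1 - r) * (A₁ * A₂) ≤ 4 * (1 - r ^ 2) * (A₁ * A₂) :=
    mul_le_mul_of_nonneg_right (by nlinarith) hA
  exact mul_nonneg (by positivity) (by linarith)

theorem exp_mul_radEnergy_mul_radEnergy_le (hn : 2 ≤ Module.finrank ℝ E) {w₁ w₂ : E → ℝ}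
    {K₁ K₂ : NNReal} (hw₁ : LipschitzWith K₁ w₁) (hw₂ : LipschitzWith K₂ w₂)
    (h₁ : ∀ x, 0 ≤ w₁ x) (h₂ : ∀ x, 0 ≤ w₂ x) (h12 : ∀ x, w₁ x * w₂ x = 0)
    (hz₁ : w₁ 0 = 0) (hz₂ : w₂ 0 = 0) (hid₁ : EnergyIdentity w₁) (hid₂ : EnergyIdentity w₂)
    {a b : ℝ} (ha : 0 < a) (hab : a ≤ b) (hb : b < 1) :
    Real.exp (4 * a) * (a ^ 4)⁻¹ * (radEnergy w₁ a * radEnergy w₂ a) ≤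
      Real.exp (4 * b) * (b ^ 4)⁻¹ * (radEnergy w₁ b * radEnergy w₂ b) := by
  have hsub : uIcc a b ⊆ uIcc 0 1 := by
    rw [uIcc_of_le hab, uIcc_of_le zero_le_one]
    exact Icc_subset_Icc ha.le hb.le
  have hac : AbsolutelyContinuousOnInterval (fun r : ℝ => Real.exp (4 * r) * (r ^ 4)⁻¹) a b := by
    refine ContDiffOn.absolutelyContinuousOnInterval (ContDiffOn.mul
      (ContDiff.contDiffOn (by fun_prop))
      (ContDiffOn.inv (contDiff_id.pow _).contDiffOn fun x hx => ?_))
    rw [uIcc_of_le hab] at hx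
    exact (pow_pos (ha.trans_le hx.1) _).ne'
  refine (hac.mul (((absolutelyContinuous_radEnergy hw₁).mono hsub).mul
    ((absolutelyContinuous_radEnergy hw₂).mono hsub))).le_of_ae_hasDerivAt_nonneg hab ?_
  filter_upwards [ae_hasDerivAt_radEnergy hw₁, ae_hasDerivAt_radEnergy hw₂,
    ae_radEnergy_growth hw₁ hz₁ hid₁ hn, ae_radEnergy_growth hw₂ hz₂ hid₂ hn,
    ae_forall_sphere_differentiableAt hw₁, ae_forall_sphere_differentiableAt hw₂]
    with r hD₁ hD₂ hg₁ hg₂ hd₁ hd₂ hr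
  have hr1 : r ∈ Ioo (0 : ℝ) 1 := ⟨ha.trans hr.1, hr.2.trans hb⟩
  have he : HasDerivAt (fun s : ℝ => Real.exp (4 * s)) (4 * Real.exp (4 * r)) r := by
    refine ((hasDerivAt_id r).const_mul 4).exp.congr_deriv ?_
    simp [mul_comm]
  refine ⟨_, (he.mul (hasDerivAt_pow_inv hr1.1 4)).mul ((hD₁ hr1).mul (hD₂ hr1)), ?_⟩
  have hA₁ := radEnergy_nonneg w₁ hr1.1.le
  have hA₂ := radEnergy_nonneg w₂ hr1.1.le
  have hE₁ : 0 ≤ r * sphEnergy w₁ r := mul_nonneg hr1.1.le (sphEnergy_nonneg w₁ r)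
  have hE₂ : 0 ≤ r * sphEnergy w₂ r := mul_nonneg hr1.1.le (sphEnergy_nonneg w₂ r)
  refine exp_mul_deriv_nonneg hr1.1 hr1.2 ?_ (mul_nonneg hA₁ hA₂)
  have hR : 0 ≤ r * (r * sphEnergy w₁ r * radEnergy w₂ r + radEnergy w₁ r * (r * sphEnergy w₂ r)) :=
    mul_nonneg hr1.1.le (add_nonneg (mul_nonneg hE₁ hA₂) (mul_nonneg hA₁ hE₂))
  rcases hg₁ hr1 with hg | ⟨hm₁, γ₁, hγ₁, hτ₁, hi₁⟩
  · rwa [show radEnergy w₁ r * radEnergy w₂ r = 0 by rw [hg, zero_mul], mul_zero]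
  rcases hg₂ hr1 with hg | ⟨hm₂, γ₂, hγ₂, hτ₂, hi₂⟩
  · rwa [show radEnergy w₁ r * radEnergy w₂ r = 0 by rw [hg, mul_zero], mul_zero]
  have hγ := two_le_add_of_tangSq_le hn hw₁ hw₂ h₁ h₂ h12 hr1.1 (hd₁ hr1) (hd₂ hr1) hm₁ hm₂ hγ₁ hγ₂
    hτ₁.le hτ₂.le
  have i₁ := mul_le_mul_of_nonneg_right hi₁ hA₂
  have i₂ := mul_le_mul_of_nonneg_left hi₂ hA₁
  have i₃ : 0 ≤ (γ₁ + γ₂ - 2) * (radEnergy w₁ r * radEnergy w₂ r) :=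
    mul_nonneg (by linarith) (mul_nonneg hA₁ hA₂)
  linarith

end ProductMonotonicity

/-! ### Solutions of the Helmholtz equation -/

section Helmholtz

variable {N : ℕ}

lemma acf_eq_radEnergy (hN : 2 ≤ N) {v V : EuclideanSpace ℝ (Fin N) → ℝ} {K : NNReal}
    (hV : LipschitzWith K V) (h : EqOn v V (ball 0 1)) {r : ℝ} (hr : 0 < r) (hr1 : r ≤ 1) :
    acf N v r = (r ^ 4)⁻¹ * (radEnergy (fun x => max (V x) 0) r *
      radEnergy (fun x => max (-V x) 0) r) := by
  have : Nontrivial (EuclideanSpace ℝ (Fin N)) :=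
    Module.nontrivial_of_finrank_pos (R := ℝ) (by rw [finrank_euclideanSpace_fin]; omega)
  have key : ∀ w W : EuclideanSpace ℝ (Fin N) → ℝ, LipschitzWith K W → EqOn w W (ball 0 1) →
      ∫ x in ball (0 : EuclideanSpace ℝ (Fin N)) r,
        ‖gradient w x‖ ^ 2 * ‖x‖ ^ ((2 : ℤ) - (N : ℤ)) = radEnergy W r := by
    intro w W hW hwW
    rw [← integral_ball_eq_radEnergy hW hr, finrank_euclideanSpace_fin]
    refine setIntegral_congr_fun measurableSet_ball fun x hx => ?_
    have hx1 : ball (0 : EuclideanSpace ℝ (Fin N)) 1 ∈ nhds x :=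
      isOpen_ball.mem_nhds (ball_subset_ball hr1 hx)
    have hg : gradient w x = gradient W x := by
      rw [gradient, gradient, (hwW.eventuallyEq_of_mem hx1).fderiv_eq]
    simp only [hg]
  rw [acf, key _ _ (hV.max_const 0) fun x hx => by simp only [h hx],
    key _ (fun x => max (-V x) 0) (hV.neg.max_const 0) fun x hx => by simp only [h hx], mul_assoc]
  norm_cast

lemma exists_lipschitz_bounded_extension {E : Type*} [NormedAddCommGroup E] {v : E → ℝ}
    {K : NNReal} (hv : LipschitzOnWith K v (ball 0 1)) (h0 : v 0 = 0) :
    ∃ V : E → ℝ, LipschitzWith K V ∧ (∀ x, |V x| ≤ K) ∧ EqOn v V (ball 0 1) := by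
  obtain ⟨g, hg, hgv⟩ := hv.extend_real
  refine ⟨fun x => min (max (g x) (-K)) K, (hg.max_const _).min_const _, fun x => ?_,
    fun x hx => ?_⟩
  · rw [abs_le]
    exact ⟨le_min (le_max_right _ _) (by linarith [K.2]), min_le_right _ _⟩
  · have h1 := hv.dist_le_mul x hx 0 (mem_ball_self one_pos)
    rw [h0, dist_zero_right, dist_zero_right, Real.norm_eq_abs] at h1
    have h2 : |v x| ≤ K := h1.trans (mul_le_of_le_one_right K.2 (mem_ball_zero_iff.1 hx).le)
    rw [abs_le] at h2
    simp only [← hgv hx]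
    rw [max_eq_left h2.1, min_eq_left h2.2]

lemma lipschitzOnWith_fderiv_apply {F : Type*} [NormedAddCommGroup F] [InnerProductSpace ℝ F]
    [FiniteDimensional ℝ F] [MeasurableSpace F] [BorelSpace F] {u : F → ℝ} {K : NNReal} {s : Set F}
    (h : LipschitzOnWith K (gradient u) s) {e : F} (he : ‖e‖ = 1) :
    LipschitzOnWith K (fun x => fderiv ℝ u x e) s := by
  refine LipschitzOnWith.of_dist_le_mul fun x hx y hy => ?_
  refine le_trans ?_ (h.dist_le_mul x hx y hy)
  rw [← inner_gradient, ← inner_gradient, dist_eq_norm, dist_eq_norm, ← inner_sub_right]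
  exact (norm_inner_le_norm _ _).trans (by rw [he, one_mul])

lemma energyIdentity_max {V : EuclideanSpace ℝ (Fin N) → ℝ} {K W : NNReal}
    (hV : LipschitzWith K V) (hW : ∀ x, |V x| ≤ W) {U : Set (EuclideanSpace ℝ (Fin N))}
    (hU : IsOpen U) (hB : ∀ x ∈ ball 0 1, x ∉ U → V x ≤ 0)
    (hweak : ∀ ψ : EuclideanSpace ℝ (Fin N) → ℝ, ContDiff ℝ (⊤ : ℕ∞) ψ → HasCompactSupport ψ →
      tsupport ψ ⊆ U → ∫ x, V x * (lap N ψ x + ψ x) = 0) :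
    EnergyIdentity (fun x => max (V x) 0) :=
  fun _ _ hη hc hs => integral_mul_sq_gradient_max hV hW hU hB hweak hη hc hs

theorem monotoneOn_exp_mul_acf (hN : 2 ≤ N) {Ω : Set (EuclideanSpace ℝ (Fin N))}
    {u : EuclideanSpace ℝ (Fin N) → ℝ} (hΩ : IsOpen Ω) (hu : ContDiff ℝ 1 u) {K : NNReal}
    (hK : LipschitzOnWith K (gradient u) (ball (0 : EuclideanSpace ℝ (Fin N)) 1))
    (heq : ∀ φ : EuclideanSpace ℝ (Fin N) → ℝ, ContDiff ℝ (⊤ : ℕ∞) φ →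
      tsupport φ ⊆ ball (0 : EuclideanSpace ℝ (Fin N)) 1 →
      ∫ x, u x * (lap N φ x + φ x) = ∫ x in Ω, φ x)
    (hz : ∀ x ∈ ball (0 : EuclideanSpace ℝ (Fin N)) 1 \ Ω, gradient u x = 0)
    (h0 : (0 : EuclideanSpace ℝ (Fin N)) ∉ Ω) {e : EuclideanSpace ℝ (Fin N)} (he : ‖e‖ = 1) :
    MonotoneOn (fun ρ => Real.exp (4 * ρ) * acf N (fun x => fderiv ℝ u x e) ρ) (Ioo 0 1) := by
  have : Nontrivial (EuclideanSpace ℝ (Fin N)) :=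
    Module.nontrivial_of_finrank_pos (R := ℝ) (by rw [finrank_euclideanSpace_fin]; omega)
  have hvz : ∀ x ∈ ball (0 : EuclideanSpace ℝ (Fin N)) 1 \ Ω, fderiv ℝ u x e = 0 := fun x hx => by
    rw [← inner_gradient, hz x hx, inner_zero_right]
  have hmem : (0 : EuclideanSpace ℝ (Fin N)) ∈ ball (0 : EuclideanSpace ℝ (Fin N)) 1 :=
    mem_ball_self one_pos
  obtain ⟨V, hV, hVb, hVe⟩ :=
    exists_lipschitz_bounded_extension (lipschitzOnWith_fderiv_apply hK he) (hvz 0 ⟨hmem, h0⟩)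
  have hVz : ∀ x ∈ ball (0 : EuclideanSpace ℝ (Fin N)) 1, x ∉ Ω ∩ ball 0 1 → V x = 0 := by
    intro x hx hxU
    rw [← hVe hx]
    exact hvz x ⟨hx, fun h => hxU ⟨h, hx⟩⟩
  have hV0 : V 0 = 0 := hVz 0 hmem fun h => h0 h.1
  have hU : IsOpen (Ω ∩ ball 0 1) := hΩ.inter isOpen_ball
  have hweak : ∀ ψ : EuclideanSpace ℝ (Fin N) → ℝ, ContDiff ℝ (⊤ : ℕ∞) ψ → HasCompactSupport ψ →
      tsupport ψ ⊆ Ω ∩ ball 0 1 → ∫ x, V x * (lap N ψ x + ψ x) = 0 := by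
    intro ψ hψ hc hs
    rw [← integral_fderiv_mul_lap_add_eq_zero hu heq e hψ hc hs]
    refine integral_congr_ae (.of_forall fun x => ?_)
    by_cases hx : x ∈ tsupport ψ
    · simp only [hVe (hs hx).2]
    · have h1 : ψ x = 0 := image_eq_zero_of_notMem_tsupport hx
      have h2 : lap N ψ x = 0 :=
        image_eq_zero_of_notMem_tsupport fun h => hx (tsupport_lap_subset ψ h)
      simp only [h1, h2, add_zero, mul_zero]
  have hid₁ := energyIdentity_max hV hVb hU (fun x hx h => (hVz x hx h).le) hweak
  have hVn : LipschitzWith K (fun x => -V x) := hV.neg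
  have hid₂ := energyIdentity_max hVn (fun x => (abs_neg (V x)).le.trans (hVb x)) hU
    (fun x hx h => by rw [hVz x hx h, neg_zero]) fun ψ hψ hc hs => by
      simp only [neg_mul, integral_neg, hweak ψ hψ hc hs, neg_zero]
  intro a ha b hb hab
  simp only
  rw [acf_eq_radEnergy hN hV hVe ha.1 ha.2.le, acf_eq_radEnergy hN hV hVe hb.1 hb.2.le,
    ← mul_assoc (Real.exp _), ← mul_assoc (Real.exp _)]
  refine exp_mul_radEnergy_mul_radEnergy_le (by rw [finrank_euclideanSpace_fin]; exact hN)
    (hV.max_const 0) (hVn.max_const 0) (fun x => le_max_right _ _) (fun x => le_max_right _ _)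
    (fun x => ?_) (by simp [hV0]) (by simp [hV0]) hid₁ hid₂ ha.1 hab hb.2
  rcases le_total (V x) 0 with h | h
  · rw [max_eq_right h, zero_mul]
  · simp [h]

end Helmholtz

/-- almost-monotonicity of the ACF functional for the Helmholtz operator. -/
theorem acf_almost_monotone_helmholtz (N : ℕ) (hN : 2 ≤ N) (M : ℝ) (hM : 0 < M) :
    ∃ C : ℝ, 0 < C ∧ ∃ r₀ : ℝ, 0 < r₀ ∧ r₀ < 1 ∧
      ∀ (Ω : Set (EuclideanSpace ℝ (Fin N))) (u : EuclideanSpace ℝ (Fin N) → ℝ),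
        IsOpen Ω → ContDiff ℝ 1 u →
        (∃ K : NNReal, LipschitzOnWith K (gradient u) (ball (0 : EuclideanSpace ℝ (Fin N)) 1)) →
        (∀ φ : EuclideanSpace ℝ (Fin N) → ℝ, ContDiff ℝ (⊤ : ℕ∞) φ →
          tsupport φ ⊆ ball (0 : EuclideanSpace ℝ (Fin N)) 1 →
          ∫ x, u x * (lap N φ x + φ x) = ∫ x in Ω, φ x) →
        (∀ x ∈ ball (0 : EuclideanSpace ℝ (Fin N)) 1 \ Ω, u x = 0 ∧ gradient u x = 0) →
        (∀ x ∈ ball (0 : EuclideanSpace ℝ (Fin N)) 1, |u x| ≤ M) →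
        (0 : EuclideanSpace ℝ (Fin N)) ∈ frontier Ω →
        ∀ e : EuclideanSpace ℝ (Fin N), ‖e‖ = 1 →
          MonotoneOn (fun ρ => Real.exp (C * ρ) * acf N (fun x => fderiv ℝ u x e) ρ)
            (Set.Ioo 0 r₀) := by
  refine ⟨4, by norm_num, 1 / 2, by norm_num, by norm_num, ?_⟩
  intro Ω u hΩ hu ⟨K, hK⟩ heq hz _ h0 e he
  have h0Ω : (0 : EuclideanSpace ℝ (Fin N)) ∉ Ω := fun h =>
    (disjoint_frontier_iff_isOpen.2 hΩ).le_bot ⟨h0, h⟩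
  exact (monotoneOn_exp_mul_acf hN hΩ hu hK heq (fun x hx => (hz x hx).2) h0Ω he).mono
    (Ioo_subset_Ioo_right (by norm_num))
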